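/- Let A_S be an Artin-Tits group, s,t ∈ S, g ∈ A_S⁺∖{1} and let g = g₁⋯g_n be the Adyan normal decomposition of g. If gs = tg, then there exists a sequence s_0 = t, s_1, …, s_n = s of elements of S such that g_i s_i = s_{i−1} g_i for all i ∈ {1,…,n}. -/

import Mathlib

/-!
Common definitions for formalizing "Normalisateur des sous-groupes paraboliques
des groupes d'Artin-Tits" (E. Godelle).

We fix a Coxeter matrix `M` over a finite index set `B` (Mathlib's convention:
`M s t = 0` encodes `m_{s,t} = ∞`).  The Artin-Tits group `Artin M` is the
presented group on the braid relations, the Coxeter group is Mathlib's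
`M.Group`, and `proj : Artin M →* M.Group` is the canonical projection
(adding the relations `s² = 1`).
-/

namespace ArtinTitsPaper

open List

variable {B : Type*}

/-- The alternating list `[s, t, s, t, ...]` with `n` terms, starting with `s`. -/
def altList (s t : B) : ℕ → List B
  | 0 => []
  | n + 1 => s :: altList t s n

/-- The braid relators `(sts⋯)(tst⋯)⁻¹` (`m_{s,t}` letters each) for `s ≠ t`,
`m_{s,t} ≠ ∞`. -/
def braidRels (M : CoxeterMatrix B) : Set (FreeGroup B) :=
  { r | ∃ s t : B, s ≠ t ∧ M s t ≠ 0 ∧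
      r = ((altList s t (M s t)).map FreeGroup.of).prod *
          (((altList t s (M s t)).map FreeGroup.of).prod)⁻¹ }

/-- The Artin-Tits group associated to the Coxeter matrix `M`. -/
def Artin (M : CoxeterMatrix B) : Type _ := PresentedGroup (braidRels M)

instance (M : CoxeterMatrix B) : Group (Artin M) :=
  QuotientGroup.Quotient.group _

/-- The standard generator of `Artin M` indexed by `s : B` (the image of `S` in `A_S`). -/
def gen (M : CoxeterMatrix B) (s : B) : Artin M := PresentedGroup.of s

theorem altList_eq_reverse_alternatingWord (s t : B) (n : ℕ) :
    altList s t n = (CoxeterSystem.alternatingWord t s n).reverse := by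
  induction n generalizing s t with
  | zero => rfl
  | succ n ih =>
      rw [altList, CoxeterSystem.alternatingWord_succ, List.concat_eq_append,
        List.reverse_append]
      simp [ih]

theorem lift_simple_listProd (M : CoxeterMatrix B) (l : List B) :
    FreeGroup.lift M.simple ((l.map FreeGroup.of).prod) =
      M.toCoxeterSystem.wordProd l := by
  rw [CoxeterSystem.wordProd, map_list_prod, List.map_map]
  simp [Function.comp_def, CoxeterMatrix.toCoxeterSystem_simple]

theorem braid_lift (M : CoxeterMatrix B) :
    ∀ r ∈ braidRels M, FreeGroup.lift M.simple r = 1 := by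
  rintro r ⟨s, t, hst, hm, rfl⟩
  rw [map_mul, map_inv, lift_simple_listProd, lift_simple_listProd,
    altList_eq_reverse_alternatingWord, altList_eq_reverse_alternatingWord,
    CoxeterSystem.wordProd_reverse, CoxeterSystem.wordProd_reverse]
  have hsym : M s t = M t s := M.symmetric s t
  have hb := M.toCoxeterSystem.wordProd_braidWord_eq t s
  rw [CoxeterSystem.braidWord, CoxeterSystem.braidWord, ← hsym] at hb
  rw [hb]
  simp

/-- The canonical projection from the Artin-Tits group onto the Coxeter group
(adding the relations `s² = 1`). -/
def proj (M : CoxeterMatrix B) : Artin M →* M.Group :=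
  PresentedGroup.toGroup (braid_lift M)

/-- The positive monoid `A_S⁺`, the submonoid of `A_S` generated by `S`. -/
def posMon (M : CoxeterMatrix B) : Submonoid (Artin M) :=
  Submonoid.closure (Set.range (gen M))

/-- The submonoid `A_X⁺` of `A_S` generated by `X ⊆ S`. -/
def posMonOn (M : CoxeterMatrix B) (X : Set B) : Submonoid (Artin M) :=
  Submonoid.closure (gen M '' X)

/-- The standard parabolic subgroup `A_X` of `A_S` generated by `X ⊆ S`. -/
def stdSub (M : CoxeterMatrix B) (X : Set B) : Subgroup (Artin M) :=
  Subgroup.closure (gen M '' X)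

/-- The standard parabolic subgroup `W_X` of the Coxeter group `W_S`. -/
def coxSub (M : CoxeterMatrix B) (X : Set B) : Subgroup M.Group :=
  Subgroup.closure (M.simple '' X)

/-- `X ⊆ S` is of spherical type if the Coxeter group `W_X` is finite. -/
def IsSpherical (M : CoxeterMatrix B) (X : Set B) : Prop :=
  Finite (coxSub M X)

/-- `a` left-divides `b` in the positive monoid: `b = a c` with `c ∈ A_S⁺`. -/
def ldvd (M : CoxeterMatrix B) (a b : Artin M) : Prop :=
  ∃ c ∈ posMon M, a * c = b

/-- `a` right-divides `b` in the positive monoid: `b = c a` with `c ∈ A_S⁺`. -/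
def rdvd (M : CoxeterMatrix B) (a b : Artin M) : Prop :=
  ∃ c ∈ posMon M, c * a = b

/-- `d` is the least common multiple `Δ_X` of `X` in `A_X⁺` (for left-divisibility). -/
def IsDelta (M : CoxeterMatrix B) (X : Set B) (d : Artin M) : Prop :=
  d ∈ posMonOn M X ∧
  (∀ s ∈ X, ∃ c ∈ posMonOn M X, gen M s * c = d) ∧
  ∀ m ∈ posMonOn M X, (∀ s ∈ X, ∃ c ∈ posMonOn M X, gen M s * c = m) →
    ∃ c ∈ posMonOn M X, d * c = m

/-- The subset `Xg = {σ_x g : x ∈ X}` of `A_S`. -/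
def leftMul (M : CoxeterMatrix B) (X : Set B) (g : Artin M) : Set (Artin M) :=
  (fun x => gen M x * g) '' X

/-- The subset `gX = {g σ_x : x ∈ X}` of `A_S`. -/
def rightMul (M : CoxeterMatrix B) (X : Set B) (g : Artin M) : Set (Artin M) :=
  (fun x => g * gen M x) '' X

/-- `Conj(S;X,Y) = {g ∈ A_S : gX = Yg}`. -/
def conjSet (M : CoxeterMatrix B) (X Y : Set B) : Set (Artin M) :=
  { g | rightMul M X g = leftMul M Y g }

/-- `Conj⁺(S;X,Y) = {g ∈ A_S⁺ : gX = Yg}`. -/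
def conjPos (M : CoxeterMatrix B) (X Y : Set B) : Set (Artin M) :=
  { g | g ∈ posMon M ∧ rightMul M X g = leftMul M Y g }

/-- The quasi-centralizer `QZ_{A_S}(A_X) = {g ∈ A_S : gX = Xg}`. -/
def QZset (M : CoxeterMatrix B) (X : Set B) : Set (Artin M) :=
  conjSet M X X

/-- The indecomposable component of `Z` containing `t` (vertices of `Z` joined to `t`
by a path of edges `m_{a,b} ≠ 2` in the Coxeter diagram on `Z`). -/
def comp (M : CoxeterMatrix B) (Z : Set B) (t : B) : Set B :=
  { s ∈ Z | Relation.ReflTransGen (fun a b => a ∈ Z ∧ b ∈ Z ∧ a ≠ b ∧ M a b ≠ 2) t s }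

/-- `Z` is indecomposable: it admits no nontrivial partition `Z = Z₁ ∪ Z₂` with
`m_{a,b} = 2` for `a ∈ Z₁`, `b ∈ Z₂`. -/
def Indecomp (M : CoxeterMatrix B) (Z : Set B) : Prop :=
  ¬ ∃ Z₁ Z₂ : Set B, Z₁.Nonempty ∧ Z₂.Nonempty ∧ Z₁ ∪ Z₂ = Z ∧ Disjoint Z₁ Z₂ ∧
      ∀ a ∈ Z₁, ∀ b ∈ Z₂, M a b = 2

/-- `g` is an elementary positive `Y`-ribbon-`X`: `g = d_{X,t}` for some `t ∈ S` with
`X(t)` of spherical type, where `d_{X,t} = Δ_{X(t)}` if `t ∈ X` and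
`d_{X,t} = Δ_{X(t)} Δ_{X(t)∖{t}}⁻¹` otherwise, and `Y ⊆ X ∪ {t}` satisfies `Yg = gX`. -/
def IsElemRibbon (M : CoxeterMatrix B) (X Y : Set B) (g : Artin M) : Prop :=
  ∃ t : B, IsSpherical M (comp M (X ∪ {t}) t) ∧
    ((t ∈ X ∧ IsDelta M (comp M (X ∪ {t}) t) g) ∨
      (t ∉ X ∧ ∃ d₁ d₂ : Artin M, IsDelta M (comp M (X ∪ {t}) t) d₁ ∧
        IsDelta M ((comp M (X ∪ {t}) t) \ {t}) d₂ ∧ g = d₁ * d₂⁻¹)) ∧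
    Y ⊆ X ∪ {t} ∧ leftMul M Y g = rightMul M X g

/-- `g` is a positive `Y`-ribbon-`X`: a product `g = g_n ⋯ g_1` of elementary positive
`X_i`-ribbons-`X_{i-1}` with `X_0 = X`, `X_n = Y`. -/
inductive IsRibbon (M : CoxeterMatrix B) : Set B → Set B → Artin M → Prop
  | nil (X : Set B) : IsRibbon M X X 1
  | cons {X Y Z : Set B} {g h : Artin M} :
      IsRibbon M X Y g → IsElemRibbon M Y Z h → IsRibbon M X Z (h * g)

/-- `g` is `X`-reduced: no element of `X` left-divides `g`. -/
def lreduced (M : CoxeterMatrix B) (X : Set B) (g : Artin M) : Prop :=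
  ∀ s ∈ X, ¬ ldvd M (gen M s) g

/-- `g` is reduced-`X`: no element of `X` right-divides `g`. -/
def rreduced (M : CoxeterMatrix B) (X : Set B) (g : Artin M) : Prop :=
  ∀ s ∈ X, ¬ rdvd M (gen M s) g

/-- The set `H_X` of elements `g₁ g₂⁻¹` where `g₁, g₂` are `X`-reduced positive
`X`-ribbons-`X`. -/
def HXset (M : CoxeterMatrix B) (X : Set B) : Set (Artin M) :=
  { g | ∃ g₁ g₂ : Artin M, IsRibbon M X X g₁ ∧ lreduced M X g₁ ∧
      IsRibbon M X X g₂ ∧ lreduced M X g₂ ∧ g = g₁ * g₂⁻¹ }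

/-- The length of a positive element (the common length of its expressions as words
in the generators; junk value `0` outside of `A_S⁺`). -/
noncomputable def len (M : CoxeterMatrix B) (g : Artin M) : ℕ :=
  sInf { n | ∃ l : List B, l.length = n ∧ (l.map (gen M)).prod = g }

/-- The length of an element of the Coxeter group `W_S`. -/
noncomputable def wlen (M : CoxeterMatrix B) (w : M.Group) : ℕ :=
  sInf { n | ∃ l : List B, l.length = n ∧ (l.map M.simple).prod = w }

/-- `g ∈ A_{S,red}`: `g` is positive and has the same length as its image in `W_S`. -/
def Red (M : CoxeterMatrix B) (g : Artin M) : Prop :=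
  g ∈ posMon M ∧ len M g = wlen M (proj M g)

/-- `C` is a simple `s`-chain-`u`: either `C = 1` and `s = u`, or
`C = tst⋯` (`k` letters, `k < m_{s,t}`) with `u ∈ {s,t}` and `C·u = tst⋯` (`k+1` letters). -/
def IsSimpleChain (M : CoxeterMatrix B) (s u : B) (C : Artin M) : Prop :=
  (C = 1 ∧ s = u) ∨
  ∃ t : B, t ≠ s ∧ (u = s ∨ u = t) ∧ ∃ k : ℕ,
    (M s t = 0 ∨ k < M s t) ∧
    C = ((altList t s k).map (gen M)).prod ∧
    C * gen M u = ((altList t s (k + 1)).map (gen M)).prod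

/-- `C` is an `s`-chain-`t`: a product `C₁ ⋯ C_k` of simple chains composing from
origin `s` to target `t`. -/
inductive IsChain (M : CoxeterMatrix B) : B → B → Artin M → Prop
  | single {s u : B} {C : Artin M} : IsSimpleChain M s u C → IsChain M s u C
  | comp {s u v : B} {C D : Artin M} :
      IsChain M s u C → IsSimpleChain M u v D → IsChain M s v (C * D)


section Roots

variable {V : Type*}

open Classical in
/-- The simple root indexed by `x`. -/
noncomputable def sroot (x : V) : V → ℤ := fun y => if y = x then 1 else 0

theorem sroot_same (x : V) : sroot x x = 1 := by simp [sroot]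

theorem sroot_of_ne {x y : V} (h : y ≠ x) : sroot x y = 0 := by simp [sroot, h]

theorem sroot_injective : Function.Injective (sroot : V → V → ℤ) := by
  intro x y h
  by_contra hne
  have := congrFun h x
  rw [sroot_same, sroot_of_ne hne] at this
  omega

variable [Fintype V] (G : SimpleGraph V)

open Classical in
/-- The pairing of `β` with the simple coroot indexed by `x`. -/
noncomputable def pairing (x : V) (β : V → ℤ) : ℤ :=
  2 * β x - ∑ y, if G.Adj x y then β y else 0

/-- The simple reflection indexed by `x`. -/
noncomputable def srefl (x : V) (β : V → ℤ) : V → ℤ := β - pairing G x β • sroot x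

/-- The height of a vector of the root lattice. -/
def height (β : V → ℤ) : ℤ := ∑ y, β y

theorem height_sroot (x : V) : height (sroot x) = 1 := by
  classical simp [height, sroot]

theorem pairing_sub (x : V) (β γ : V → ℤ) :
    pairing G x (β - γ) = pairing G x β - pairing G x γ := by
  classical
  simp only [pairing, Pi.sub_apply]
  have : (∑ y, if G.Adj x y then β y - γ y else 0) =
      (∑ y, if G.Adj x y then β y else 0) - ∑ y, if G.Adj x y then γ y else 0 := by
    rw [← Finset.sum_sub_distrib]
    refine Finset.sum_congr rfl fun y _ => ?_
    split_ifs <;> simp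
  rw [this]; ring

theorem pairing_smul (x : V) (k : ℤ) (β : V → ℤ) :
    pairing G x (k • β) = k * pairing G x β := by
  classical
  simp only [pairing, Pi.smul_apply, smul_eq_mul]
  have : (∑ y, if G.Adj x y then k * β y else 0) =
      k * ∑ y, if G.Adj x y then β y else 0 := by
    rw [Finset.mul_sum]
    refine Finset.sum_congr rfl fun y _ => ?_
    split_ifs <;> simp
  rw [this]; ring

theorem pairing_sroot_same (x : V) : pairing G x (sroot x) = 2 := by
  classical
  have : (∑ y, if G.Adj x y then sroot x y else 0) = 0 :=
    Finset.sum_eq_zero fun y _ => by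
      split_ifs with h
      · exact sroot_of_ne h.ne'
      · rfl
  simp [pairing, this, sroot_same]

variable {G}

theorem pairing_sroot_adj {x y : V} (h : G.Adj x y) : pairing G x (sroot y) = -1 := by
  classical
  have : (∑ z, if G.Adj x z then sroot y z else 0) = 1 := by
    rw [Finset.sum_eq_single y]
    · simp [h, sroot_same]
    · intro z _ hz; simp [sroot_of_ne hz]
    · simp
  simp [pairing, this, sroot_of_ne h.ne]

theorem pairing_sroot_orth {x y : V} (hne : x ≠ y) (h : ¬ G.Adj x y) :
    pairing G x (sroot y) = 0 := by
  classical
  have : (∑ z, if G.Adj x z then sroot y z else 0) = 0 :=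
    Finset.sum_eq_zero fun z _ => by
      split_ifs with h'
      · exact sroot_of_ne (by rintro rfl; exact h h')
      · rfl
  simp [pairing, this, sroot_of_ne hne]

theorem pairing_srefl_same (x : V) (β : V → ℤ) :
    pairing G x (srefl G x β) = - pairing G x β := by
  rw [srefl, pairing_sub, pairing_smul, pairing_sroot_same]; ring

theorem pairing_srefl_adj {x y : V} (h : G.Adj x y) (β : V → ℤ) :
    pairing G x (srefl G y β) = pairing G x β + pairing G y β := by
  rw [srefl, pairing_sub, pairing_smul, pairing_sroot_adj h]; ring

theorem pairing_srefl_orth {x y : V} (hne : x ≠ y) (h : ¬ G.Adj x y) (β : V → ℤ) :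
    pairing G x (srefl G y β) = pairing G x β := by
  rw [srefl, pairing_sub, pairing_smul, pairing_sroot_orth hne h]; ring

theorem srefl_srefl (x : V) (β : V → ℤ) : srefl G x (srefl G x β) = β := by
  rw [srefl, pairing_srefl_same, srefl]; simp

theorem srefl_of_pairing_eq_zero {x : V} {β : V → ℤ} (h : pairing G x β = 0) :
    srefl G x β = β := by simp [srefl, h]

theorem srefl_apply_same (x : V) (β : V → ℤ) :
    srefl G x β x = β x - pairing G x β := by simp [srefl, sroot_same]

theorem srefl_apply_of_ne {x y : V} (h : y ≠ x) (β : V → ℤ) : srefl G x β y = β y := by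
  simp [srefl, sroot_of_ne h]

theorem srefl_comm {x y : V} (hne : x ≠ y) (h : ¬ G.Adj x y) (β : V → ℤ) :
    srefl G x (srefl G y β) = srefl G y (srefl G x β) := by
  ext z
  simp only [srefl, pairing_sub, pairing_smul, pairing_sroot_orth hne h,
    pairing_sroot_orth hne.symm fun h' => h h'.symm, Pi.sub_apply, Pi.smul_apply, smul_eq_mul]
  ring

theorem srefl_braid {x y : V} (h : G.Adj x y) (β : V → ℤ) :
    srefl G x (srefl G y (srefl G x β)) = srefl G y (srefl G x (srefl G y β)) := by
  ext z
  simp only [srefl, pairing_sub, pairing_smul, pairing_sroot_same, pairing_sroot_adj h,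
    pairing_sroot_adj h.symm, Pi.sub_apply, Pi.smul_apply, smul_eq_mul]
  ring

theorem height_srefl (x : V) (β : V → ℤ) :
    height (srefl G x β) = height β - pairing G x β := by
  have := height_sroot x
  simp only [height] at this ⊢
  simp only [srefl, Pi.sub_apply, Pi.smul_apply, smul_eq_mul, Finset.sum_sub_distrib,
    ← Finset.mul_sum, this, mul_one]

theorem srefl_sroot_same (x : V) : srefl G x (sroot x) = - sroot x := by
  rw [srefl, pairing_sroot_same]; module

theorem srefl_sroot_orth {x y : V} (hne : x ≠ y) (h : ¬ G.Adj x y) :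
    srefl G x (sroot y) = sroot y := srefl_of_pairing_eq_zero (pairing_sroot_orth hne h)

theorem srefl_sroot_adj {x y : V} (h : G.Adj x y) :
    srefl G x (sroot y) = srefl G y (sroot x) := by
  rw [srefl, srefl, pairing_sroot_adj h, pairing_sroot_adj h.symm]; module

theorem srefl_srefl_sroot_adj {x y : V} (h : G.Adj x y) :
    srefl G x (srefl G y (sroot x)) = sroot y := by
  rw [← srefl_sroot_adj h, srefl_srefl]

theorem eq_srefl_iff {x : V} {β γ : V → ℤ} : srefl G x β = γ ↔ β = srefl G x γ := by
  constructor <;> rintro rfl <;> rw [srefl_srefl]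

variable (G) in
/-- Positive real roots, obtained from simple roots by height-increasing simple reflections. -/
inductive PosRoot : (V → ℤ) → Prop
  | simple (x : V) : PosRoot (sroot x)
  | raise {x : V} {β : V → ℤ} : PosRoot β → pairing G x β < 0 → PosRoot (srefl G x β)

theorem PosRoot.nonneg {β : V → ℤ} (h : PosRoot G β) (y : V) : 0 ≤ β y := by
  induction h with
  | simple x => by_cases hy : y = x <;> simp [sroot, hy]
  | @raise x β _ hx ih =>
    by_cases hy : y = x
    · subst hy; rw [srefl_apply_same]; omega
    · rwa [srefl_apply_of_ne hy]

theorem PosRoot.height_pos {β : V → ℤ} (h : PosRoot G β) : 0 < height β := by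
  induction h with
  | simple x => rw [height_sroot]; norm_num
  | raise _ hx ih => rw [height_srefl]; omega

variable (G) in
/-- Triangle-freeness of a graph. -/
def TriangleFree : Prop := ∀ x y z : V, G.Adj x y → G.Adj y z → ¬ G.Adj x z

theorem PosRoot.srefl_aux (n : ℕ) : ∀ {β : V → ℤ}, height β < n → PosRoot G β → ∀ s,
    β ≠ sroot s → PosRoot G (srefl G s β) := by
  induction n with
  | zero => intro β h hβ; exact absurd hβ.height_pos (by simpa using h.le)
  | succ n IH =>
  intro β hh hβ s hs
  cases hβ with
  | simple t =>
    have hst : s ≠ t := fun h => hs (by rw [h])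
    by_cases h : G.Adj s t
    · exact (PosRoot.simple t).raise (by rw [pairing_sroot_adj h]; norm_num)
    · rw [srefl_sroot_orth hst h]; exact .simple t
  | @raise t γ hγ ht =>
    have hlt : height γ < n := by rw [height_srefl] at hh; push_cast at hh; omega
    by_cases hst : s = t
    · subst hst; rwa [srefl_srefl]
    by_cases hadj : G.Adj s t
    swap
    · have hγs : γ ≠ sroot s := by
        rintro rfl
        rw [pairing_sroot_orth (Ne.symm hst) fun h => hadj h.symm] at ht; omega
      rw [srefl_comm hst hadj]
      exact (IH hlt hγ s hγs).raise
        (by rwa [pairing_srefl_orth (Ne.symm hst) fun h => hadj h.symm])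
    rcases lt_trichotomy (pairing G s (srefl G t γ)) 0 with h | h | h
    · exact (hγ.raise ht).raise h
    · rw [srefl_of_pairing_eq_zero h]; exact hγ.raise ht
    have h' := h
    rw [pairing_srefl_adj hadj] at h'
    by_cases hγs : γ = sroot s
    · subst hγs
      rw [srefl_srefl_sroot_adj hadj]; exact .simple t
    have h1 := IH hlt hγ s hγs
    have hl1 : height (srefl G s γ) < n := by rw [height_srefl]; omega
    by_cases h1t : srefl G s γ = sroot t
    · rw [eq_srefl_iff] at h1t; subst h1t
      rw [srefl_srefl_sroot_adj hadj.symm, pairing_sroot_same] at *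
      rw [pairing_srefl_adj hadj.symm, pairing_sroot_same, pairing_sroot_adj hadj] at ht
      omega
    have h2 := IH hl1 h1 t h1t
    have e : srefl G t (srefl G s (srefl G t (srefl G s γ))) = srefl G s (srefl G t γ) := by
      rw [srefl_braid hadj.symm, srefl_srefl]
    rw [← e]
    have h3 : PosRoot G (srefl G s (srefl G t (srefl G s γ))) := h2.raise (by
      rw [pairing_srefl_adj hadj, pairing_srefl_adj hadj.symm, pairing_srefl_same]; omega)
    refine h3.raise ?_
    rw [srefl_braid hadj, pairing_srefl_same, pairing_srefl_adj hadj.symm,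
      pairing_srefl_same, pairing_srefl_adj hadj]
    omega

theorem PosRoot.srefl {β : V → ℤ} (hβ : PosRoot G β) {s : V} (hs : β ≠ sroot s) :
    PosRoot G (srefl G s β) :=
  PosRoot.srefl_aux (height β + 1).toNat (by have := hβ.height_pos; omega) hβ s hs

theorem PosRoot.exists_lower {β : V → ℤ} (hβ : PosRoot G β) (h : ∀ x, β ≠ sroot x) :
    ∃ t, 0 < pairing G t β := by
  cases hβ with
  | simple x => exact absurd rfl (h x)
  | @raise x γ hγ hx => exact ⟨x, by rw [pairing_srefl_same]; omega⟩

end Roots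

section StructureConstants

variable {V : Type*} [Fintype V] {G : SimpleGraph V}

theorem ne_sroot_of_pairing {r t : V} {β : V → ℤ}
    (h : pairing G r β ≠ pairing G r (sroot t)) : β ≠ sroot t := fun e => h (by rw [e])

open Classical in
variable (G) in
/-- The integers attached to a generator and a positive root which define the
Lawrence–Krammer–Paris representation. -/
noncomputable def lkp (s : V) (β : V → ℤ) : ℤ :=
  if β = sroot s then 2
  else if 0 < pairing G s β then 0
  else if h : PosRoot G β ∧ ∀ x, β ≠ sroot x then
    let t := (h.1.exists_lower h.2).choose
    if G.Adj s t then
      if pairing G s (srefl G t β) < 0 then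
        lkp s (srefl G t β) + 2 * lkp t (srefl G t β)
      else if pairing G s (srefl G t β) = 0 then
        2 * lkp t (srefl G t β) - lkp s (srefl G t β)
      else 2 * lkp t (srefl G s (srefl G t β))
    else lkp s (srefl G t β)
  else 1
termination_by (height β).toNat
decreasing_by
  all_goals
    have h1 := (h.1.exists_lower h.2).choose_spec
    have h2 := h.1.height_pos
    have ht : t = (h.1.exists_lower h.2).choose := rfl
    rw [← ht] at h1 ⊢
    clear_value t
    simp only [height_srefl]
    omega

open Classical in
variable (G) in
/-- The value at `(s, t γ)` prescribed by the recursion defining `lkp`. -/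
noncomputable def lkpStep (s t : V) (γ : V → ℤ) : ℤ :=
  if G.Adj s t then
    if pairing G s γ < 0 then lkp G s γ + 2 * lkp G t γ
    else if pairing G s γ = 0 then 2 * lkp G t γ - lkp G s γ
    else 2 * lkp G t (srefl G s γ)
  else lkp G s γ

theorem lkp_self (s : V) : lkp G s (sroot s) = 2 := by rw [lkp]; simp

theorem lkp_of_pos {s : V} {β : V → ℤ} (h : 0 < pairing G s β) (hne : β ≠ sroot s) :
    lkp G s β = 0 := by rw [lkp]; simp [hne, h]

theorem lkp_sroot {s t : V} (hne : t ≠ s) : lkp G s (sroot t) = 1 := by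
  rw [lkp, if_neg fun h => hne (sroot_injective h), if_neg, dif_neg]
  · rintro ⟨_, h⟩; exact h t rfl
  · by_cases h : G.Adj s t
    · rw [pairing_sroot_adj h]; norm_num
    · rw [pairing_sroot_orth hne.symm h]; norm_num

theorem exists_lkp_eq_step {s : V} {β : V → ℤ} (hβ : PosRoot G β) (hs : pairing G s β ≤ 0)
    (h : ∀ x, β ≠ sroot x) :
    ∃ t, 0 < pairing G t β ∧ lkp G s β = lkpStep G s t (srefl G t β) := by
  refine ⟨(hβ.exists_lower h).choose, (hβ.exists_lower h).choose_spec, ?_⟩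
  rw [lkp, if_neg (h s), if_neg (by omega), dif_pos ⟨hβ, h⟩]
  rfl

theorem lkpStep_orth {s t : V} {γ : V → ℤ} (h : ¬ G.Adj s t) :
    lkpStep G s t γ = lkp G s γ := by simp [lkpStep, h]

theorem lkpStep_neg {s t : V} {γ : V → ℤ} (h : G.Adj s t) (hs : pairing G s γ < 0) :
    lkpStep G s t γ = lkp G s γ + 2 * lkp G t γ := by simp [lkpStep, h, hs]

theorem lkpStep_zero {s t : V} {γ : V → ℤ} (h : G.Adj s t) (hs : pairing G s γ = 0) :
    lkpStep G s t γ = 2 * lkp G t γ - lkp G s γ := by simp [lkpStep, h, hs]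

theorem lkpStep_pos {s t : V} {γ δ : V → ℤ} (h : G.Adj s t) (hs : 0 < pairing G s γ)
    (e : srefl G s γ = δ) : lkpStep G s t γ = 2 * lkp G t δ := by
  simp [lkpStep, h, hs.not_gt, hs.ne', e]

variable (G) in
/-- The recursion for `lkp` holds for every lowering of roots of height below `n`. -/
def LowerRule (n : ℤ) : Prop :=
  ∀ β, PosRoot G β → height β < n → ∀ s t, pairing G s β ≤ 0 → 0 < pairing G t β →
    β ≠ sroot t → lkp G s β = lkpStep G s t (srefl G t β)

namespace LowerRule

variable {n : ℤ} {β γ δ : V → ℤ} {s t : V}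

theorem orth (H : LowerRule G n) (hβ : PosRoot G β) (hn : height β < n) (h : ¬ G.Adj s t)
    (hs : pairing G s β ≤ 0) (ht : 0 < pairing G t β) (hne : β ≠ sroot t)
    (e : srefl G t β = γ) : lkp G s β = lkp G s γ := by
  rw [H β hβ hn s t hs ht hne, e, lkpStep_orth h]

theorem neg (H : LowerRule G n) (hβ : PosRoot G β) (hn : height β < n) (h : G.Adj s t)
    (hs : pairing G s β ≤ 0) (ht : 0 < pairing G t β) (hne : β ≠ sroot t)
    (e : srefl G t β = γ) (hγ : pairing G s γ < 0) :
    lkp G s β = lkp G s γ + 2 * lkp G t γ := by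
  rw [H β hβ hn s t hs ht hne, e, lkpStep_neg h hγ]

theorem zero (H : LowerRule G n) (hβ : PosRoot G β) (hn : height β < n) (h : G.Adj s t)
    (hs : pairing G s β ≤ 0) (ht : 0 < pairing G t β) (hne : β ≠ sroot t)
    (e : srefl G t β = γ) (hγ : pairing G s γ = 0) :
    lkp G s β = 2 * lkp G t γ - lkp G s γ := by
  rw [H β hβ hn s t hs ht hne, e, lkpStep_zero h hγ]

theorem pos (H : LowerRule G n) (hβ : PosRoot G β) (hn : height β < n) (h : G.Adj s t)
    (hs : pairing G s β ≤ 0) (ht : 0 < pairing G t β) (hne : β ≠ sroot t)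
    (e : srefl G t β = γ) (hγ : 0 < pairing G s γ) (e' : srefl G s γ = δ) :
    lkp G s β = 2 * lkp G t δ := by
  rw [H β hβ hn s t hs ht hne, e, lkpStep_pos h hγ e']

end LowerRule

end StructureConstants

section Recursion

variable {V : Type*} [Fintype V] {G : SimpleGraph V}

section Independence

variable {n : ℤ} {β : V → ℤ} {s t r : V}

theorem lkpStep_indep_orth_left (H : LowerRule G n) (hβ : PosRoot G β)
    (hn : height β ≤ n) (hsimple : ∀ x, β ≠ sroot x) (hs : pairing G s β ≤ 0)
    (ht : 0 < pairing G t β) (hr : 0 < pairing G r β) (hst : s ≠ t) (hsr : s ≠ r) (htr : t ≠ r)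
    (nst : ¬ G.Adj s t) (nsr : ¬ G.Adj s r) :
    lkpStep G s t (srefl G t β) = lkpStep G s r (srefl G r β) := by
  have Pst := pairing_srefl_orth hst nst
  have Psr := pairing_srefl_orth hsr nsr
  have Pt := pairing_srefl_same (G := G) t
  have Pr := pairing_srefl_same (G := G) r
  have hγ := hβ.srefl (hsimple t)
  have hδ := hβ.srefl (hsimple r)
  rw [lkpStep_orth nst, lkpStep_orth nsr]
  by_cases atr : G.Adj t r
  · have Ptr := pairing_srefl_adj atr
    have Prt := pairing_srefl_adj atr.symm
    by_cases h : srefl G t β = sroot r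
    · have h' : srefl G r β = sroot t := by
        rw [eq_srefl_iff.1 h, srefl_srefl_sroot_adj atr.symm]
      rw [h, h', lkp_sroot hsr.symm, lkp_sroot hst.symm]
    have h' : srefl G r β ≠ sroot t := fun h' => h (by
        rw [eq_srefl_iff.1 h', srefl_srefl_sroot_adj atr])
    have k1 := hγ.srefl h
    have k2 := hδ.srefl h'
    rw [H.orth hγ (by rw [height_srefl]; omega) nsr (by rw [Pst]; exact hs)
        (by rw [Prt]; omega) h rfl,
      H.orth hδ (by rw [height_srefl]; omega) nst (by rw [Psr]; exact hs)
        (by rw [Ptr]; omega) h' rfl,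
      H.orth k1 (by simp only [height_srefl, Prt]; omega) nst (by rw [Psr, Pst]; exact hs)
        (by simp only [Ptr, Prt, Pt]; omega)
        (ne_sroot_of_pairing (G := G) (r := r) (by
          simp only [Pr, Prt, pairing_sroot_adj atr.symm]; omega)) rfl,
      H.orth k2 (by simp only [height_srefl, Ptr]; omega) nsr (by rw [Pst, Psr]; exact hs)
        (by simp only [Ptr, Prt, Pr]; omega)
        (ne_sroot_of_pairing (G := G) (r := t) (by
          simp only [Pt, Ptr, pairing_sroot_adj atr]; omega)) rfl,
      srefl_braid atr]
  · have Ptr := pairing_srefl_orth htr atr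
    have Prt := pairing_srefl_orth htr.symm fun h => atr h.symm
    rw [H.orth hγ (by rw [height_srefl]; omega) nsr (by rw [Pst]; exact hs)
        (by rw [Prt]; omega) (fun h => hsimple r (by
          rw [eq_srefl_iff.1 h, srefl_sroot_orth htr atr])) rfl,
      H.orth hδ (by rw [height_srefl]; omega) nst (by rw [Psr]; exact hs)
        (by rw [Ptr]; omega) (fun h => hsimple t (by
          rw [eq_srefl_iff.1 h, srefl_sroot_orth htr.symm fun h => atr h.symm])) rfl,
      srefl_comm htr atr]

theorem lkpStep_indep_adj_orth (H : LowerRule G n) (hβ : PosRoot G β)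
    (hn : height β ≤ n) (hsimple : ∀ x, β ≠ sroot x) (hs : pairing G s β ≤ 0)
    (ht : 0 < pairing G t β) (hr : 0 < pairing G r β) (hsr : s ≠ r) (htr : t ≠ r)
    (ast : G.Adj s t) (nsr : ¬ G.Adj s r) (ntr : ¬ G.Adj t r) :
    lkpStep G s t (srefl G t β) = lkpStep G s r (srefl G r β) := by
  have nrt : ¬ G.Adj r t := fun h => ntr h.symm
  have nrs : ¬ G.Adj r s := fun h => nsr h.symm
  have Pst := pairing_srefl_adj ast
  have Pts := pairing_srefl_adj ast.symm
  have Psr := pairing_srefl_orth hsr nsr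
  have Ptr := pairing_srefl_orth htr ntr
  have Prt := pairing_srefl_orth htr.symm nrt
  have Prs := pairing_srefl_orth hsr.symm nrs
  have Pt := pairing_srefl_same (G := G) t
  have hγ := hβ.srefl (hsimple t)
  have hδ := hβ.srefl (hsimple r)
  have eδ : srefl G r (srefl G t β) = srefl G t (srefl G r β) := srefl_comm htr.symm nrt β
  have hne : srefl G t β ≠ sroot r := fun h => hsimple r (by
    rw [eq_srefl_iff.1 h, srefl_sroot_orth htr ntr])
  have hne' : srefl G r β ≠ sroot t := fun h => hsimple t (by
    rw [eq_srefl_iff.1 h, srefl_sroot_orth htr.symm nrt])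
  rw [lkpStep_orth nsr]
  have gt : lkp G t (srefl G t β) = lkp G t (srefl G t (srefl G r β)) :=
    H.orth hγ (by rw [height_srefl]; omega) ntr (by rw [Pt]; omega)
      (by rw [Prt]; exact hr) hne eδ
  have gs (h : pairing G s (srefl G t β) ≤ 0) :
      lkp G s (srefl G t β) = lkp G s (srefl G t (srefl G r β)) :=
    H.orth hγ (by rw [height_srefl]; omega) nsr h (by rw [Prt]; exact hr) hne eδ
  have lδ : height (srefl G r β) < n := by rw [height_srefl]; omega
  rcases lt_trichotomy (pairing G s (srefl G t β)) 0 with h | h | h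
  · rw [lkpStep_neg ast h, H.neg hδ lδ ast (by rw [Psr]; exact hs) (by rw [Ptr]; exact ht)
      hne' rfl (by simp only [Pst, Psr, Ptr] at h ⊢; exact h), gt, gs h.le]
  · rw [lkpStep_zero ast h, H.zero hδ lδ ast (by rw [Psr]; exact hs) (by rw [Ptr]; exact ht)
      hne' rfl (by simp only [Pst, Psr, Ptr] at h ⊢; exact h), gt, gs h.le]
  · have hγs : srefl G t β ≠ sroot s := ne_sroot_of_pairing (G := G) (r := r) (by
      rw [Prt, pairing_sroot_orth hsr.symm nrs]; exact hr.ne')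
    rw [lkpStep_pos ast h rfl, H.pos hδ lδ ast (by rw [Psr]; exact hs) (by rw [Ptr]; exact ht)
      hne' rfl (by simp only [Pst, Psr, Ptr] at h ⊢; exact h) rfl]
    rw [H.orth (hγ.srefl hγs) (by simp only [height_srefl]; omega) ntr
      (by simp only [Pts, Pst, Pt] at h ⊢; omega) (by simp only [Prs, Prt]; exact hr)
      (ne_sroot_of_pairing (G := G) (r := s) (by
        rw [pairing_srefl_same, pairing_sroot_orth hsr nsr]; omega))
      (srefl_comm hsr.symm nrs _), eδ]

theorem lkpStep_indep_path (H : LowerRule G n) (hβ : PosRoot G β)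
    (hn : height β ≤ n) (hsimple : ∀ x, β ≠ sroot x) (hs : pairing G s β ≤ 0)
    (ht : 0 < pairing G t β) (hr : 0 < pairing G r β) (hsr : s ≠ r)
    (ast : G.Adj s t) (nsr : ¬ G.Adj s r) (atr : G.Adj t r) :
    lkpStep G s t (srefl G t β) = lkpStep G s r (srefl G r β) := by
  have nrs : ¬ G.Adj r s := fun h => nsr h.symm
  have Pst := pairing_srefl_adj ast
  have Pts := pairing_srefl_adj ast.symm
  have Psr := pairing_srefl_orth hsr nsr
  have Ptr := pairing_srefl_adj atr
  have Prt := pairing_srefl_adj atr.symm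
  have Prs := pairing_srefl_orth hsr.symm nrs
  have Pt := pairing_srefl_same (G := G) t
  have Pr := pairing_srefl_same (G := G) r
  have Ps := pairing_srefl_same (G := G) s
  have sst := pairing_sroot_adj ast
  have sts := pairing_sroot_adj ast.symm
  have ssr := pairing_sroot_orth hsr nsr
  have srs := pairing_sroot_orth hsr.symm nrs
  have str := pairing_sroot_adj atr
  have srt := pairing_sroot_adj atr.symm
  have hγ := hβ.srefl (hsimple t)
  have hδ := hβ.srefl (hsimple r)
  rw [lkpStep_orth nsr]
  by_cases hsp : srefl G t β = sroot r
  · have h' : srefl G r β = sroot t := by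
      rw [eq_srefl_iff.1 hsp, srefl_srefl_sroot_adj atr.symm]
    rw [hsp, h', lkpStep_zero ast ssr, lkp_sroot ast.ne', lkp_sroot hsr.symm,
      lkp_sroot atr.ne']
    norm_num
  have hsp' : srefl G r β ≠ sroot t := fun h' => hsp (by
    rw [eq_srefl_iff.1 h', srefl_srefl_sroot_adj atr])
  obtain ⟨γ, eγ⟩ : ∃ γ, γ = srefl G t β := ⟨_, rfl⟩
  obtain ⟨ρ, eρ⟩ : ∃ ρ, ρ = srefl G r γ := ⟨_, rfl⟩
  obtain ⟨δ, eδ⟩ : ∃ δ, δ = srefl G r β := ⟨_, rfl⟩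
  obtain ⟨η, eη⟩ : ∃ η, η = srefl G t δ := ⟨_, rfl⟩
  obtain ⟨ξ, eξ⟩ : ∃ ξ, ξ = srefl G r η := ⟨_, rfl⟩
  have eξ' : srefl G t ρ = ξ := by rw [eξ, eη, eδ, eρ, eγ, srefl_braid atr]
  rw [← eγ] at hγ hsp ⊢
  rw [← eδ] at hδ hsp' ⊢
  have ps_γ : pairing G s γ = pairing G s β + pairing G t β := by rw [eγ, Pst]
  have pt_γ : pairing G t γ = - pairing G t β := by rw [eγ, Pt]
  have pr_γ : pairing G r γ = pairing G r β + pairing G t β := by rw [eγ, Prt]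
  have ps_ρ : pairing G s ρ = pairing G s β + pairing G t β := by rw [eρ, Psr, ps_γ]
  have pt_ρ : pairing G t ρ = pairing G r β := by rw [eρ, Ptr, pt_γ, pr_γ]; ring
  have pr_ρ : pairing G r ρ = - (pairing G r β + pairing G t β) := by rw [eρ, Pr, pr_γ]
  have ps_δ : pairing G s δ = pairing G s β := by rw [eδ, Psr]
  have pt_δ : pairing G t δ = pairing G t β + pairing G r β := by rw [eδ, Ptr]
  have pr_δ : pairing G r δ = - pairing G r β := by rw [eδ, Pr]
  have ps_η : pairing G s η = pairing G s β + pairing G t β + pairing G r β := by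
    rw [eη, Pst, ps_δ, pt_δ]; ring
  have pt_η : pairing G t η = - (pairing G t β + pairing G r β) := by rw [eη, Pt, pt_δ]
  have pr_η : pairing G r η = pairing G t β := by rw [eη, Prt, pr_δ, pt_δ]; ring
  have ps_ξ : pairing G s ξ = pairing G s β + pairing G t β + pairing G r β := by
    rw [eξ, Psr, ps_η]
  have pt_ξ : pairing G t ξ = - pairing G r β := by rw [eξ, Ptr, pt_η, pr_η]; ring
  have pr_ξ : pairing G r ξ = - pairing G t β := by rw [eξ, Pr, pr_η]
  have lγ : height γ < n := by rw [eγ, height_srefl]; omega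
  have lδ : height δ < n := by rw [eδ, height_srefl]; omega
  have lρ : height ρ < n := by rw [eρ, height_srefl]; omega
  have lη : height η < n := by rw [eη, height_srefl]; omega
  have hρ : PosRoot G ρ := eρ ▸ hγ.srefl hsp
  have hη : PosRoot G η := eη ▸ hδ.srefl hsp'
  have ηr : η ≠ sroot r := ne_sroot_of_pairing (G := G) (r := t) (by rw [pt_η, str]; omega)
  have ρt : ρ ≠ sroot t := ne_sroot_of_pairing (G := G) (r := r) (by rw [pr_ρ, srt]; omega)
  have hξ : PosRoot G ξ := eξ ▸ hη.srefl ηr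
  have lξ : height ξ < n := by rw [eξ, height_srefl]; omega
  have g_tγ : lkp G t γ = 2 * lkp G r ξ :=
    H.pos hγ lγ atr (by omega) (by omega) hsp eρ.symm (by omega) eξ'
  have g_sγ (h : pairing G s γ ≤ 0) : lkp G s γ = lkp G s ρ :=
    H.orth hγ lγ nsr h (by omega) hsp eρ.symm
  by_cases he : pairing G s η ≤ 0
  · have g_sη : lkp G s η = lkp G s ξ :=
      H.orth hη lη nsr he (by omega) ηr eξ.symm
    have g_tη : lkp G t η = lkp G t ξ + 2 * lkp G r ξ :=
      H.neg hη lη atr (by omega) (by omega) ηr eξ.symm (by omega)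
    rw [lkpStep_neg ast (by omega), g_tγ, g_sγ (by omega)]
    rcases he.lt_or_eq with he | he
    · rw [H.neg hδ lδ ast (by omega) (by omega) hsp' eη.symm he, g_sη, g_tη,
        H.neg hρ lρ ast (by omega) (by omega) ρt eξ' (by omega)]
      ring
    · rw [H.zero hδ lδ ast (by omega) (by omega) hsp' eη.symm he, g_sη, g_tη,
        H.zero hρ lρ ast (by omega) (by omega) ρt eξ' (by omega)]
      ring
  push Not at he
  have ηs : η ≠ sroot s := ne_sroot_of_pairing (G := G) (r := r) (by rw [pr_η, srs]; omega)
  have ξs : ξ ≠ sroot s := ne_sroot_of_pairing (G := G) (r := r) (by rw [pr_ξ, srs]; omega)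
  have hsη := hη.srefl ηs
  have hsξ := hξ.srefl ξs
  have lsη : height (srefl G s η) < n := by rw [height_srefl]; omega
  have lsξ : height (srefl G s ξ) < n := by rw [height_srefl]; omega
  have sηr : srefl G s η ≠ sroot r := ne_sroot_of_pairing (G := G) (r := s) (by
    rw [Ps, ssr]; omega)
  have e1 : srefl G r (srefl G s η) = srefl G s ξ := by rw [srefl_comm hsr.symm nrs, eξ]
  rw [H.pos hδ lδ ast (by omega) (by omega) hsp' eη.symm he rfl]
  have g_sρ (h : pairing G s ρ ≤ 0) : lkp G s ρ = 2 * lkp G t (srefl G s ξ) :=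
    H.pos hρ lρ ast (by omega) (by omega) ρt eξ' (by omega) rfl
  have g_rsξ : lkp G r ξ = lkp G r (srefl G s ξ) :=
    H.orth hξ lξ nrs (by omega) (by omega) ξs rfl
  rcases lt_trichotomy (pairing G s γ) 0 with h | h | h
  · rw [lkpStep_neg ast h, g_tγ, g_sγ h.le, g_sρ (by omega), g_rsξ,
      H.neg hsη lsη atr (by rw [Pts]; omega) (by rw [Prs]; omega) sηr e1 (by rw [Pts]; omega)]
    ring
  · rw [lkpStep_zero ast h, g_tγ, g_sγ h.le, g_sρ (by omega), g_rsξ,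
      H.zero hsη lsη atr (by rw [Pts]; omega) (by rw [Prs]; omega) sηr e1 (by rw [Pts]; omega)]
    ring
  · have γs : γ ≠ sroot s := ne_sroot_of_pairing (G := G) (r := r) (by rw [pr_γ, srs]; omega)
    have ρs : ρ ≠ sroot s := ne_sroot_of_pairing (G := G) (r := r) (by rw [pr_ρ, srs]; omega)
    have hsγ := hγ.srefl γs
    have hsρ := hρ.srefl ρs
    have sρt : srefl G s ρ ≠ sroot t := ne_sroot_of_pairing (G := G) (r := r) (by
      rw [Prs, srt]; omega)
    have hτ := hsρ.srefl sρt
    have e2 : srefl G r (srefl G s γ) = srefl G s ρ := by rw [srefl_comm hsr.symm nrs, eρ]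
    have e3 : srefl G s (srefl G t (srefl G s ρ)) = srefl G t (srefl G s ξ) := by
      rw [srefl_braid ast, eξ']
    rw [lkpStep_pos ast h rfl,
      H.pos hsγ (by rw [height_srefl]; omega) atr (by rw [Pts]; omega) (by rw [Prs]; omega)
        (ne_sroot_of_pairing (G := G) (r := s) (by rw [Ps, ssr]; omega)) e2 (by rw [Pts]; omega) rfl,
      H.pos hsη lsη atr (by rw [Pts]; omega) (by rw [Prs]; omega) sηr e1
        (by rw [Pts]; omega) rfl,
      H.orth hτ (by simp only [height_srefl, Pts]; omega) nrs
        (by simp only [Prt, Prs, Pts]; omega) (by simp only [Pst, Ps, Pts]; omega)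
        (ne_sroot_of_pairing (G := G) (r := t) (by simp only [Pt, Pts, sts]; omega)) e3]

theorem lkpStep_indep_fork (H : LowerRule G n) (hβ : PosRoot G β)
    (hn : height β ≤ n) (hsimple : ∀ x, β ≠ sroot x) (hs : pairing G s β ≤ 0)
    (ht : 0 < pairing G t β) (hr : 0 < pairing G r β) (htr : t ≠ r)
    (ast : G.Adj s t) (asr : G.Adj s r) (ntr : ¬ G.Adj t r)
    (hle : pairing G s β + pairing G t β ≤ pairing G s β + pairing G r β) :
    lkpStep G s t (srefl G t β) = lkpStep G s r (srefl G r β) := by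
  have nrt : ¬ G.Adj r t := fun h => ntr h.symm
  have Pst := pairing_srefl_adj ast
  have Pts := pairing_srefl_adj ast.symm
  have Psr := pairing_srefl_adj asr
  have Prs := pairing_srefl_adj asr.symm
  have Ptr := pairing_srefl_orth htr ntr
  have Prt := pairing_srefl_orth htr.symm nrt
  have Pt := pairing_srefl_same (G := G) t
  have Pr := pairing_srefl_same (G := G) r
  have Ps := pairing_srefl_same (G := G) s
  have sst := pairing_sroot_adj ast
  have sts := pairing_sroot_adj ast.symm
  have ssr := pairing_sroot_adj asr
  have srs := pairing_sroot_adj asr.symm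
  have str := pairing_sroot_orth htr ntr
  have srt := pairing_sroot_orth htr.symm nrt
  obtain ⟨γ, eγ⟩ : ∃ γ, γ = srefl G t β := ⟨_, rfl⟩
  obtain ⟨δ, eδ⟩ : ∃ δ, δ = srefl G r β := ⟨_, rfl⟩
  obtain ⟨ε, eε⟩ : ∃ ε, ε = srefl G t δ := ⟨_, rfl⟩
  have eε' : srefl G r γ = ε := by rw [eε, eδ, eγ, srefl_comm htr ntr]
  have hγ : PosRoot G γ := eγ ▸ hβ.srefl (hsimple t)
  have hδ : PosRoot G δ := eδ ▸ hβ.srefl (hsimple r)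
  have γr : γ ≠ sroot r := fun h => hsimple r (by
    rw [eγ, eq_srefl_iff] at h; rw [h, srefl_sroot_orth htr ntr])
  have δt : δ ≠ sroot t := fun h => hsimple t (by
    rw [eδ, eq_srefl_iff] at h; rw [h, srefl_sroot_orth htr.symm nrt])
  have hε : PosRoot G ε := eε ▸ hδ.srefl δt
  rw [← eγ, ← eδ]
  have ps_γ : pairing G s γ = pairing G s β + pairing G t β := by rw [eγ, Pst]
  have pt_γ : pairing G t γ = - pairing G t β := by rw [eγ, Pt]
  have pr_γ : pairing G r γ = pairing G r β := by rw [eγ, Prt]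
  have ps_δ : pairing G s δ = pairing G s β + pairing G r β := by rw [eδ, Psr]
  have pt_δ : pairing G t δ = pairing G t β := by rw [eδ, Ptr]
  have pr_δ : pairing G r δ = - pairing G r β := by rw [eδ, Pr]
  have ps_ε : pairing G s ε = pairing G s β + pairing G t β + pairing G r β := by
    rw [eε, Pst, ps_δ, pt_δ]; ring
  have pt_ε : pairing G t ε = - pairing G t β := by rw [eε, Pt, pt_δ]
  have pr_ε : pairing G r ε = - pairing G r β := by rw [eε, Prt, pr_δ]
  have lγ : height γ < n := by rw [eγ, height_srefl]; omega
  have lδ : height δ < n := by rw [eδ, height_srefl]; omega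
  have lε : height ε < n := by rw [eε, height_srefl]; omega
  have g_tγ : lkp G t γ = lkp G t ε :=
    H.orth hγ lγ ntr (by omega) (by omega) γr eε'
  have g_rδ : lkp G r δ = lkp G r ε :=
    H.orth hδ lδ nrt (by omega) (by omega) δt eε.symm
  by_cases he : pairing G s ε ≤ 0
  · rw [lkpStep_neg ast (by omega), lkpStep_neg asr (by omega), g_tγ, g_rδ]
    rcases he.lt_or_eq with he | he
    · rw [H.neg hγ lγ asr (by omega) (by omega) γr eε' he,
        H.neg hδ lδ ast (by omega) (by omega) δt eε.symm he]
      ring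
    · rw [H.zero hγ lγ asr (by omega) (by omega) γr eε' he,
        H.zero hδ lδ ast (by omega) (by omega) δt eε.symm he]
      ring
  push Not at he
  by_cases hsp : ε = sroot s
  · have h1 : γ = srefl G r (sroot s) := by rw [← hsp, ← eε', srefl_srefl]
    have h2 : δ = srefl G t (sroot s) := by rw [← hsp, eε, srefl_srefl]
    have h3 : pairing G s γ = 1 := by
      rw [h1, Psr, pairing_sroot_same, srs]; norm_num
    have h4 : pairing G s δ = 1 := by
      rw [h2, Pst, pairing_sroot_same, sts]; norm_num
    rw [lkpStep_pos (δ := sroot r) ast (by omega) (by rw [h1, srefl_srefl_sroot_adj asr]),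
      lkpStep_pos (δ := sroot t) asr (by omega) (by rw [h2, srefl_srefl_sroot_adj ast]),
      lkp_sroot htr.symm, lkp_sroot htr]
  obtain ⟨ζ, eζ⟩ : ∃ ζ, ζ = srefl G s ε := ⟨_, rfl⟩
  have hζ : PosRoot G ζ := eζ ▸ hε.srefl hsp
  have eζ' : srefl G s ζ = ε := by rw [eζ, srefl_srefl]
  have ps_ζ : pairing G s ζ = - pairing G s ε := by rw [eζ, Ps]
  have pt_ζ : pairing G t ζ = pairing G s β + pairing G r β := by
    rw [eζ, Pts, ps_ε, pt_ε]; ring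
  have pr_ζ : pairing G r ζ = pairing G s β + pairing G t β := by
    rw [eζ, Prs, ps_ε, pr_ε]; ring
  have lζ : height ζ < n := by rw [eζ, height_srefl]; omega
  have g_sγ (h : pairing G s γ ≤ 0) : lkp G s γ = 2 * lkp G r ζ :=
    H.pos hγ lγ asr h (by omega) γr eε' he eζ.symm
  have g_sδ (h : pairing G s δ ≤ 0) : lkp G s δ = 2 * lkp G t ζ :=
    H.pos hδ lδ ast h (by omega) δt eε.symm he eζ.symm
  have g_rε (h : pairing G s γ < 0) : lkp G r ε = lkp G r ζ + 2 * lkp G s ζ :=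
    H.neg hε lε asr.symm (by omega) he hsp eζ.symm (by omega)
  have g_rε0 (h : pairing G s γ = 0) : lkp G r ε = 2 * lkp G s ζ - lkp G r ζ :=
    H.zero hε lε asr.symm (by omega) he hsp eζ.symm (by omega)
  have g_tε (h : pairing G s δ < 0) : lkp G t ε = lkp G t ζ + 2 * lkp G s ζ :=
    H.neg hε lε ast.symm (by omega) he hsp eζ.symm (by omega)
  have g_tε0 (h : pairing G s δ = 0) : lkp G t ε = 2 * lkp G s ζ - lkp G t ζ :=
    H.zero hε lε ast.symm (by omega) he hsp eζ.symm (by omega)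
  rcases lt_trichotomy (pairing G s δ) 0 with h | h | h
  · rw [lkpStep_neg ast (by omega), lkpStep_neg asr (by omega), g_tγ, g_rδ,
      g_sγ (by omega), g_sδ h.le, g_rε (by omega), g_tε h]
    ring
  · rw [lkpStep_zero asr h, g_rδ, g_sδ h.le]
    rcases (show pairing G s γ ≤ 0 by omega).lt_or_eq with h' | h'
    · rw [lkpStep_neg ast h', g_tγ, g_sγ h'.le, g_tε0 h, g_rε h']; ring
    · rw [lkpStep_zero ast h', g_tγ, g_sγ h'.le, g_tε0 h, g_rε0 h']; ring
  have ζt : ζ ≠ sroot t := fun h' => by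
    have h1 := congrArg (pairing G s) h'
    have h2 := congrArg (pairing G t) h'
    rw [sst] at h1; rw [pairing_sroot_same] at h2; omega
  obtain ⟨θ, eθ⟩ : ∃ θ, θ = srefl G t ζ := ⟨_, rfl⟩
  have hθ : PosRoot G θ := eθ ▸ hζ.srefl ζt
  have lθ : height θ < n := by rw [eθ, height_srefl]; omega
  have ps_θ : pairing G s θ = - pairing G t β := by rw [eθ, Pst]; omega
  have pt_θ : pairing G t θ = - pairing G s δ := by rw [eθ, Pt]; omega
  have pr_θ : pairing G r θ = pairing G s γ := by rw [eθ, Prt]; omega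
  have δs : δ ≠ sroot s := ne_sroot_of_pairing (G := G) (r := t) (by rw [pt_δ, sts]; omega)
  have hsδ := hδ.srefl δs
  have e1 : srefl G t (srefl G s δ) = srefl G s θ := by
    rw [eθ, eζ, ← srefl_braid ast.symm, eε, srefl_srefl]
  have sδt : srefl G s δ ≠ sroot t := fun h' => hsp (by
    rw [eε, eq_srefl_iff.1 h', srefl_srefl_sroot_adj ast.symm])
  have hsθ : PosRoot G (srefl G s θ) := e1 ▸ hsδ.srefl sδt
  have lsδ : height (srefl G s δ) < n := by rw [height_srefl]; omega
  have lsθ : height (srefl G s θ) < n := by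
    rw [← e1, height_srefl, Pts]; omega
  have sθs : srefl G s θ ≠ sroot s := fun h' => by
    have h1 := congrArg (pairing G s) h'
    have h2 := congrArg (pairing G t) h'
    rw [Ps, pairing_sroot_same] at h1
    rw [Pts, sts] at h2
    omega
  rw [lkpStep_pos asr h rfl,
    H.orth hsδ lsδ nrt (by rw [Prs]; omega) (by rw [Pts]; omega) sδt e1]
  have g_rθ (h : pairing G s γ ≤ 0) : lkp G r ζ = lkp G r θ :=
    H.orth hζ lζ nrt (by omega) (by omega) ζt eθ.symm
  have g_tε' : lkp G t ε = 2 * lkp G s θ :=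
    H.pos hε lε ast.symm (by omega) he hsp eζ.symm (by omega) eθ.symm
  rcases lt_trichotomy (pairing G s γ) 0 with h' | h' | h'
  · rw [lkpStep_neg ast h', g_tγ, g_sγ h'.le, g_tε', g_rθ h'.le,
      H.neg hsθ lsθ asr.symm (by rw [Prs]; omega) (by rw [Ps]; omega) sθs (srefl_srefl s θ)
        (by omega)]
    ring
  · rw [lkpStep_zero ast h', g_tγ, g_sγ h'.le, g_tε', g_rθ h'.le,
      H.zero hsθ lsθ asr.symm (by rw [Prs]; omega) (by rw [Ps]; omega) sθs (srefl_srefl s θ)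
        (by omega)]
    ring
  have ζr : ζ ≠ sroot r := fun h' => by
    have h1 := congrArg (pairing G s) h'
    have h2 := congrArg (pairing G r) h'
    rw [ssr] at h1; rw [pairing_sroot_same] at h2; omega
  obtain ⟨κ, eκ⟩ : ∃ κ, κ = srefl G r ζ := ⟨_, rfl⟩
  have hκ : PosRoot G κ := eκ ▸ hζ.srefl ζr
  have ps_κ : pairing G s κ = - pairing G r β := by rw [eκ, Psr]; omega
  have pr_κ : pairing G r κ = - pairing G s γ := by rw [eκ, Pr]; omega
  have pt_κ : pairing G t κ = pairing G s δ := by rw [eκ, Ptr]; omega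
  have γs : γ ≠ sroot s := ne_sroot_of_pairing (G := G) (r := r) (by rw [pr_γ, srs]; omega)
  have hsγ := hγ.srefl γs
  have e2 : srefl G r (srefl G s γ) = srefl G s κ := by
    rw [eκ, eζ, ← srefl_braid asr.symm, ← eε', srefl_srefl]
  have sγr : srefl G s γ ≠ sroot r := fun h' => hsp (by
    rw [← eε', eq_srefl_iff.1 h', srefl_srefl_sroot_adj asr.symm])
  have hsκ : PosRoot G (srefl G s κ) := e2 ▸ hsγ.srefl sγr
  have lsγ : height (srefl G s γ) < n := by rw [height_srefl]; omega
  have lsκ : height (srefl G s κ) < n := by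
    rw [← e2, height_srefl, Prs]; omega
  have sκs : srefl G s κ ≠ sroot s := fun h' => by
    have h1 := congrArg (pairing G s) h'
    have h2 := congrArg (pairing G r) h'
    rw [Ps, pairing_sroot_same] at h1
    rw [Prs, srs] at h2
    omega
  rw [lkpStep_pos ast h' rfl,
    H.orth hsγ lsγ ntr (by rw [Pts]; omega) (by rw [Prs]; omega) sγr e2,
    H.pos hsκ lsκ ast.symm (by rw [Pts]; omega) (by rw [Ps]; omega) sκs (srefl_srefl s κ)
        (by omega) rfl,
    H.pos hsθ lsθ asr.symm (by rw [Prs]; omega) (by rw [Ps]; omega) sθs (srefl_srefl s θ)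
        (by omega) rfl,
    eκ, eθ, srefl_comm htr ntr]

end Independence

theorem lkpStep_indep (hG : TriangleFree G) {n : ℤ} {β : V → ℤ} {s t r : V}
    (H : LowerRule G n) (hβ : PosRoot G β) (hn : height β ≤ n) (hsimple : ∀ x, β ≠ sroot x)
    (hs : pairing G s β ≤ 0) (ht : 0 < pairing G t β) (hr : 0 < pairing G r β) :
    lkpStep G s t (srefl G t β) = lkpStep G s r (srefl G r β) := by
  have hst : s ≠ t := by rintro rfl; omega
  have hsr : s ≠ r := by rintro rfl; omega
  by_cases htr : t = r
  · rw [htr]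
  by_cases ast : G.Adj s t <;> by_cases asr : G.Adj s r <;> by_cases atr : G.Adj t r
  · exact absurd asr (hG s t r ast atr)
  · rcases le_total (pairing G t β) (pairing G r β) with h | h
    · exact lkpStep_indep_fork H hβ hn hsimple hs ht hr htr ast asr atr (by omega)
    · exact (lkpStep_indep_fork H hβ hn hsimple hs hr ht (Ne.symm htr) asr ast
        (fun h => atr h.symm) (by omega)).symm
  · exact lkpStep_indep_path H hβ hn hsimple hs ht hr hsr ast asr atr
  · exact lkpStep_indep_adj_orth H hβ hn hsimple hs ht hr hsr htr ast asr atr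
  · exact (lkpStep_indep_path H hβ hn hsimple hs hr ht hst asr ast atr.symm).symm
  · exact (lkpStep_indep_adj_orth H hβ hn hsimple hs hr ht hst (Ne.symm htr) asr ast
      fun h => atr h.symm).symm
  all_goals exact lkpStep_indep_orth_left H hβ hn hsimple hs ht hr hst hsr htr ast asr

theorem lowerRule (hG : TriangleFree G) (n : ℕ) : LowerRule G n := by
  induction n with
  | zero => intro β hβ h; exact absurd hβ.height_pos (by simpa using h.le)
  | succ n ih =>
    intro β hβ hn s t hs ht hne
    have hn' : height β ≤ n := by push_cast at hn; omega
    have hsimple : ∀ x, β ≠ sroot x := by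
      rintro x rfl
      have hx : t ≠ x := fun h => hne (by rw [h])
      by_cases h : G.Adj t x
      · rw [pairing_sroot_adj h] at ht; omega
      · rw [pairing_sroot_orth hx h] at ht; omega
    obtain ⟨r, hr, e⟩ := exists_lkp_eq_step hβ hs hsimple
    rw [e]
    exact lkpStep_indep hG ih hβ hn' hsimple hs hr ht

/-- Recursion formula for `lkp`, along an arbitrary lowering of a positive root. -/
theorem lkp_eq_step (hG : TriangleFree G) {β : V → ℤ} (hβ : PosRoot G β) {s t : V}
    (hs : pairing G s β ≤ 0) (ht : 0 < pairing G t β) (hne : β ≠ sroot t) :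
    lkp G s β = lkpStep G s t (srefl G t β) :=
  lowerRule hG (height β + 1).toNat β hβ (by have := hβ.height_pos; omega) s t hs ht hne

end Recursion

section MarkovAction

variable {V : Type*} [Fintype V] {G : SimpleGraph V}

theorem lkp_eq_lkp_of_pairing_eq_zero_aux (hG : TriangleFree G) (n : ℕ) :
    ∀ {β : V → ℤ} {s t : V}, height β < n → PosRoot G β → G.Adj s t → pairing G s β = 0 →
      pairing G t β = 0 → lkp G s β = lkp G t β := by
  induction n with
  | zero => intro β s t h hβ; exact absurd hβ.height_pos (by simpa using h.le)
  | succ n IH =>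
  intro β s t hn hβ ast hs ht
  have H := lowerRule hG (n + 1)
  by_cases hsimple : ∃ x, β = sroot x
  · obtain ⟨x, rfl⟩ := hsimple
    rw [lkp_sroot, lkp_sroot]
    · rintro rfl; rw [pairing_sroot_same] at ht; omega
    · rintro rfl; rw [pairing_sroot_same] at hs; omega
  push Not at hsimple
  obtain ⟨r, hr⟩ := hβ.exists_lower hsimple
  have hsr : s ≠ r := by rintro rfl; omega
  have htr : t ≠ r := by rintro rfl; omega
  have hγ := hβ.srefl (hsimple r)
  have Pr := pairing_srefl_same (G := G) r
  have lγ : height (srefl G r β) < n := by rw [height_srefl]; push_cast at hn; omega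
  have key : ∀ {s t : V}, G.Adj s t → pairing G s β = 0 → pairing G t β = 0 → s ≠ r → t ≠ r →
      G.Adj s r → lkp G s β = lkp G t β := by
    intro s t ast hs ht hsr htr asr
    have ntr : ¬ G.Adj t r := hG t s r ast.symm asr
    have nrt : ¬ G.Adj r t := fun h => ntr h.symm
    have Pst := pairing_srefl_adj ast
    have Pts := pairing_srefl_adj ast.symm
    have Psr := pairing_srefl_adj asr
    have Prs := pairing_srefl_adj asr.symm
    have Ptr := pairing_srefl_orth htr ntr
    have Prt := pairing_srefl_orth htr.symm nrt
    have Ps := pairing_srefl_same (G := G) s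
    have γs : srefl G r β ≠ sroot s := ne_sroot_of_pairing (G := G) (r := t) (by
      rw [Ptr, pairing_sroot_adj ast.symm]; omega)
    have hsγ := hγ.srefl γs
    have sγt : srefl G s (srefl G r β) ≠ sroot t := fun h' => by
      have h1 := congrArg (pairing G s) h'
      have h2 := congrArg (pairing G t) h'
      rw [Ps, Psr, pairing_sroot_adj ast] at h1
      rw [Pts, Ptr, Psr, pairing_sroot_same] at h2
      omega
    have hδ := hsγ.srefl sγt
    rw [H.pos hβ hn asr (by omega) hr (hsimple r) rfl (by rw [Psr]; omega) rfl,
      H.orth hβ hn ntr (by omega) hr (hsimple r) rfl,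
      H.pos hγ (by omega) ast.symm (by rw [Ptr]; omega) (by rw [Psr]; omega) γs rfl
        (by rw [Pts, Ptr, Psr]; omega) rfl,
      H.orth hsγ (by rw [height_srefl, Psr]; omega) nrt (by rw [Prs, Psr, Pr]; omega)
        (by rw [Pts, Ptr, Psr]; omega) sγt rfl]
    rw [IH (by simp only [height_srefl, Pts, Ptr, Psr]; omega) hδ asr.symm
      (by rw [Prt, Prs, Psr, Pr]; omega) (by rw [Pst, Ps, Pts, Ptr, Psr]; omega)]
  by_cases asr : G.Adj s r
  · exact key ast hs ht hsr htr asr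
  by_cases atr : G.Adj t r
  · exact (key ast.symm ht hs htr hsr atr).symm
  rw [H.orth hβ hn asr (by omega) hr (hsimple r) rfl,
    H.orth hβ hn atr (by omega) hr (hsimple r) rfl]
  exact IH lγ hγ ast (by rwa [pairing_srefl_orth hsr asr]) (by rwa [pairing_srefl_orth htr atr])

theorem lkp_eq_lkp_of_pairing_eq_zero (hG : TriangleFree G) {β : V → ℤ} {s t : V}
    (hβ : PosRoot G β) (h : G.Adj s t) (hs : pairing G s β = 0) (ht : pairing G t β = 0) :
    lkp G s β = lkp G t β :=
  lkp_eq_lkp_of_pairing_eq_zero_aux hG (height β + 1).toNat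
    (by have := hβ.height_pos; omega) hβ h hs ht

theorem srefl_ne_sroot_self {β : V → ℤ} (hβ : PosRoot G β) (s : V) :
    srefl G s β ≠ sroot s := by
  intro h
  have h1 := congrFun (eq_srefl_iff.1 h) s
  rw [srefl_sroot_same, Pi.neg_apply, sroot_same] at h1
  have := hβ.nonneg s
  omega

open Classical in
variable (G) in
/-- The non-deformed action of a generator on functions on the root lattice. -/
noncomputable def markov (s : V) : Module.End ℝ ((V → ℤ) → ℝ) where
  toFun h β :=
    if PosRoot G β then
      if β = sroot s then 0
      else if pairing G s β < 0 then (h β + h (srefl G s β)) / 2 else h (srefl G s β)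
    else h β
  map_add' h k := by
    ext β
    simp only [Pi.add_apply]
    split_ifs <;> ring
  map_smul' x h := by
    ext β
    simp only [Pi.smul_apply, smul_eq_mul, RingHom.id_apply]
    split_ifs <;> ring

section

variable {s t : V} {β : V → ℤ} {h : (V → ℤ) → ℝ}

theorem markov_of_not_posRoot (hβ : ¬ PosRoot G β) : markov G s h β = h β := by
  simp [markov, hβ]

theorem markov_self : markov G s h (sroot s) = 0 := by
  simp [markov, PosRoot.simple]

theorem markov_of_neg (hβ : PosRoot G β) (hs : pairing G s β < 0) :
    markov G s h β = (h β + h (srefl G s β)) / 2 := by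
  have : β ≠ sroot s := by rintro rfl; rw [pairing_sroot_same] at hs; omega
  simp [markov, hβ, hs, this]

theorem markov_of_nonneg (hβ : PosRoot G β) (hs : 0 ≤ pairing G s β) (hne : β ≠ sroot s) :
    markov G s h β = h (srefl G s β) := by
  simp [markov, hβ, hne, hs.not_gt]

theorem markov_of_eq_zero (hβ : PosRoot G β) (hs : pairing G s β = 0) :
    markov G s h β = h β := by
  have : β ≠ sroot s := by rintro rfl; rw [pairing_sroot_same] at hs; omega
  rw [markov_of_nonneg hβ hs.ge this, srefl_of_pairing_eq_zero hs]

theorem markov_sroot_orth (hne : s ≠ t) (hst : ¬ G.Adj s t) :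
    markov G s h (sroot t) = h (sroot t) :=
  markov_of_eq_zero (.simple t) (pairing_sroot_orth hne hst)

theorem markov_sroot_adj (hst : G.Adj s t) :
    markov G s h (sroot t) = (h (sroot t) + h (srefl G s (sroot t))) / 2 :=
  markov_of_neg (.simple t) (by rw [pairing_sroot_adj hst]; norm_num)

theorem posRoot_srefl_sroot (hst : G.Adj s t) : PosRoot G (srefl G s (sroot t)) :=
  (PosRoot.simple t).srefl (sroot_injective.ne hst.ne')

theorem markov_srefl_sroot (hst : G.Adj s t) :
    markov G s h (srefl G s (sroot t)) = h (sroot t) := by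
  rw [markov_of_nonneg (posRoot_srefl_sroot hst)
    (by rw [pairing_srefl_same, pairing_sroot_adj hst]; norm_num)
    (srefl_ne_sroot_self (.simple t) s), srefl_srefl]

end

theorem markov_comm {s t : V} (hne : s ≠ t) (hst : ¬ G.Adj s t) :
    markov G s * markov G t = markov G t * markov G s := by
  have hts : ¬ G.Adj t s := fun h => hst h.symm
  refine LinearMap.ext fun h => funext fun β => ?_
  simp only [Module.End.mul_apply]
  by_cases hβ : PosRoot G β
  swap
  · simp only [markov_of_not_posRoot hβ]
  by_cases h1 : β = sroot s
  · subst h1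
    rw [markov_self, markov_sroot_orth hne.symm hts, markov_self]
  by_cases h2 : β = sroot t
  · subst h2
    rw [markov_self, markov_sroot_orth hne hst, markov_self]
  have n1 : srefl G s β ≠ sroot t := fun h => h2 (by
    rw [eq_srefl_iff.1 h, srefl_sroot_orth hne hst])
  have n2 : srefl G t β ≠ sroot s := fun h => h1 (by
    rw [eq_srefl_iff.1 h, srefl_sroot_orth hne.symm hts])
  have r1 := hβ.srefl h1
  have r2 := hβ.srefl h2
  have e := srefl_comm hne hst β
  simp only [markov, LinearMap.coe_mk, AddHom.coe_mk, hβ, r1, r2, h1, h2, n1, n2,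
    pairing_srefl_orth hne hst, pairing_srefl_orth hne.symm hts, if_true, if_false, e]
  split_ifs <;> ring

theorem markov_braid {s t : V} (hst : G.Adj s t) :
    markov G s * (markov G t * markov G s) = markov G t * (markov G s * markov G t) := by
  refine LinearMap.ext fun h => funext fun β => ?_
  simp only [Module.End.mul_apply]
  by_cases hβ : PosRoot G β
  swap
  · simp only [markov_of_not_posRoot hβ]
  have hsum := srefl_sroot_adj hst
  by_cases h1 : β = sroot s
  · subst h1
    rw [markov_self, markov_sroot_adj hst.symm, markov_self, ← hsum, markov_srefl_sroot hst,
      markov_self]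
    norm_num
  by_cases h2 : β = sroot t
  · subst h2
    rw [markov_self, markov_sroot_adj hst, markov_self, hsum, markov_srefl_sroot hst.symm,
      markov_self]
    norm_num
  by_cases h3 : β = srefl G s (sroot t)
  · subst h3
    rw [markov_srefl_sroot hst, markov_self, hsum, markov_srefl_sroot hst.symm, markov_self]
  have h3' : β ≠ srefl G t (sroot s) := by rwa [← hsum]
  have n1 : srefl G s β ≠ sroot t := fun h => h3 (eq_srefl_iff.1 h)
  have n2 : srefl G t β ≠ sroot s := fun h => h3' (eq_srefl_iff.1 h)
  have r1 := hβ.srefl h1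
  have r2 := hβ.srefl h2
  have r3 := r1.srefl n1
  have r4 := r2.srefl n2
  have n3 : srefl G t (srefl G s β) ≠ sroot s := fun h => h2 (by
    rw [eq_srefl_iff, eq_srefl_iff] at h; rw [h, srefl_srefl_sroot_adj hst])
  have n4 : srefl G s (srefl G t β) ≠ sroot t := fun h => h1 (by
    rw [eq_srefl_iff, eq_srefl_iff] at h; rw [h, srefl_srefl_sroot_adj hst.symm])
  have n5 := srefl_ne_sroot_self hβ s
  have n6 := srefl_ne_sroot_self hβ t
  have e := srefl_braid hst β
  simp only [markov, LinearMap.coe_mk, AddHom.coe_mk, hβ, r1, r2, r3, r4, h1, h2, n1, n2, n3,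
    n4, n5, n6, pairing_srefl_adj hst, pairing_srefl_adj hst.symm, pairing_srefl_same,
    if_true, if_false, srefl_srefl, e]
  have es : pairing G s β = 0 → srefl G s β = β := srefl_of_pairing_eq_zero
  have et : pairing G t β = 0 → srefl G t β = β := srefl_of_pairing_eq_zero
  have est : pairing G s β + pairing G t β = 0 → srefl G s (srefl G t β) = srefl G t β :=
    fun h => srefl_of_pairing_eq_zero (by rw [pairing_srefl_adj hst, h])
  have ets : pairing G s β + pairing G t β = 0 → srefl G t (srefl G s β) = srefl G s β :=
    fun h => srefl_of_pairing_eq_zero (by rw [pairing_srefl_adj hst.symm]; omega)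
  clear hβ h1 h2 h3 h3' hsum n1 n2 n3 n4 n5 n6 r1 r2 r3 r4
  generalize pairing G s β = a at *
  generalize pairing G t β = b at *
  rcases lt_trichotomy a 0 with ha | ha | ha <;> rcases lt_trichotomy b 0 with hb | hb | hb <;>
    rcases lt_trichotomy (a + b) 0 with hab | hab | hab <;>
    try (exfalso; omega)
  all_goals
    try simp (disch := omega) only [if_pos, if_neg, es, et, est, ets, srefl_srefl] at e ⊢
    try ring1

end MarkovAction

section Deformation

variable {V : Type*} [Fintype V] {G : SimpleGraph V}

open Classical in
variable (G) in
/-- The vector added by the deformed action of the generator `s`. -/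
noncomputable def kcoef (s : V) : (V → ℤ) → ℝ :=
  fun β => if PosRoot G β then (lkp G s β : ℝ) - 1 else 0

theorem kcoef_of_posRoot {s : V} {β : V → ℤ} (hβ : PosRoot G β) :
    kcoef G s β = (lkp G s β : ℝ) - 1 := by simp [kcoef, hβ]

theorem kcoef_of_not_posRoot {s : V} {β : V → ℤ} (hβ : ¬ PosRoot G β) :
    kcoef G s β = 0 := by simp [kcoef, hβ]

theorem kcoef_self (s : V) : kcoef G s (sroot s) = 1 := by
  rw [kcoef_of_posRoot (.simple s), lkp_self]; norm_num

theorem kcoef_sroot {s t : V} (h : t ≠ s) : kcoef G s (sroot t) = 0 := by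
  rw [kcoef_of_posRoot (.simple t), lkp_sroot h]; norm_num

theorem kcoef_sum {s t : V} (h : G.Adj s t) : kcoef G s (srefl G s (sroot t)) = -1 := by
  rw [kcoef_of_posRoot (posRoot_srefl_sroot h),
    lkp_of_pos (by rw [pairing_srefl_same, pairing_sroot_adj h]; norm_num)
      (srefl_ne_sroot_self (.simple t) s)]
  norm_num

theorem lkp_srefl_orth (hG : TriangleFree G) {s t : V} {β : V → ℤ} (hβ : PosRoot G β)
    (hne : s ≠ t) (h : ¬ G.Adj s t) (ht : pairing G t β < 0) :
    lkp G s (srefl G t β) = lkp G s β := by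
  have h' : ¬ G.Adj t s := fun k => h k.symm
  have e := pairing_srefl_orth hne h β
  rcases le_or_gt (pairing G s β) 0 with hs | hs
  · rw [lkp_eq_step hG (hβ.raise ht) (by rwa [e]) (by rw [pairing_srefl_same]; omega)
      (srefl_ne_sroot_self hβ t), srefl_srefl, lkpStep_orth h]
  · have := pairing_sroot_orth hne.symm h'
    rw [lkp_of_pos hs (ne_sroot_of_pairing (G := G) (r := t) (by omega)),
      lkp_of_pos (by rwa [e]) (ne_sroot_of_pairing (G := G) (r := t) (by
        rw [pairing_srefl_same]; omega))]

theorem markov_kcoef_orth (hG : TriangleFree G) {s t : V} (hne : s ≠ t) (h : ¬ G.Adj s t) :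
    markov G t (kcoef G s) = kcoef G s := by
  funext β
  by_cases hβ : PosRoot G β
  swap
  · exact markov_of_not_posRoot hβ
  by_cases ht : β = sroot t
  · subst ht; rw [markov_self, kcoef_sroot hne.symm]
  have h1 := hβ.srefl ht
  rcases lt_trichotomy (pairing G t β) 0 with h2 | h2 | h2
  · rw [markov_of_neg hβ h2, kcoef_of_posRoot hβ, kcoef_of_posRoot h1,
      lkp_srefl_orth hG hβ hne h h2]
    ring
  · exact markov_of_eq_zero hβ h2
  · rw [markov_of_nonneg hβ h2.le ht, kcoef_of_posRoot hβ, kcoef_of_posRoot h1,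
      ← lkp_srefl_orth hG h1 hne h (by rw [pairing_srefl_same]; omega), srefl_srefl]

theorem markov_kcoef_adj (hG : TriangleFree G) {s t : V} (h : G.Adj s t) :
    markov G t (kcoef G s) = markov G s (kcoef G t) := by
  have hsum := srefl_sroot_adj h
  funext β
  by_cases hβ : PosRoot G β
  swap
  · simp only [markov_of_not_posRoot hβ, kcoef_of_not_posRoot hβ]
  have key : ∀ {s t : V}, G.Adj s t → markov G t (kcoef G s) (sroot t) =
      markov G s (kcoef G t) (sroot t) := by
    intro s t h
    rw [markov_self, markov_sroot_adj h, kcoef_self, srefl_sroot_adj h, kcoef_sum h.symm]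
    norm_num
  by_cases h1 : β = sroot s
  · subst h1; exact (key h.symm).symm
  by_cases h2 : β = sroot t
  · subst h2; exact key h
  by_cases h3 : β = srefl G s (sroot t)
  · subst h3
    rw [markov_srefl_sroot h, hsum, markov_srefl_sroot h.symm, kcoef_self, kcoef_self]
  have n1 : srefl G s β ≠ sroot t := fun h => h3 (eq_srefl_iff.1 h)
  have n2 : srefl G t β ≠ sroot s := fun h => h3 (by rw [eq_srefl_iff.1 h, hsum])
  have key2 : ∀ {s t : V}, G.Adj s t → 0 ≤ pairing G s β → pairing G t β < 0 →
      β ≠ sroot s → β ≠ sroot t → srefl G s β ≠ sroot t → srefl G t β ≠ sroot s →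
      markov G t (kcoef G s) β = markov G s (kcoef G t) β := by
    intro s t h hs ht h1 h2 n1 n2
    have ps := pairing_srefl_adj h β
    have pt := pairing_srefl_adj h.symm β
    rw [markov_of_neg hβ ht, markov_of_nonneg hβ hs h1, kcoef_of_posRoot hβ,
      kcoef_of_posRoot (hβ.srefl h2), kcoef_of_posRoot (hβ.srefl h1)]
    have gs (k : pairing G s (srefl G t β) ≤ 0) := lkp_eq_step hG (hβ.raise ht) k
      (by rw [pairing_srefl_same]; omega) (srefl_ne_sroot_self hβ t)
    rw [srefl_srefl] at gs
    rcases hs.eq_or_lt with hs | hs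
    · rw [gs (by omega), lkpStep_zero h hs.symm, srefl_of_pairing_eq_zero hs.symm]
      push_cast; ring
    rw [lkp_of_pos hs h1]
    rcases le_or_gt (pairing G s (srefl G t β)) 0 with k | k
    · rw [gs k, lkpStep_pos h hs rfl]
      push_cast; ring
    · rw [lkp_of_pos k n2, lkp_of_pos (by omega) n1]
      norm_num
  rcases lt_or_ge (pairing G s β) 0 with hs | hs <;>
    rcases lt_or_ge (pairing G t β) 0 with ht | ht
  · have ps := pairing_srefl_adj h β
    have pt := pairing_srefl_adj h.symm β
    rw [markov_of_neg hβ ht, markov_of_neg hβ hs, kcoef_of_posRoot hβ, kcoef_of_posRoot hβ,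
      kcoef_of_posRoot (hβ.srefl h2), kcoef_of_posRoot (hβ.srefl h1),
      lkp_eq_step hG (hβ.raise ht) (by omega) (by rw [pairing_srefl_same]; omega)
        (srefl_ne_sroot_self hβ t),
      lkp_eq_step hG (hβ.raise hs) (by omega) (by rw [pairing_srefl_same]; omega)
        (srefl_ne_sroot_self hβ s), srefl_srefl, srefl_srefl, lkpStep_neg h hs,
      lkpStep_neg h.symm ht]
    push_cast; ring
  · exact (key2 h.symm ht hs h2 h1 n2 n1).symm
  · exact key2 h hs ht h1 h2 n1 n2
  · rw [markov_of_nonneg hβ hs h1, markov_of_nonneg hβ ht h2,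
      kcoef_of_posRoot (hβ.srefl h2), kcoef_of_posRoot (hβ.srefl h1)]
    by_cases k : pairing G s β = 0 ∧ pairing G t β = 0
    · rw [srefl_of_pairing_eq_zero k.1, srefl_of_pairing_eq_zero k.2,
        lkp_eq_lkp_of_pairing_eq_zero hG hβ h k.1 k.2]
    · have ps := pairing_srefl_adj h β
      have pt := pairing_srefl_adj h.symm β
      rw [lkp_of_pos (by omega) n1, lkp_of_pos (by omega) n2]

theorem markov_markov_kcoef {s t : V} (hne : s ≠ t) :
    markov G s (markov G s (kcoef G t)) =
      (1 / 2 : ℝ) • (markov G s (kcoef G t) + kcoef G t) := by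
  funext β
  simp only [Pi.smul_apply, Pi.add_apply, smul_eq_mul]
  by_cases hβ : PosRoot G β
  swap
  · simp only [markov_of_not_posRoot hβ]; ring
  by_cases hs : β = sroot s
  · subst hs; rw [markov_self, markov_self, kcoef_sroot hne]; ring
  have h1 := hβ.srefl hs
  have h2 := srefl_ne_sroot_self hβ s
  have h3 := pairing_srefl_same (G := G) s β
  rcases lt_trichotomy (pairing G s β) 0 with h | h | h
  · rw [markov_of_neg hβ h, markov_of_nonneg h1 (by omega) h2, srefl_srefl]; ring
  · rw [markov_of_eq_zero hβ h, markov_of_eq_zero hβ h]; ring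
  · rw [markov_of_nonneg hβ h.le hs, markov_of_nonneg hβ h.le hs,
      markov_of_neg h1 (by omega), srefl_srefl]; ring

variable (G) in
/-- The deformed action of a generator, with deformation parameter `x`. -/
noncomputable def deform (x : ℝ) (s : V) : Module.End ℝ ((V → ℤ) → ℝ) :=
  markov G s + x • (LinearMap.proj (sroot s)).smulRight (kcoef G s)

theorem deform_apply (x : ℝ) (s : V) (h : (V → ℤ) → ℝ) :
    deform G x s h = markov G s h + (x * h (sroot s)) • kcoef G s := by
  simp [deform, smul_smul]

theorem deform_zero (s : V) : deform G 0 s = markov G s := by simp [deform]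

theorem deform_comm (hG : TriangleFree G) (x : ℝ) {s t : V} (hne : s ≠ t)
    (h : ¬ G.Adj s t) : deform G x s * deform G x t = deform G x t * deform G x s := by
  have h' : ¬ G.Adj t s := fun k => h k.symm
  refine LinearMap.ext fun f => ?_
  have e := LinearMap.congr_fun (markov_comm hne h) f
  simp only [Module.End.mul_apply] at e ⊢
  simp only [deform_apply, map_add, map_smul, markov_kcoef_orth hG hne h,
    markov_kcoef_orth hG hne.symm h', kcoef_sroot hne, kcoef_sroot hne.symm,
    markov_sroot_orth hne h, markov_sroot_orth hne.symm h', e]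
  module

theorem deform_braid (hG : TriangleFree G) (x : ℝ) {s t : V} (h : G.Adj s t) :
    deform G x s * (deform G x t * deform G x s) =
      deform G x t * (deform G x s * deform G x t) := by
  refine LinearMap.ext fun f => ?_
  have e := LinearMap.congr_fun (markov_braid h) f
  have hsum := srefl_sroot_adj h
  have k1 := markov_markov_kcoef (G := G) h.ne
  have k2 := markov_markov_kcoef (G := G) h.ne'
  have k3 := markov_kcoef_adj hG h
  simp only [Module.End.mul_apply] at e ⊢
  have k4 : kcoef G t (srefl G s (sroot t)) = -1 := by rw [hsum, kcoef_sum h.symm]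
  have k5 (f) : markov G t f (srefl G s (sroot t)) = f (sroot s) := by
    rw [hsum, markov_srefl_sroot h.symm]
  rw [k3] at k2
  simp only [deform_apply, map_add, map_smul, kcoef_sroot h.ne, kcoef_sroot h.ne', kcoef_self,
    markov_self, markov_sroot_adj h, markov_sroot_adj h.symm, ← hsum, markov_srefl_sroot h,
    e, k1, k2, k3, k4, k5]
  module

end Deformation

section ArtinMonoids

variable {B : Type*}

/-- The braid relations of the Artin-Tits monoid attached to `m`, where `m s t = 0` means that
there is no relation between `s` and `t`. -/
def monoidRel (m : B → B → ℕ) (a b : FreeMonoid B) : Prop :=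
  ∃ s t, s ≠ t ∧ m s t ≠ 0 ∧ a = FreeMonoid.ofList (altList s t (m s t)) ∧
    b = FreeMonoid.ofList (altList t s (m s t))

/-- The Artin-Tits monoid attached to `m`. -/
abbrev ArtinMonoid (m : B → B → ℕ) : Type _ := PresentedMonoid (monoidRel m)

/-- The generators of the Artin-Tits monoid. -/
def mgen (m : B → B → ℕ) (s : B) : ArtinMonoid m := PresentedMonoid.of _ s

theorem length_altList (s t : B) (n : ℕ) : (altList s t n).length = n := by
  induction n generalizing s t with
  | zero => rfl
  | succ n ih => simp [altList, ih]

/-- The alternating product `a * b * a * ⋯` with `n` factors. -/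
def altProd {N : Type*} [Monoid N] (a b : N) : ℕ → N
  | 0 => 1
  | n + 1 => a * altProd b a n

theorem prod_map_altList {N : Type*} [Monoid N] (f : B → N) (s t : B) (n : ℕ) :
    ((altList s t n).map f).prod = altProd (f s) (f t) n := by
  induction n generalizing s t with
  | zero => rfl
  | succ n ih => simp [altList, altProd, ih]

theorem map_altProd {N P : Type*} [Monoid N] [Monoid P] (f : N →* P) (a b : N) (n : ℕ) :
    f (altProd a b n) = altProd (f a) (f b) n := by
  induction n generalizing a b with
  | zero => exact map_one f
  | succ n ih => simp [altProd, ih]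

variable {m : B → B → ℕ}

/-- A family of elements satisfying the braid relations defines a morphism. -/
def ArtinMonoid.lift {N : Type*} [Monoid N] (f : B → N)
    (hf : ∀ s t, s ≠ t → m s t ≠ 0 → altProd (f s) (f t) (m s t) = altProd (f t) (f s) (m s t)) :
    ArtinMonoid m →* N :=
  PresentedMonoid.lift f (by
    rintro a b ⟨s, t, hne, h0, rfl, rfl⟩
    simpa [FreeMonoid.lift_ofList, prod_map_altList] using hf s t hne h0)

@[simp]
theorem ArtinMonoid.lift_mgen {N : Type*} [Monoid N] (f : B → N)
    (hf : ∀ s t, s ≠ t → m s t ≠ 0 → altProd (f s) (f t) (m s t) = altProd (f t) (f s) (m s t))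
    (s : B) : ArtinMonoid.lift f hf (mgen m s) = f s :=
  PresentedMonoid.lift_of _ _

theorem mk_ofList (l : List B) :
    PresentedMonoid.mk (monoidRel m) (FreeMonoid.ofList l) = (l.map (mgen m)).prod := by
  induction l with
  | nil => rfl
  | cons a l ih =>
    rw [FreeMonoid.ofList_cons, map_mul, ih, List.map_cons, List.prod_cons]
    rfl

theorem exists_word (g : ArtinMonoid m) : ∃ l : List B, (l.map (mgen m)).prod = g := by
  obtain ⟨w, rfl⟩ := PresentedMonoid.surjective_mk g
  exact ⟨w.toList, (mk_ofList _).symm⟩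

theorem braid_mgen {s t : B} (hne : s ≠ t) (h : m s t ≠ 0) :
    altProd (mgen m s) (mgen m t) (m s t) = altProd (mgen m t) (mgen m s) (m s t) := by
  rw [← prod_map_altList, ← prod_map_altList, ← mk_ofList, ← mk_ofList]
  exact PresentedMonoid.mk_eq_mk_of_rel ⟨s, t, hne, h, rfl, rfl⟩

/-- The length morphism. -/
def mlen (g : ArtinMonoid m) : ℕ :=
  (ArtinMonoid.lift (m := m) (fun _ => Multiplicative.ofAdd 1) (fun _ _ _ _ => rfl) g).toAdd

@[simp]
theorem mlen_one : mlen (1 : ArtinMonoid m) = 0 := by simp [mlen]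

@[simp]
theorem mlen_mul (g h : ArtinMonoid m) : mlen (g * h) = mlen g + mlen h := by simp [mlen]

@[simp]
theorem mlen_mgen (s : B) : mlen (mgen m s) = 1 := by simp [mlen]

theorem mlen_prod (l : List B) : mlen ((l.map (mgen m)).prod) = l.length := by
  induction l with
  | nil => simp
  | cons a l ih => simp [ih, add_comm]

theorem eq_one_or_mgen_mul (g : ArtinMonoid m) : g = 1 ∨ ∃ s h, g = mgen m s * h := by
  obtain ⟨l, rfl⟩ := exists_word g
  cases l with
  | nil => exact .inl rfl
  | cons a l => exact .inr ⟨a, _, List.prod_cons⟩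

theorem eq_one_of_mlen {g : ArtinMonoid m} (h : mlen g = 0) : g = 1 := by
  obtain h1 | ⟨s, k, rfl⟩ := eq_one_or_mgen_mul g
  · exact h1
  · simp at h

end ArtinMonoids

section GraphMonoid

variable {V : Type*} {G : SimpleGraph V}

open Classical in
/-- The Coxeter matrix with entries `2` and `3` given by a graph. -/
noncomputable def graphMat (G : SimpleGraph V) (s t : V) : ℕ := if G.Adj s t then 3 else 2

theorem graphMat_adj {s t : V} (h : G.Adj s t) : graphMat G s t = 3 := if_pos h

theorem graphMat_orth {s t : V} (h : ¬ G.Adj s t) : graphMat G s t = 2 := if_neg h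

theorem mgen_comm {s t : V} (hne : s ≠ t) (h : ¬ G.Adj s t) :
    mgen (graphMat G) s * mgen (graphMat G) t = mgen (graphMat G) t * mgen (graphMat G) s := by
  have := braid_mgen (m := graphMat G) hne (by simp [graphMat_orth h])
  simpa [graphMat_orth h, altProd] using this

theorem mgen_braid {s t : V} (h : G.Adj s t) :
    mgen (graphMat G) s * (mgen (graphMat G) t * mgen (graphMat G) s) =
      mgen (graphMat G) t * (mgen (graphMat G) s * mgen (graphMat G) t) := by
  have := braid_mgen (m := graphMat G) h.ne (by simp [graphMat_adj h])
  simpa [graphMat_adj h, altProd] using this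

variable [Fintype V]

/-- The representation of the Artin-Tits monoid of a triangle-free graph by deformed actions. -/
noncomputable def deformHom (hG : TriangleFree G) (x : ℝ) :
    ArtinMonoid (graphMat G) →* Module.End ℝ ((V → ℤ) → ℝ) :=
  ArtinMonoid.lift (deform G x) fun s t hne _ => by
    by_cases h : G.Adj s t
    · simpa [graphMat_adj h, altProd] using deform_braid hG x h
    · simpa [graphMat_orth h, altProd] using deform_comm hG x hne h

@[simp]
theorem deformHom_mgen (hG : TriangleFree G) (x : ℝ) (s : V) :
    deformHom hG x (mgen (graphMat G) s) = deform G x s := ArtinMonoid.lift_mgen ..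

theorem markov_surjective (s : V) (k : (V → ℤ) → ℝ) (hk : k (sroot s) = 0) (c : ℝ) :
    ∃ h, markov G s h = k ∧ h (sroot s) = c := by
  classical
  refine ⟨fun β => if PosRoot G β then if β = sroot s then c else
    if pairing G s β ≤ 0 then k (srefl G s β) else 2 * k (srefl G s β) - k β else k β,
    funext fun β => ?_, by simp [PosRoot.simple]⟩
  by_cases hβ : PosRoot G β
  swap
  · simp [markov_of_not_posRoot hβ, hβ]
  by_cases hs : β = sroot s
  · rw [hs, markov_self, hk]
  have h1 := hβ.srefl hs
  have h2 := srefl_ne_sroot_self hβ s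
  have h3 := pairing_srefl_same (G := G) s β
  rcases lt_or_ge (pairing G s β) 0 with h | h
  · rw [markov_of_neg hβ h]
    have : ¬ pairing G s (srefl G s β) ≤ 0 := by omega
    simp only [hβ, h1, hs, h2, h.le, this, srefl_srefl, if_true, if_false]
    ring
  · rw [markov_of_nonneg hβ h hs]
    have : pairing G s (srefl G s β) ≤ 0 := by omega
    simp only [h1, h2, this, srefl_srefl, if_true, if_false]

theorem eq_zero_of_markov_eq_zero {s : V} {h : (V → ℤ) → ℝ} (h0 : markov G s h = 0)
    (hs : h (sroot s) = 0) : h = 0 := by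
  funext β
  by_cases hβ : PosRoot G β
  swap
  · simpa [markov_of_not_posRoot hβ] using congrFun h0 β
  by_cases hs' : β = sroot s
  · rw [hs', hs, Pi.zero_apply]
  have h1 := hβ.srefl hs'
  have h2 := srefl_ne_sroot_self hβ s
  have h3 := pairing_srefl_same (G := G) s β
  have key : ∀ {γ}, PosRoot G γ → γ ≠ sroot s → pairing G s γ ≤ 0 → h γ = 0 := by
    intro γ hγ hne hp
    have := congrFun h0 (srefl G s γ)
    rwa [markov_of_nonneg (hγ.srefl hne) (by rw [pairing_srefl_same]; omega)
      (srefl_ne_sroot_self hγ s), srefl_srefl] at this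
  rcases le_or_gt (pairing G s β) 0 with h | h
  · exact key hβ hs' h
  · have := congrFun h0 (srefl G s β)
    rw [markov_of_neg h1 (by omega), srefl_srefl, key h1 h2 (by omega), Pi.zero_apply] at this
    rw [Pi.zero_apply]
    linarith

theorem isUnit_deform {x : ℝ} (hx : x ≠ 0) (s : V) : IsUnit (deform G x s) := by
  rw [Module.End.isUnit_iff]
  constructor
  · rw [injective_iff_map_eq_zero]
    intro h h0
    have hs : h (sroot s) = 0 := by
      have := congrFun h0 (sroot s)
      simpa [deform_apply, markov_self, kcoef_self, hx] using this
    exact eq_zero_of_markov_eq_zero (by simpa [deform_apply, hs] using h0) hs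
  · intro k
    obtain ⟨h, h1, h2⟩ := markov_surjective (G := G) s (k - k (sroot s) • kcoef G s)
      (by simp [kcoef_self]) (k (sroot s) / x)
    refine ⟨h, ?_⟩
    rw [deform_apply, h1, h2, mul_div_cancel₀ _ hx]
    abel

theorem continuous_deform_apply (s : V) {f : ℝ → (V → ℤ) → ℝ}
    (hf : ∀ β, Continuous fun x => f x β) (β : V → ℤ) :
    Continuous fun x => deform G x s (f x) β := by
  have : Continuous fun x => markov G s (f x) β := by
    by_cases hβ : PosRoot G β
    swap
    · simpa only [markov_of_not_posRoot hβ] using hf β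
    by_cases hs : β = sroot s
    · subst hs; simpa only [markov_self] using continuous_const
    rcases lt_or_ge (pairing G s β) 0 with h | h
    · simp only [markov_of_neg hβ h]
      exact ((hf _).add (hf _)).div_const 2
    · simpa only [markov_of_nonneg hβ h hs] using hf _
  simp only [deform_apply, Pi.add_apply, Pi.smul_apply, smul_eq_mul]
  exact this.add ((continuous_id.mul (hf _)).mul continuous_const)

theorem continuous_deformHom (hG : TriangleFree G) (g : ArtinMonoid (graphMat G))
    (β : V → ℤ) : Continuous fun x => deformHom hG x g 1 β := by
  obtain ⟨l, rfl⟩ := exists_word g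
  induction l generalizing β with
  | nil => simpa using continuous_const
  | cons s l ih => simpa using continuous_deform_apply s ih β

/-- The orbit of the constant function `1` under the undeformed action. -/
noncomputable def weight (hG : TriangleFree G) (g : ArtinMonoid (graphMat G)) : (V → ℤ) → ℝ :=
  deformHom hG 0 g 1

theorem weight_mgen_mul (hG : TriangleFree G) (s : V) (g : ArtinMonoid (graphMat G)) :
    weight hG (mgen _ s * g) = markov G s (weight hG g) := by
  simp [weight, deform_zero]

theorem weight_one (hG : TriangleFree G) (β : V → ℤ) : weight hG 1 β = 1 := by
  simp [weight]

theorem weight_eq_of_deformHom_eq (hG : TriangleFree G) {g h : ArtinMonoid (graphMat G)}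
    (e : ∀ x ≠ 0, deformHom hG x g = deformHom hG x h) : weight hG g = weight hG h := by
  funext β
  have := Continuous.ext_on (dense_compl_singleton (0 : ℝ)) (continuous_deformHom hG g β)
    (continuous_deformHom hG h β) fun x hx => by rw [e x hx]
  exact congrFun this 0

theorem markov_nonneg {h : (V → ℤ) → ℝ} (hh : ∀ β, 0 ≤ h β) (s : V) (β : V → ℤ) :
    0 ≤ markov G s h β := by
  by_cases hβ : PosRoot G β
  swap
  · rw [markov_of_not_posRoot hβ]; exact hh β
  by_cases hs : β = sroot s
  · rw [hs, markov_self]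
  rcases lt_or_ge (pairing G s β) 0 with h | h
  · rw [markov_of_neg hβ h]; linarith [hh β, hh (srefl G s β)]
  · rw [markov_of_nonneg hβ h hs]; exact hh _

theorem weight_nonneg (hG : TriangleFree G) (g : ArtinMonoid (graphMat G)) (β : V → ℤ) :
    0 ≤ weight hG g β := by
  obtain ⟨l, rfl⟩ := exists_word g
  induction l generalizing β with
  | nil => rw [List.map_nil, List.prod_nil, weight_one]; exact zero_le_one
  | cons s l ih => rw [List.map_cons, List.prod_cons, weight_mgen_mul]; exact markov_nonneg ih s β

theorem mgen_dvd_of_weight_eq_zero_aux (hG : TriangleFree G) (n : ℕ) :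
    ∀ {g : ArtinMonoid (graphMat G)} {s : V}, mlen g < n → weight hG g (sroot s) = 0 →
      ∃ h, g = mgen _ s * h := by
  induction n with
  | zero => intro g s hn; omega
  | succ n ih =>
    intro g s hn hs
    obtain rfl | ⟨t, h, rfl⟩ := eq_one_or_mgen_mul g
    · rw [weight_one] at hs; norm_num at hs
    rw [mlen_mul, mlen_mgen] at hn
    by_cases hts : t = s
    · exact ⟨h, by rw [hts]⟩
    rw [weight_mgen_mul] at hs
    by_cases hadj : G.Adj t s
    · rw [markov_sroot_adj hadj] at hs
      have p1 := weight_nonneg hG h (sroot s)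
      have p2 := weight_nonneg hG h (srefl G t (sroot s))
      have q1 : weight hG h (sroot s) = 0 := by linarith
      have q2 : weight hG h (srefl G t (sroot s)) = 0 := by linarith
      obtain ⟨h', rfl⟩ := ih (by omega) q1
      rw [srefl_sroot_adj hadj, weight_mgen_mul, markov_srefl_sroot hadj.symm] at q2
      rw [mlen_mul, mlen_mgen] at hn
      obtain ⟨h'', rfl⟩ := ih (by omega) q2
      refine ⟨mgen _ t * (mgen _ s * h''), ?_⟩
      simpa only [mul_assoc] using congrArg (· * h'') (mgen_braid hadj)
    · rw [markov_sroot_orth hts hadj] at hs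
      obtain ⟨h', rfl⟩ := ih (by omega) hs
      refine ⟨mgen _ t * h', ?_⟩
      simpa only [mul_assoc] using congrArg (· * h') (mgen_comm hts hadj)

/-- A generator divides an element on the left as soon as the corresponding weight vanishes. -/
theorem mgen_dvd_of_weight_eq_zero (hG : TriangleFree G) {g : ArtinMonoid (graphMat G)} {s : V}
    (h : weight hG g (sroot s) = 0) : ∃ h, g = mgen _ s * h :=
  mgen_dvd_of_weight_eq_zero_aux hG _ (Nat.lt_succ_self _) h

end GraphMonoid

section Flip

variable {V : Type*} [Fintype V] {G : SimpleGraph V}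

open Classical in
variable (G) in
/-- Apply the reflections in those `v ∈ l` which have positive pairing with `β` or lie in `E`. -/
noncomputable def flip (l : List V) (E : Set V) (β : V → ℤ) : V → ℤ :=
  fun v => if v ∈ l ∧ (0 < pairing G v β ∨ v ∈ E) then β v - pairing G v β else β v

theorem flip_nil (E : Set V) (β : V → ℤ) : flip G [] E β = β := by
  funext v; simp [flip]

/-- The elements of `l` are distinct and pairwise non adjacent. -/
def Orthogonal (G : SimpleGraph V) (l : List V) : Prop :=
  l.Pairwise fun x y => x ≠ y ∧ ¬ G.Adj x y

open Classical in
theorem flip_cons_of_flip {x : V} {l : List V} (hl : Orthogonal G (x :: l)) {E : Set V}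
    {β : V → ℤ} (h : 0 < pairing G x β ∨ x ∈ E) :
    flip G (x :: l) E β = flip G l E (srefl G x β) := by
  rw [Orthogonal, List.pairwise_cons] at hl
  funext v
  by_cases hv : v = x
  · subst hv
    have : v ∉ l := fun hv => (hl.1 v hv).1 rfl
    simp [flip, this, h, srefl_apply_same]
  · by_cases hvl : v ∈ l
    · have := hl.1 v hvl
      have e := pairing_srefl_orth hv (fun k => this.2 k.symm) β
      rw [flip, flip, e, srefl_apply_of_ne hv]
      exact if_congr (by simp [hvl]) rfl rfl
    · simp [flip, hv, hvl, srefl_apply_of_ne hv]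

open Classical in
theorem flip_cons_of_not_flip {x : V} {l : List V} {E : Set V} {β : V → ℤ}
    (h : ¬ (0 < pairing G x β ∨ x ∈ E)) : flip G (x :: l) E β = flip G l E β := by
  funext v
  by_cases hv : v = x
  · subst hv; simp only [flip, h, and_false, if_false]
  · exact if_congr (by simp [hv]) rfl rfl

open Classical in
theorem flip_congr {l : List V} {E E' : Set V} {β : V → ℤ} (h : ∀ v ∈ l, v ∈ E ↔ v ∈ E') :
    flip G l E β = flip G l E' β := by
  funext v
  by_cases hv : v ∈ l
  · exact if_congr (by rw [h v hv]) rfl rfl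
  · simp [flip, hv]

theorem weight_prod_mul_eq_zero_iff (hG : TriangleFree G) (g : ArtinMonoid (graphMat G))
    {l : List V} (hl : Orthogonal G l) {β : V → ℤ} (hβ : PosRoot G β)
    (hne : ∀ x ∈ l, β ≠ sroot x) :
    weight hG ((l.map (mgen _)).prod * g) β = 0 ↔ ∀ E, weight hG g (flip G l E β) = 0 := by
  induction l generalizing β with
  | nil => simp [flip_nil]
  | cons x l ih =>
    have hl' := List.pairwise_cons.1 hl
    have hx := hne x List.mem_cons_self
    have e1 := ih hl'.2 hβ fun y hy => hne y (List.mem_cons_of_mem _ hy)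
    have e2 := ih hl'.2 (hβ.srefl hx) fun y hy k => by
      rw [eq_srefl_iff, srefl_sroot_orth (hl'.1 y hy).1 (hl'.1 y hy).2] at k
      exact hne y (List.mem_cons_of_mem _ hy) k
    rw [List.map_cons, List.prod_cons, mul_assoc, weight_mgen_mul]
    have hxl : x ∉ l := fun h => (hl'.1 x h).1 rfl
    rcases lt_or_ge (pairing G x β) 0 with h | h
    · have p1 := weight_nonneg hG ((l.map (mgen _)).prod * g) β
      have p2 := weight_nonneg hG ((l.map (mgen _)).prod * g) (srefl G x β)
      rw [markov_of_neg hβ h]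
      trans weight hG ((l.map (mgen _)).prod * g) β = 0 ∧
        weight hG ((l.map (mgen _)).prod * g) (srefl G x β) = 0
      · constructor
        · intro k; constructor <;> linarith
        · rintro ⟨k1, k2⟩; rw [k1, k2]; norm_num
      rw [e1, e2]
      constructor
      · rintro ⟨k1, k2⟩ E
        by_cases hE : x ∈ E
        · rw [flip_cons_of_flip hl (.inr hE)]; exact k2 E
        · rw [flip_cons_of_not_flip (by simp [hE, h.le])]; exact k1 E
      · refine fun k => ⟨fun E => ?_, fun E => ?_⟩
        · rw [← flip_congr (E := E \ {x})
            fun v hv => by simp [show v ≠ x from fun k => hxl (k ▸ hv)],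
            ← flip_cons_of_not_flip (x := x) (by simp [h.le])]
          exact k _
        · rw [← flip_congr (E := insert x E)
            fun v hv => by simp [show v ≠ x from fun k => hxl (k ▸ hv)],
            ← flip_cons_of_flip hl (.inr (by simp))]
          exact k _
    · rw [markov_of_nonneg hβ h hx, e2]
      refine forall_congr' fun E => ?_
      by_cases hE : 0 < pairing G x β ∨ x ∈ E
      · rw [flip_cons_of_flip hl hE]
      · have h0 : pairing G x β = 0 := le_antisymm (not_lt.1 fun k => hE (.inl k)) h
        rw [flip_cons_of_not_flip hE, srefl_of_pairing_eq_zero h0]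

theorem weight_prod_mul_sroot (hG : TriangleFree G) (g : ArtinMonoid (graphMat G))
    {l : List V} (hl : Orthogonal G l) {x : V} (hx : x ∈ l) :
    weight hG ((l.map (mgen _)).prod * g) (sroot x) = 0 := by
  induction l with
  | nil => simp at hx
  | cons y l ih =>
    have hl' := List.pairwise_cons.1 hl
    rw [List.map_cons, List.prod_cons, mul_assoc, weight_mgen_mul]
    rcases List.mem_cons.1 hx with rfl | hx
    · exact markov_self
    · rw [markov_sroot_orth (hl'.1 x hx).1 (hl'.1 x hx).2, ih hl'.2 hx]

theorem prod_dvd_of_weight_eq_zero (hG : TriangleFree G) {g : ArtinMonoid (graphMat G)}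
    {l : List V} (hl : Orthogonal G l) (h : ∀ x ∈ l, weight hG g (sroot x) = 0) :
    ∃ k, g = (l.map (mgen _)).prod * k := by
  induction l generalizing g with
  | nil => exact ⟨g, by simp⟩
  | cons y l ih =>
    have hl' := List.pairwise_cons.1 hl
    obtain ⟨g', rfl⟩ := mgen_dvd_of_weight_eq_zero hG (h y List.mem_cons_self)
    obtain ⟨k, rfl⟩ := ih (g := g') hl'.2 fun x hx => by
      have := h x (List.mem_cons_of_mem _ hx)
      rwa [weight_mgen_mul, markov_sroot_orth (hl'.1 x hx).1 (hl'.1 x hx).2] at this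
    exact ⟨k, by rw [List.map_cons, List.prod_cons, mul_assoc]⟩

end Flip

section Fold

variable {B : Type*}

/-- The hypotheses under which `foldGraph` unfolds the Coxeter matrix `m` into a graph with `L`
vertices above each generator. -/
structure Foldable (m : B → B → ℕ) (L : ℕ) : Prop where
  symm : ∀ s t, m s t = m t s
  two_le : ∀ s t, s ≠ t → 2 ≤ m s t
  dvd : ∀ s t, s ≠ t → m s t - 1 ∣ L
  pos : 0 < L

variable {m : B → B → ℕ} {L : ℕ}

/-- The unfolding of `m`: above a pair `s`, `t` it is a disjoint union of alternating paths with
`m s t - 1` vertices. -/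
def foldGraph (hm : Foldable m L) : SimpleGraph (B × Fin L) where
  Adj v w := v.1 ≠ w.1 ∧ ((v.2 : ℕ) + 1 = w.2 ∨ (w.2 : ℕ) + 1 = v.2) ∧
    (v.2 : ℕ) / (m v.1 w.1 - 1) = (w.2 : ℕ) / (m v.1 w.1 - 1)
  symm := ⟨fun v w h => ⟨h.1.symm, h.2.1.symm, by rw [hm.symm w.1 v.1]; exact h.2.2.symm⟩⟩
  loopless := ⟨fun v h => h.1 rfl⟩

variable (hm : Foldable m L)

theorem foldGraph_triangleFree : TriangleFree (foldGraph hm) := by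
  intro x y z hxy hyz hxz
  have h1 := hxy.2.1
  have h2 := hyz.2.1
  have h3 := hxz.2.1
  omega

/-- The letter at position `i` of a path alternating between `x` and `y`. -/
def letter (x y : B) (i : ℤ) : B := if i % 2 = 0 then x else y

theorem letter_eq_iff {x y : B} (hne : x ≠ y) {i j : ℤ} :
    letter x y i = letter x y j ↔ i % 2 = j % 2 := by
  unfold letter
  split_ifs with h1 h2 h2
  · simp [h1, h2]
  · simp [hne, h1, Ne.symm h2]
  · simp [hne.symm, h1, h2]
  · simp only [true_iff]; omega

theorem letter_congr (x y : B) {i j : ℤ} (h : i % 2 = j % 2) : letter x y i = letter x y j := by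
  simp [letter, h]

open Classical in
/-- The sum of the simple roots at the positions between `a` and `b` of an alternating path. -/
noncomputable def ivl (x y : B) (a b : ℤ) : B × Fin L → ℤ :=
  fun v => if a ≤ (v.2 : ℤ) ∧ (v.2 : ℤ) ≤ b ∧ v.1 = letter x y v.2 then 1 else 0

/-- `[lo, hi]` is the set of positions of one of the alternating paths above `x` and `y`. -/
structure IsSegment (m : B → B → ℕ) (L : ℕ) (x y : B) (lo hi : ℤ) : Prop where
  nonneg : 0 ≤ lo
  lt : hi < L
  div_iff : ∀ i : ℕ, lo ≤ i ∧ (i : ℤ) ≤ hi ∨ lo ≤ i + 1 ∧ (i : ℤ) + 1 ≤ hi →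
    (i / (m x y - 1) = (i + 1) / (m x y - 1) ↔ lo ≤ i ∧ (i : ℤ) + 1 ≤ hi)

variable {hm} {x y : B} {lo hi : ℤ}

theorem ivl_same {i : Fin L} : ivl x y i i = sroot (letter x y i, i) := by
  funext ⟨w, j⟩
  by_cases h : (w, j) = (letter x y i, i)
  · rw [h, sroot_same]
    exact if_pos ⟨le_rfl, le_rfl, rfl⟩
  · rw [sroot_of_ne h]
    refine if_neg fun ⟨h1, h2, h3⟩ => h ?_
    have : j = i := Fin.ext (by exact_mod_cast le_antisymm h2 h1)
    rw [Prod.mk.injEq]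
    exact ⟨by rw [← this]; exact h3, this⟩

open Classical in
theorem ivl_succ {a b : ℤ} (hab : a ≤ b + 1) {i : Fin L} (hi : (i : ℤ) = b + 1) :
    ivl x y a (b + 1) = ivl x y a b + sroot (letter x y i, i) := by
  funext ⟨w, j⟩
  by_cases hj : j = i
  · subst hj
    by_cases hw : w = letter x y j
    · subst hw
      simp [ivl, sroot_same, hi, hab]
    · simp [ivl, sroot, hw]
  · have : (w, j) ≠ (letter x y i, i) := fun h => hj (Prod.ext_iff.1 h).2
    rw [Pi.add_apply, sroot_of_ne this, add_zero]
    refine if_congr ?_ rfl rfl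
    have : (j : ℤ) ≠ i := fun h => hj (Fin.ext (by omega))
    constructor <;> rintro ⟨h1, h2, h3⟩ <;> exact ⟨h1, by dsimp only at *; omega, h3⟩

variable [Fintype B]

theorem pairing_add {V : Type*} [Fintype V] {G : SimpleGraph V} (v : V) (β γ : V → ℤ) :
    pairing G v (β + γ) = pairing G v β + pairing G v γ := by
  have : β + γ = β - (-1 : ℤ) • γ := by module
  rw [this, pairing_sub, pairing_smul]; ring

theorem pairing_node (hne : x ≠ y) (hs : IsSegment m L x y lo hi) {c : ℤ} {i j : Fin L}
    (h1 : lo ≤ j) (h2 : (j : ℤ) ≤ hi) :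
    pairing (foldGraph hm) (letter x y c, i) (sroot (letter x y j, j)) =
      if (i : ℤ) % 2 = c % 2 then
        (if (i : ℤ) = j then 2 else 0) + (if lo ≤ i ∧ (j : ℤ) = i + 1 then -1 else 0) +
          (if (i : ℤ) ≤ hi ∧ (j : ℤ) = i - 1 then -1 else 0)
      else 0 := by
  have hmm : ∀ k, letter x y c ≠ letter x y k → m (letter x y c) (letter x y k) = m x y := by
    intro k
    unfold letter
    split_ifs
    · simp
    · simp
    · simp [hm.symm y x]
    · simp
  have hadj : (foldGraph hm).Adj (letter x y c, i) (letter x y j, j) ↔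
      (j : ℤ) % 2 ≠ c % 2 ∧ (lo ≤ i ∧ (j : ℤ) = i + 1 ∨ (i : ℤ) ≤ hi ∧ (j : ℤ) = i - 1) := by
    have e1 : letter x y c ≠ letter x y j ↔ (j : ℤ) % 2 ≠ c % 2 := by
      rw [Ne, letter_eq_iff hne, eq_comm]
    by_cases hcj : (j : ℤ) % 2 = c % 2
    · exact ⟨fun h => absurd hcj (e1.1 h.1), fun h => absurd hcj h.1⟩
    have e2 := hmm j (e1.2 hcj)
    have e3 := hs.div_iff i
    have e4 := hs.div_iff j
    change letter x y c ≠ letter x y j ∧ ((i : ℕ) + 1 = j ∨ (j : ℕ) + 1 = i) ∧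
      (i : ℕ) / (m (letter x y c) (letter x y j) - 1) =
        (j : ℕ) / (m (letter x y c) (letter x y j) - 1) ↔ _
    rw [e1, e2]
    constructor
    · rintro ⟨_, h | h, h'⟩
      · rw [← h] at h'; rw [e3 (by omega)] at h'; omega
      · rw [← h, eq_comm] at h'; rw [e4 (by omega)] at h'; omega
    · rintro ⟨_, ⟨h, h'⟩ | ⟨h, h'⟩⟩
      · refine ⟨hcj, by omega, ?_⟩
        rw [show (j : ℕ) = i + 1 by omega, e3 (by omega)]; omega
      · refine ⟨hcj, by omega, ?_⟩
        rw [show (i : ℕ) = j + 1 by omega, eq_comm, e4 (by omega)]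
        omega
  by_cases hsame : (letter x y c, i) = (letter x y j, j)
  · have h3 := (letter_eq_iff hne).1 (Prod.ext_iff.1 hsame).1
    have h4 : i = j := (Prod.ext_iff.1 hsame).2
    rw [hsame, pairing_sroot_same]
    subst h4
    rw [if_pos h3.symm, if_pos rfl, if_neg (by omega), if_neg (by omega)]
    rfl
  have hsame' : (j : ℤ) % 2 = c % 2 → (i : ℤ) ≠ j := by
    intro h h'
    exact hsame (Prod.ext ((letter_eq_iff hne).2 h.symm) (show i = j from Fin.ext (by omega)))
  by_cases h : (foldGraph hm).Adj (letter x y c, i) (letter x y j, j)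
  · rw [pairing_sroot_adj h]
    rw [hadj] at h
    rw [if_pos (by omega), if_neg (by omega)]
    rcases h.2 with k | k
    · rw [if_pos k, if_neg (by omega)]; rfl
    · rw [if_neg (by omega), if_pos k]; rfl
  · rw [pairing_sroot_orth hsame h]
    rw [hadj] at h
    by_cases h5 : (i : ℤ) % 2 = c % 2
    · rw [if_pos h5, if_neg (by omega), if_neg (by omega), if_neg (by omega)]; rfl
    · rw [if_neg h5]

theorem pairing_ivl (hne : x ≠ y) (hs : IsSegment m L x y lo hi) {c a b : ℤ} {i : Fin L}
    (h1 : lo ≤ a) (h2 : b ≤ hi) (hab : a ≤ b) :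
    pairing (foldGraph hm) (letter x y c, i) (ivl x y a b) =
      if (i : ℤ) % 2 = c % 2 then
        (if a ≤ i ∧ (i : ℤ) ≤ b then 2 else 0) +
        (if lo ≤ i ∧ a ≤ i + 1 ∧ (i : ℤ) + 1 ≤ b then -1 else 0) +
          (if (i : ℤ) ≤ hi ∧ a ≤ i - 1 ∧ (i : ℤ) - 1 ≤ b then -1 else 0)
      else 0 := by
  obtain ⟨n, rfl⟩ : ∃ n : ℕ, b = a + n := ⟨(b - a).toNat, by omega⟩
  have hn := hs.nonneg
  have hl := hs.lt
  induction n with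
  | zero =>
    obtain ⟨j, hj⟩ : ∃ j : Fin L, (j : ℤ) = a := ⟨⟨a.toNat, by omega⟩, by simp; omega⟩
    simp only [Nat.cast_zero, add_zero]
    rw [← hj, ivl_same, pairing_node hne hs (by omega) (by omega)]
    congr 2
    · congr 1
      · exact if_congr (by omega) rfl rfl
      · exact if_congr (by omega) rfl rfl
    · exact if_congr (by omega) rfl rfl
  | succ n ih =>
    obtain ⟨j, hj⟩ : ∃ j : Fin L, (j : ℤ) = a + n + 1 :=
      ⟨⟨(a + n + 1).toNat, by omega⟩, by simp; omega⟩
    rw [Nat.cast_succ, ← add_assoc, ivl_succ (by omega) hj, pairing_add, ih (by omega) (by omega),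
      pairing_node hne hs (by omega) (by omega)]
    split_ifs <;> omega

theorem posRoot_ivl (hne : x ≠ y) (hs : IsSegment m L x y lo hi) {a b : ℤ}
    (h1 : lo ≤ a) (h2 : b ≤ hi) (hab : a ≤ b) : PosRoot (foldGraph hm) (ivl x y a b) := by
  obtain ⟨n, rfl⟩ : ∃ n : ℕ, b = a + n := ⟨(b - a).toNat, by omega⟩
  have hn := hs.nonneg
  have hl := hs.lt
  induction n with
  | zero =>
    obtain ⟨j, hj⟩ : ∃ j : Fin L, (j : ℤ) = a := ⟨⟨a.toNat, by omega⟩, by simp; omega⟩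
    simp only [Nat.cast_zero, add_zero]
    rw [← hj, ivl_same]
    exact .simple _
  | succ n ih =>
    obtain ⟨j, hj⟩ : ∃ j : Fin L, (j : ℤ) = a + n + 1 :=
      ⟨⟨(a + n + 1).toNat, by omega⟩, by simp; omega⟩
    rw [Nat.cast_succ, ← add_assoc, ivl_succ (by omega) hj]
    have e : pairing (foldGraph hm) (letter x y j, j) (ivl x y a (a + n)) = -1 := by
      rw [pairing_ivl hne hs (by omega) (by omega) (by omega), if_pos rfl, if_neg (by omega),
        if_neg (by omega), if_pos (by omega)]
      rfl
    have := (ih (by omega) (by omega)).raise (x := (letter x y j, j)) (by rw [e]; norm_num)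
    rwa [srefl, e, neg_one_smul, sub_neg_eq_add] at this

end Fold

section Dynamics

variable {B : Type*} {m : B → B → ℕ} {L : ℕ} {hm : Foldable m L}
variable {x y : B} {lo hi : ℤ}

/-- The vertices of the unfolding above a generator. -/
def fiber (L : ℕ) (z : B) : List (B × Fin L) := (List.finRange L).map (z, ·)

theorem mem_fiber {z w : B} {i : Fin L} : (w, i) ∈ fiber L z ↔ w = z := by
  simp [fiber, eq_comm]

theorem orthogonal_fiber (hm : Foldable m L) (z : B) :
    Orthogonal (foldGraph hm) (fiber L z) := by
  rw [Orthogonal, fiber, List.pairwise_map]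
  refine (List.nodup_finRange L).imp fun h => ⟨fun k => h (Prod.ext_iff.1 k).2, fun k => k.1 rfl⟩

/-- The possible new endpoints of an interval after applying the generators at all positions of
the same parity as `c`. -/
def IvlStep (lo hi c a b a' b' : ℤ) : Prop :=
  (a % 2 = c % 2 ∧ a' = a + 1 ∨ a % 2 ≠ c % 2 ∧ (a' = a ∨ a' = a - 1 ∧ lo ≤ a')) ∧
    (b % 2 = c % 2 ∧ b' = b - 1 ∨ b % 2 ≠ c % 2 ∧ (b' = b ∨ b' = b + 1 ∧ b' ≤ hi))

theorem ivlStep_bounds {c a b a' b' : ℤ} (h : IvlStep lo hi c a b a' b') :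
    a - 1 ≤ a' ∧ a' ≤ a + 1 ∧ b - 1 ≤ b' ∧ b' ≤ b + 1 := by
  obtain ⟨⟨_, rfl⟩ | ⟨_, rfl | ⟨rfl, _⟩⟩, ⟨_, rfl⟩ | ⟨_, rfl | ⟨rfl, _⟩⟩⟩ := h <;> omega

open Classical in
theorem ivlStep_apply {c a b a' b' j q : ℤ} {F : Prop} (h1 : lo ≤ a) (h2 : b ≤ hi) (hab : a ≤ b)
    (hk : ¬ (a = b ∧ a % 2 = c % 2)) (h : IvlStep lo hi c a b a' b') (hj : j % 2 = c % 2)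
    (ha : a % 2 ≠ c % 2 → lo ≤ j → j = a - 1 → (F ↔ a' = a - 1))
    (hb : b % 2 ≠ c % 2 → j ≤ hi → j = b + 1 → (F ↔ b' = b + 1))
    (e : q = (if a ≤ j ∧ j ≤ b then 2 else 0) +
        (if lo ≤ j ∧ a ≤ j + 1 ∧ j + 1 ≤ b then -1 else 0) +
          (if j ≤ hi ∧ a ≤ j - 1 ∧ j - 1 ≤ b then -1 else 0)) :
    (if 0 < q ∨ F then (if a ≤ j ∧ j ≤ b then 1 else 0) - q else if a ≤ j ∧ j ≤ b then 1 else 0) =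
      if a' ≤ j ∧ j ≤ b' then 1 else 0 := by
  obtain ⟨g1, g2, g3, g4⟩ := ivlStep_bounds h
  rcases (by omega : j < a - 1 ∨ b + 1 < j ∨ j = a - 1 ∨ j = b + 1 ∨ (j = a ∧ a < b) ∨
    (j = b ∧ a < b) ∨ (a < j ∧ j < b) ∨ (a = b ∧ j = a)) with k | k | k | k | k | k | k | k
  · clear h hk ha hb hj
    rw [if_neg (by omega), if_neg (by omega), if_neg (by omega)] at e
    subst e
    rw [if_neg (by omega : ¬ (a ≤ j ∧ j ≤ b)), if_neg (by omega : ¬ (a' ≤ j ∧ j ≤ b'))]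
    simp
  · clear h hk ha hb hj
    rw [if_neg (by omega), if_neg (by omega), if_neg (by omega)] at e
    subst e
    rw [if_neg (by omega : ¬ (a ≤ j ∧ j ≤ b)), if_neg (by omega : ¬ (a' ≤ j ∧ j ≤ b'))]
    simp
  · have hac : a % 2 ≠ c % 2 := by omega
    replace h := h.1.resolve_left fun k => hac k.1
    replace ha := ha hac
    clear hk hb hj
    rw [if_neg (by omega), if_neg (by omega : ¬ (j ≤ hi ∧ a ≤ j - 1 ∧ j - 1 ≤ b))] at e
    rw [if_neg (by omega : ¬ (a ≤ j ∧ j ≤ b))]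
    by_cases hlo : lo ≤ j
    · rw [if_pos (by omega)] at e
      subst e
      by_cases hF : F
      · have := (ha hlo k).1 hF
        rw [if_pos (.inr hF), if_pos (by omega)]
        rfl
      · have := mt (ha hlo k).2 hF
        rw [if_neg (by simp [hF]), if_neg (by omega)]
    · rw [if_neg (by omega)] at e
      subst e
      rw [if_neg (by omega : ¬ (a' ≤ j ∧ j ≤ b'))]
      simp
  · have hbc : b % 2 ≠ c % 2 := by omega
    replace h := h.2.resolve_left fun k => hbc k.1
    replace hb := hb hbc
    clear hk ha hj
    rw [if_neg (by omega), if_neg (by omega : ¬ (lo ≤ j ∧ a ≤ j + 1 ∧ j + 1 ≤ b))] at e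
    rw [if_neg (by omega : ¬ (a ≤ j ∧ j ≤ b))]
    by_cases hhi : j ≤ hi
    · rw [if_pos (by omega)] at e
      subst e
      by_cases hF : F
      · have := (hb hhi k).1 hF
        rw [if_pos (.inr hF), if_pos (by omega)]
        rfl
      · have := mt (hb hhi k).2 hF
        rw [if_neg (by simp [hF]), if_neg (by omega)]
    · rw [if_neg (by omega)] at e
      subst e
      rw [if_neg (by omega : ¬ (a' ≤ j ∧ j ≤ b'))]
      simp
  · have hac : a % 2 = c % 2 := by omega
    replace h := h.1.resolve_right fun k => k.1 hac
    clear hk ha hb hj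
    rw [if_pos (by omega), if_pos (by omega), if_neg (by omega)] at e
    subst e
    rw [if_pos (.inl (by norm_num)), if_pos (by omega), if_neg (by omega)]
    rfl
  · have hbc : b % 2 = c % 2 := by omega
    replace h := h.2.resolve_right fun k => k.1 hbc
    clear hk ha hb hj
    rw [if_pos (by omega), if_neg (by omega), if_pos (by omega)] at e
    subst e
    rw [if_pos (.inl (by norm_num)), if_pos (by omega), if_neg (by omega)]
    rfl
  · clear h hk ha hb hj
    rw [if_pos (by omega), if_pos (by omega), if_pos (by omega)] at e
    subst e
    rw [if_pos (by omega : a ≤ j ∧ j ≤ b), if_pos (by omega : a' ≤ j ∧ j ≤ b')]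
    simp
  · exact absurd ⟨k.1, k.2 ▸ hj⟩ hk

theorem sroot_ne_ivl (hne : x ≠ y) (hs : IsSegment m L x y lo hi) {c a b : ℤ} (h1 : lo ≤ a)
    (h2 : b ≤ hi) (hab : a ≤ b) (hk : ¬ (a = b ∧ a % 2 = c % 2)) {v : B × Fin L}
    (hv : v ∈ fiber L (letter x y c)) : ivl x y a b ≠ sroot v := by
  obtain ⟨w, i⟩ := v
  rw [mem_fiber] at hv
  subst hv
  intro h
  have hn := hs.nonneg
  have hl := hs.lt
  have key : ∀ j : ℤ, a ≤ j → j ≤ b → j = i ∧ j % 2 = c % 2 := by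
    intro j h3 h4
    obtain ⟨k, hk⟩ : ∃ k : Fin L, (k : ℤ) = j := ⟨⟨j.toNat, by omega⟩, by simp; omega⟩
    have e := congrFun h (letter x y k, k)
    rw [ivl, if_pos ⟨by simpa [hk] using h3, by simpa [hk] using h4, rfl⟩] at e
    by_contra hc
    rw [sroot_of_ne] at e
    · norm_num at e
    · intro h
      have e1 := (letter_eq_iff hne).1 (Prod.ext_iff.1 h).1
      have e2 : k = i := (Prod.ext_iff.1 h).2
      subst e2
      exact hc ⟨hk.symm, by omega⟩
  have ka := key a le_rfl hab
  have kb := key b hab le_rfl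
  omega

variable (hm) in
/-- The product of the generators above `z`. -/
noncomputable def foldGen (z : B) : ArtinMonoid (graphMat (foldGraph hm)) :=
  ((fiber L z).map (mgen _)).prod

variable [Fintype B]

theorem flip_ivl (hne : x ≠ y) (hs : IsSegment m L x y lo hi) {c a b a' b' : ℤ}
    (h1 : lo ≤ a) (h2 : b ≤ hi) (hab : a ≤ b) (hk : ¬ (a = b ∧ a % 2 = c % 2))
    (h : IvlStep lo hi c a b a' b') {E : Set (B × Fin L)}
    (ha : a % 2 ≠ c % 2 → ∀ i : Fin L, lo ≤ i → (i : ℤ) = a - 1 →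
      ((letter x y c, i) ∈ E ↔ a' = a - 1))
    (hb : b % 2 ≠ c % 2 → ∀ i : Fin L, (i : ℤ) ≤ hi → (i : ℤ) = b + 1 →
      ((letter x y c, i) ∈ E ↔ b' = b + 1)) :
    flip (foldGraph hm) (fiber L (letter x y c)) E (ivl x y a b) = ivl x y a' b' := by
  classical
  funext ⟨w, i⟩
  by_cases hw : w = letter x y c
  swap
  · rw [flip, if_neg fun k => hw (mem_fiber.1 k.1)]
    by_cases hwi : w = letter x y i
    · have : (i : ℤ) % 2 ≠ c % 2 := by rw [hwi] at hw; exact fun k => hw (letter_congr x y k)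
      have e : ∀ p q : ℤ, ivl x y p q (w, i) = if p ≤ i ∧ (i : ℤ) ≤ q then 1 else 0 := by
        intro p q; simp [ivl, hwi]
      rw [e, e]
      have := ivlStep_bounds h
      unfold IvlStep at h
      exact if_congr (by omega) rfl rfl
    · simp [ivl, hwi]
  subst hw
  have hw := letter_eq_iff hne (i := c) (j := i)
  rw [flip]
  have e := pairing_ivl (hm := hm) (c := c) (i := i) hne hs h1 h2 hab
  by_cases hic : (i : ℤ) % 2 = c % 2
  swap
  · have : letter x y c ≠ letter x y i := by rw [Ne, hw]; omega
    rw [if_neg hic] at e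
    rw [e, sub_zero]
    simp [ivl, this]
  have e2 : ∀ p q : ℤ, ivl x y p q (letter x y c, i) = if p ≤ i ∧ (i : ℤ) ≤ q then 1 else 0 := by
    intro p q; simp [ivl, hw.2 hic.symm]
  rw [if_pos hic] at e
  simp only [mem_fiber, true_and]
  have ha := fun k => ha k i
  have hb := fun k => hb k i
  rw [e2, e2]
  convert ivlStep_apply h1 h2 hab hk h hic ha hb e

variable (hm) in
/-- The weight of an element of the Artin-Tits monoid of the unfolding. -/
noncomputable def foldWeight (g : ArtinMonoid (graphMat (foldGraph hm))) :
    (B × Fin L → ℤ) → ℝ := weight (foldGraph_triangleFree hm) g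

theorem foldWeight_foldGen_mul_eq_zero_iff (hne : x ≠ y) (hs : IsSegment m L x y lo hi)
    {c a b : ℤ} (h1 : lo ≤ a) (h2 : b ≤ hi) (hab : a ≤ b) (hk : ¬ (a = b ∧ a % 2 = c % 2))
    (g : ArtinMonoid (graphMat (foldGraph hm))) :
    foldWeight hm (foldGen hm (letter x y c) * g) (ivl x y a b) = 0 ↔
      ∀ a' b', IvlStep lo hi c a b a' b' → foldWeight hm g (ivl x y a' b') = 0 := by
  classical
  rw [foldWeight, foldWeight, foldGen, weight_prod_mul_eq_zero_iff _ _ (orthogonal_fiber hm _)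
    (posRoot_ivl hne hs h1 h2 hab) fun v hv => sroot_ne_ivl hne hs h1 h2 hab hk hv]
  constructor
  · intro h a' b' hab'
    rw [← h {v | (v.2 : ℤ) = a' ∨ (v.2 : ℤ) = b'}]
    congr 1
    symm
    unfold IvlStep at hab'
    apply flip_ivl hne hs h1 h2 hab hk hab'
    · intro _ i _ _
      simp only [Set.mem_ofPred_eq]
      omega
    · intro _ i _ _
      simp only [Set.mem_ofPred_eq]
      omega
  · intro h E
    rw [← h (if a % 2 = c % 2 then a + 1 else
        if lo ≤ a - 1 ∧ ∃ i : Fin L, (i : ℤ) = a - 1 ∧ (letter x y c, i) ∈ E then a - 1 else a)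
      (if b % 2 = c % 2 then b - 1 else
        if b + 1 ≤ hi ∧ ∃ i : Fin L, (i : ℤ) = b + 1 ∧ (letter x y c, i) ∈ E then b + 1 else b)]
    · congr 1
      apply flip_ivl hne hs h1 h2 hab hk
      · unfold IvlStep
        constructor <;> split_ifs <;> omega
      · intro h3 i h4 h5
        rw [if_neg h3]
        have : (∃ j : Fin L, (j : ℤ) = a - 1 ∧ (letter x y c, j) ∈ E) ↔
            (letter x y c, i) ∈ E := by
          constructor
          · rintro ⟨j, hj, hjE⟩
            rwa [show i = j from Fin.ext (by omega)]
          · exact fun k => ⟨i, h5, k⟩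
        simp only [this]
        split_ifs with h6
        · simp [h6.2]
        · constructor
          · intro k; exact absurd ⟨by omega, k⟩ h6
          · intro k; omega
      · intro h3 i h4 h5
        rw [if_neg h3]
        have : (∃ j : Fin L, (j : ℤ) = b + 1 ∧ (letter x y c, j) ∈ E) ↔
            (letter x y c, i) ∈ E := by
          constructor
          · rintro ⟨j, hj, hjE⟩
            rwa [show i = j from Fin.ext (by omega)]
          · exact fun k => ⟨i, h5, k⟩
        simp only [this]
        split_ifs with h6
        · simp [h6.2]
        · constructor
          · intro k; exact absurd ⟨by omega, k⟩ h6
          · intro k; omega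
    · unfold IvlStep
      constructor <;> split_ifs <;> omega

theorem foldWeight_foldGen_mul_self (z : B) (i : Fin L)
    (g : ArtinMonoid (graphMat (foldGraph hm))) :
    foldWeight hm (foldGen hm z * g) (sroot (z, i)) = 0 :=
  weight_prod_mul_sroot _ _ (orthogonal_fiber hm z) (mem_fiber.2 rfl)

theorem foldWeight_foldGen_mul_singleton (hs : IsSegment m L x y lo hi)
    {c a : ℤ} (h1 : lo ≤ a) (h2 : a ≤ hi) (hc : a % 2 = c % 2)
    (g : ArtinMonoid (graphMat (foldGraph hm))) :
    foldWeight hm (foldGen hm (letter x y c) * g) (ivl x y a a) = 0 := by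
  have hn := hs.nonneg
  have hl := hs.lt
  obtain ⟨i, rfl⟩ : ∃ k : Fin L, (k : ℤ) = a := ⟨⟨a.toNat, by omega⟩, by simp; omega⟩
  rw [ivl_same, letter_congr x y hc]
  exact foldWeight_foldGen_mul_self _ _ _

/-- The alternating product of `n` factors `f (letter x y c)`, `f (letter x y (c + 1))`, .... -/
def altFrom {N : Type*} [Monoid N] (f : B → N) (x y : B) (c : ℤ) : ℕ → N
  | 0 => 1
  | n + 1 => f (letter x y c) * altFrom f x y (c + 1) n

/-- Alternating products of `foldGen` of full length kill every interval. -/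
theorem foldWeight_altFrom_eq_zero (hne : x ≠ y) (hs : IsSegment m L x y lo hi) (n : ℕ) :
    ∀ {c a b P Q : ℤ}, lo ≤ a → b ≤ hi → a ≤ b →
      (a % 2 = c % 2 ∧ P = a ∨ a % 2 ≠ c % 2 ∧ P = 2 * lo - 1 - a) →
      (b % 2 = c % 2 ∧ Q = b ∨ b % 2 ≠ c % 2 ∧ Q = 2 * hi + 1 - b) → Q - P < 2 * n →
      ∀ g, foldWeight hm (altFrom (foldGen hm) x y c n * g) (ivl x y a b) = 0 := by
  induction n with
  | zero => intro c a b P Q h1 h2 hab hP hQ hn; omega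
  | succ n ih =>
    intro c a b P Q h1 h2 hab hP hQ hn g
    rw [altFrom, mul_assoc]
    by_cases hk : a = b ∧ a % 2 = c % 2
    · obtain ⟨rfl, hc⟩ := hk
      exact foldWeight_foldGen_mul_singleton hs h1 h2 hc _
    rw [foldWeight_foldGen_mul_eq_zero_iff hne hs h1 h2 hab hk]
    intro a' b' h
    unfold IvlStep at h
    refine ih (P := if a' % 2 = (c + 1) % 2 then a' else 2 * lo - 1 - a')
      (Q := if b' % 2 = (c + 1) % 2 then b' else 2 * hi + 1 - b')
      (by omega) (by omega) (by omega) ?_ ?_ ?_ g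
    · split_ifs <;> omega
    · split_ifs <;> omega
    · split_ifs <;> omega

/-- Following the interval with endpoints `max P (2 * l - 1 - P)` and `min Q (2 * r + 1 - Q)`. -/
theorem foldWeight_trajectory (hne : x ≠ y) (hs : IsSegment m L x y lo hi) {l r : ℤ}
    (hl : lo ≤ l) (hr : r ≤ hi) (n : ℕ) : ∀ {c P Q : ℤ}, P % 2 = c % 2 → Q % 2 = c % 2 →
      P + (2 * n) ≤ Q → Q - P ≤ 2 * (r - l) + 2 → 2 * l ≤ P + Q → P + Q ≤ 2 * r →
      ∀ g, foldWeight hm (altFrom (foldGen hm) x y c n * g)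
        (ivl x y (max P (2 * l - 1 - P)) (min Q (2 * r + 1 - Q))) = 0 →
      foldWeight hm g
        (ivl x y (max (P + n) (2 * l - 1 - (P + n))) (min (Q - n) (2 * r + 1 - (Q - n)))) = 0 := by
  induction n with
  | zero => intro c P Q _ _ _ _ _ _ g h; simpa [altFrom] using h
  | succ n ih =>
    intro c P Q hP hQ hPQ h3 h4 h5 g h
    rw [altFrom, mul_assoc,
      foldWeight_foldGen_mul_eq_zero_iff hne hs (by omega) (by omega) (by omega) (by omega)] at h
    have := ih (c := c + 1) (P := P + 1) (Q := Q - 1) (by omega) (by omega) (by omega) (by omega)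
      (by omega) (by omega) g (h _ _ (by unfold IvlStep; omega))
    convert this using 3 <;> push_cast <;> ring_nf

/-- A vanishing weight at `p` propagates to its mirror image in a subinterval `[l, r]`. -/
theorem foldWeight_reach (hne : x ≠ y) (hs : IsSegment m L x y lo hi) {l r : ℤ}
    (hl : lo ≤ l) (hr : r ≤ hi) {n : ℕ} {c p : ℤ} (hn : (n : ℤ) = r - l + 1) (hlp : l ≤ p)
    (hpr : p ≤ r) (hp : p % 2 ≠ c % 2) {g : ArtinMonoid (graphMat (foldGraph hm))}
    (h : foldWeight hm (altFrom (foldGen hm) x y c n * g) (ivl x y p p) = 0) :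
    foldWeight hm g (ivl x y (l + r - p) (l + r - p)) = 0 := by
  have := foldWeight_trajectory hne hs hl hr n (c := c) (P := 2 * l - 1 - p)
    (Q := 2 * r + 1 - p) (by omega) (by omega) (by omega) (by omega) (by omega) (by omega) g (by
      convert h using 3 <;> omega)
  convert this using 3 <;> omega

end Dynamics

section FoldHom

variable {B : Type*} {m : B → B → ℕ} {L : ℕ} {hm : Foldable m L}

theorem letter_succ (x y : B) (i : ℤ) : letter x y (i + 1) = letter y x i := by
  unfold letter
  split_ifs <;> first | rfl | omega

theorem letter_mem (x y : B) (i : ℤ) : letter x y i = x ∨ letter x y i = y := by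
  unfold letter
  split_ifs
  · exact Or.inl rfl
  · exact Or.inr rfl

theorem altProd_succ_right {N : Type*} [Monoid N] (f : B → N) (x y : B) (n : ℕ) :
    altProd (f x) (f y) (n + 1) = altProd (f x) (f y) n * f (letter x y n) := by
  induction n generalizing x y with
  | zero => simp [altProd, letter]
  | succ n ih =>
    rw [altProd, ih y x, altProd, mul_assoc, Nat.cast_succ, letter_succ]

theorem altFrom_eq_altProd {N : Type*} [Monoid N] (f : B → N) (x y : B) (c : ℤ) (n : ℕ) :
    altFrom f x y c n = altProd (f (letter x y c)) (f (letter x y (c + 1))) n := by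
  induction n generalizing c with
  | zero => rfl
  | succ n ih =>
    rw [altFrom, ih, altProd, letter_congr x y (show (c + 1 + 1) % 2 = c % 2 by omega)]

theorem Foldable.isSegment (hm : Foldable m L) {x y : B} (hne : x ≠ y) (p : Fin L) :
    IsSegment m L x y (((p : ℕ) / (m x y - 1) * (m x y - 1) : ℕ) : ℤ)
      (((p : ℕ) / (m x y - 1) * (m x y - 1) + (m x y - 1) : ℕ) - 1 : ℤ) := by
  have h2 := hm.two_le x y hne
  obtain ⟨d, hd⟩ := hm.dvd x y hne
  have hp := p.2
  generalize hN : m x y - 1 = N at *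
  have hN0 : 0 < N := by omega
  have h3 : (p : ℕ) / N < d := by
    rw [Nat.div_lt_iff_lt_mul hN0, mul_comm]; omega
  generalize (p : ℕ) / N = e at *
  have h4 : e * N + N ≤ N * d := by nlinarith
  refine ⟨by positivity, by omega, fun i h => ?_⟩
  rw [hN]
  have key : ∀ k, e * N ≤ k → k < e * N + N → k / N = e := fun k h1 h2 =>
    (Nat.div_eq_iff hN0).2 ⟨by omega, by omega⟩
  have key' : ∀ k, k / N = e → e * N ≤ k ∧ k < e * N + N := fun k h => by
    rw [Nat.div_eq_iff hN0] at h; omega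
  constructor
  · intro h'
    rcases h with h | h
    · have := key i (by omega) (by omega)
      have := key' (i + 1) (by omega)
      omega
    · have := key (i + 1) (by omega) (by omega)
      have := key' i (by omega)
      omega
  · intro h'
    rw [key i (by omega) (by omega), key (i + 1) (by omega) (by omega)]

/-- Positions `p` and `q` of an alternating path are opposite in a subpath with `n` vertices. -/
def Opposite (m : B → B → ℕ) (s t : B) (n : ℕ) (p q : Fin L) : Prop :=
  ∃ l r lo hi : ℤ, IsSegment m L s t lo hi ∧ lo ≤ l ∧ r ≤ hi ∧ (n : ℤ) = r - l + 1 ∧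
    l ≤ p ∧ p ≤ r ∧ q = l + r - p

theorem Opposite.symm {s t : B} {n : ℕ} {p q : Fin L} (h : Opposite m s t n p q) :
    Opposite m s t n q p := by
  obtain ⟨l, r, lo, hi, h1, h2, h3, h4, h5, h6, h7⟩ := h
  exact ⟨l, r, lo, hi, h1, h2, h3, h4, by omega, by omega, by omega⟩

theorem exists_opposite (hm : Foldable m L) {s t : B} (hst : s ≠ t) {n : ℕ} (hn : 0 < n)
    (hn' : n < m s t) (p : Fin L) : ∃ q, Opposite m s t n p q := by
  have hs := hm.isSegment hst p
  have h3 := Nat.div_add_mod (p : ℕ) (m s t - 1)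
  have h4 := Nat.mod_lt (p : ℕ) (show m s t - 1 > 0 by omega)
  rw [mul_comm] at h3
  generalize (p : ℕ) / (m s t - 1) * (m s t - 1) = a at *
  have h5 := hs.lt
  refine ⟨⟨max a (p + 1 - n) + (max a (p + 1 - n) + n - 1) - p, by omega⟩,
    (max a (p + 1 - n) : ℕ), ((max a (p + 1 - n) : ℕ) : ℤ) + n - 1, _, _, hs, ?_⟩
  simp only
  omega

theorem mlen_foldGen (z : B) : mlen (foldGen hm z) = L := by
  rw [foldGen, mlen_prod, fiber]
  simp

theorem mlen_altProd_foldGen (s t : B) (n : ℕ) :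
    mlen (altProd (foldGen hm s) (foldGen hm t) n) = n * L := by
  induction n generalizing s t with
  | zero => simp [altProd]
  | succ n ih => rw [altProd, mlen_mul, ih, mlen_foldGen]; ring

variable [Fintype B]

theorem foldWeight_altProd_eq_zero {s t : B} (hst : s ≠ t) (p : Fin L)
    (g : ArtinMonoid (graphMat (foldGraph hm))) :
    foldWeight hm (altProd (foldGen hm s) (foldGen hm t) (m s t) * g) (sroot (t, p)) = 0 := by
  have h2 := hm.two_le s t hst
  obtain ⟨x, y, hxy, hm', hl1, hl2⟩ : ∃ x y : B, x ≠ y ∧ m x y = m s t ∧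
      letter x y p = t ∧ letter x y (p + 1) = s := by
    rcases Int.emod_two_eq_zero_or_one p with h | h
    · exact ⟨t, s, hst.symm, hm.symm t s, by simp [letter, h], by simp [letter]; omega⟩
    · exact ⟨s, t, hst, rfl, by simp [letter, h], by simp [letter]; omega⟩
  have hs := hm.isSegment hxy p
  have h3 := Nat.div_add_mod (p : ℕ) (m x y - 1)
  have h4 := Nat.mod_lt (p : ℕ) (show m x y - 1 > 0 by omega)
  rw [mul_comm] at h3
  have := foldWeight_altFrom_eq_zero (hm := hm) hxy hs (m s t) (c := p + 1) (a := p) (b := p)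
    (by omega) (by omega) le_rfl (Or.inr ⟨by omega, rfl⟩) (Or.inr ⟨by omega, rfl⟩) (by omega) g
  rwa [altFrom_eq_altProd, hl2, letter_congr x y (show ((p : ℤ) + 1 + 1) % 2 = p % 2 by omega),
    ivl_same, hl1] at this

theorem Opposite.foldWeight {s t : B} (hst : s ≠ t) {n : ℕ} {p q : Fin L}
    (h : Opposite m s t n p q) {g : ArtinMonoid (graphMat (foldGraph hm))}
    (hg : foldWeight hm (altProd (foldGen hm t) (foldGen hm s) n * g) (sroot (s, p)) = 0) :
    foldWeight hm g (sroot (letter t s n, q)) = 0 := by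
  obtain ⟨l, r, lo, hi, hs, h1, h2, h3, h4, h5, h6⟩ := h
  have hs' : IsSegment m L t s lo hi := ⟨hs.nonneg, hs.lt, by rw [hm.symm t s]; exact hs.div_iff⟩
  obtain ⟨x, y, hxy, hs, hl1, hl2⟩ : ∃ x y : B, x ≠ y ∧ IsSegment m L x y lo hi ∧
      letter x y p = s ∧ letter x y (p + 1) = t := by
    rcases Int.emod_two_eq_zero_or_one p with h | h
    · exact ⟨s, t, hst, hs, by simp [letter, h], by simp [letter]; omega⟩
    · exact ⟨t, s, hst.symm, hs', by simp [letter, h], by simp [letter]; omega⟩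
  have := foldWeight_reach (hm := hm) hxy hs h1 h2 h3 (c := p + 1) h4 h5 (by omega) (g := g) (by
    rwa [altFrom_eq_altProd, hl2, letter_congr x y (show ((p : ℤ) + 1 + 1) % 2 = p % 2 by omega),
      ivl_same, hl1])
  rw [← h6, ivl_same] at this
  convert this using 3
  rw [← hl1, ← hl2]
  unfold letter
  split_ifs <;> first | rfl | omega

theorem foldGen_dvd (z : B) {g : ArtinMonoid (graphMat (foldGraph hm))}
    (h : ∀ i, foldWeight hm g (sroot (z, i)) = 0) : ∃ k, g = foldGen hm z * k :=
  prod_dvd_of_weight_eq_zero _ (orthogonal_fiber hm z) fun v hv => by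
    obtain ⟨w, i⟩ := v
    rw [mem_fiber.1 hv]
    exact h i

theorem altProd_foldGen {s t : B} (hst : s ≠ t) :
    altProd (foldGen hm s) (foldGen hm t) (m s t) =
      altProd (foldGen hm t) (foldGen hm s) (m s t) := by
  have h2 := hm.two_le s t hst
  suffices h : ∀ n ≤ m s t, ∃ h, altProd (foldGen hm s) (foldGen hm t) (m s t) =
      altProd (foldGen hm t) (foldGen hm s) n * h by
    obtain ⟨h, e⟩ := h _ le_rfl
    have := congrArg mlen e
    rw [mlen_mul, mlen_altProd_foldGen, mlen_altProd_foldGen] at this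
    rw [e, eq_one_of_mlen (g := h) (by omega), mul_one]
  intro n
  induction n with
  | zero => exact fun _ => ⟨_, (one_mul _).symm⟩
  | succ n ih =>
    intro hn
    obtain ⟨h, e⟩ := ih (by omega)
    suffices h' : ∀ i, foldWeight hm h (sroot (letter t s n, i)) = 0 by
      obtain ⟨k, rfl⟩ := foldGen_dvd _ h'
      exact ⟨k, by rw [e, altProd_succ_right, mul_assoc]⟩
    intro q
    rcases Nat.eq_zero_or_pos n with rfl | h0
    · rw [altProd, one_mul] at e
      rw [← e]
      have := foldWeight_altProd_eq_zero (hm := hm) hst q 1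
      rwa [mul_one] at this
    · obtain ⟨p, hp⟩ := exists_opposite hm hst h0 (by omega) q
      refine hp.symm.foldWeight hst ?_
      rw [← e]
      obtain ⟨k, hk⟩ : ∃ k, m s t = k + 1 := ⟨m s t - 1, by omega⟩
      rw [hk, altProd]
      exact foldWeight_foldGen_mul_self _ _ _

/-- The monoid morphism sending each generator to the product of the generators above it. -/
noncomputable def foldHom (hm : Foldable m L) :
    ArtinMonoid m →* ArtinMonoid (graphMat (foldGraph hm)) :=
  ArtinMonoid.lift (foldGen hm) fun _ _ hst _ => altProd_foldGen hst

theorem foldHom_mgen (s : B) : foldHom hm (mgen m s) = foldGen hm s :=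
  ArtinMonoid.lift_mgen _ _ _

theorem foldHom_altProd (s t : B) (n : ℕ) :
    foldHom hm (altProd (mgen m s) (mgen m t) n) = altProd (foldGen hm s) (foldGen hm t) n := by
  rw [map_altProd, foldHom_mgen, foldHom_mgen]

theorem foldWeight_mgen_mul_self (s : B) (p : Fin L) (g : ArtinMonoid m) :
    foldWeight hm (foldHom hm (mgen m s * g)) (sroot (s, p)) = 0 := by
  rw [map_mul, foldHom_mgen, foldWeight_foldGen_mul_self]

theorem altProd_dvd_of_foldWeight {g' : ArtinMonoid m} {s t : B} {p : Fin L} (hst : s ≠ t)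
    (ih : ∀ h : ArtinMonoid m, mlen h < mlen (mgen m t * g') → ∀ (z : B) (q : Fin L),
      foldWeight hm (foldHom hm h) (sroot (z, q)) = 0 → ∃ k, h = mgen m z * k)
    (hg : foldWeight hm (foldHom hm (mgen m t * g')) (sroot (s, p)) = 0) :
    ∃ h, mgen m t * g' = altProd (mgen m t) (mgen m s) (m s t) * h := by
  have h2 := hm.two_le s t hst
  suffices key : ∀ n, 0 < n → n ≤ m s t → ∃ h, mgen m t * g' =
      altProd (mgen m t) (mgen m s) n * h ∧ mlen h < mlen (mgen m t * g') by
    obtain ⟨h, e, _⟩ := key (m s t) (by omega) le_rfl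
    exact ⟨h, e⟩
  intro n h0
  induction n, h0 using Nat.le_induction with
  | base => exact fun _ => ⟨g', by simp [altProd], by simp⟩
  | succ n h0 ihn =>
    intro hn
    obtain ⟨h, e, hlen⟩ := ihn (by omega)
    obtain ⟨q, hq⟩ := exists_opposite hm hst h0 (by omega) p
    rw [e, map_mul, foldHom_altProd] at hg
    obtain ⟨h', rfl⟩ := ih h hlen _ _ (hq.foldWeight hst hg)
    refine ⟨h', by rw [e, altProd_succ_right, mul_assoc], lt_of_le_of_lt ?_ hlen⟩
    simp

theorem mgen_dvd_of_foldWeight_eq_zero (g : ArtinMonoid m) (s : B) (p : Fin L)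
    (hg : foldWeight hm (foldHom hm g) (sroot (s, p)) = 0) : ∃ h, g = mgen m s * h := by
  induction hk : mlen g using Nat.strong_induction_on generalizing g s p with
  | _ k ih =>
    rcases eq_one_or_mgen_mul g with rfl | ⟨t, g', rfl⟩
    · rw [map_one, foldWeight, weight_one] at hg
      exact absurd hg one_ne_zero
    by_cases hst : s = t
    · exact ⟨g', by rw [hst]⟩
    obtain ⟨h, e⟩ := altProd_dvd_of_foldWeight hst
      (fun h hl z q hz => ih _ (hk ▸ hl) h z q hz rfl) hg
    have h2 := hm.two_le s t hst
    rw [← braid_mgen (m := m) hst (by omega)] at e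
    obtain ⟨j, hj⟩ : ∃ j, m s t = j + 1 := ⟨m s t - 1, by omega⟩
    rw [hj, altProd, mul_assoc] at e
    exact ⟨_, e⟩

/-- Two distinct generators dividing the same element have a common multiple dividing it. -/
theorem altProd_dvd {s t : B} (hm : Foldable m L) (hst : s ≠ t) {g h : ArtinMonoid m}
    (e : mgen m s * g = mgen m t * h) :
    ∃ k, mgen m t * h = altProd (mgen m t) (mgen m s) (m s t) * k := by
  refine altProd_dvd_of_foldWeight (hm := hm) (p := ⟨0, hm.pos⟩) hst
    (fun h _ z q => mgen_dvd_of_foldWeight_eq_zero h z q) ?_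
  rw [← e]
  exact foldWeight_mgen_mul_self _ _ _

end FoldHom

section Embedding

variable {B : Type*} (M : CoxeterMatrix B)

theorem coxeterMatrix_two_le {s t : B} (hst : s ≠ t) (h : M s t ≠ 0) : 2 ≤ M s t := by
  have := M.off_diagonal s t hst
  omega

/-- The product of generators of the Artin-Tits group along a word. -/
def word (l : List B) : Artin M := (l.map (gen M)).prod

variable {M}

theorem word_nil : word M [] = 1 := rfl

theorem word_cons (s : B) (l : List B) : word M (s :: l) = gen M s * word M l := rfl

theorem word_append (l l' : List B) : word M (l ++ l') = word M l * word M l' := by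
  simp [word]

theorem braid_gen {s t : B} (hst : s ≠ t) (h : M s t ≠ 0) :
    altProd (gen M s) (gen M t) (M s t) = altProd (gen M t) (gen M s) (M s t) := by
  have : (PresentedGroup.mk (braidRels M)) _ = 1 :=
    PresentedGroup.one_of_mem (rels := braidRels M) ⟨s, t, hst, h, rfl⟩
  rw [map_mul, map_inv, mul_inv_eq_one, map_list_prod, map_list_prod, List.map_map,
    List.map_map] at this
  rw [← prod_map_altList, ← prod_map_altList]
  exact this

/-- A family of units satisfying the braid relations factors through the Artin-Tits group. -/
theorem prod_map_eq_of_word_eq {N : Type*} [Monoid N] (φ : B → N) (hu : ∀ s, IsUnit (φ s))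
    (hb : ∀ s t, s ≠ t → M s t ≠ 0 →
      altProd (φ s) (φ t) (M s t) = altProd (φ t) (φ s) (M s t)) {l l' : List B}
    (h : word M l = word M l') : (l.map φ).prod = (l'.map φ).prod := by
  choose u hu using hu
  have hrel : ∀ r ∈ braidRels M, FreeGroup.lift u r = 1 := by
    rintro r ⟨s, t, hst, hm, rfl⟩
    rw [map_mul, map_inv, mul_inv_eq_one, map_list_prod, map_list_prod, List.map_map,
      List.map_map]
    simp only [Function.comp_def, FreeGroup.lift_apply_of]
    rw [prod_map_altList, prod_map_altList]
    apply Units.ext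
    have := hb s t hst hm
    rw [← hu s, ← hu t] at this
    have key := map_altProd (Units.coeHom N)
    simp only [Units.coeHom_apply] at key
    rwa [key, key]
  have key : ∀ l : List B, (l.map φ).prod = (PresentedGroup.toGroup hrel (word M l) : Nˣ) := by
    intro l
    induction l with
    | nil => rw [word_nil]; erw [map_one]; rfl
    | cons a l ih =>
      rw [word_cons]
      erw [map_mul]
      rw [List.map_cons, List.prod_cons, ih, ← hu a]
      erw [PresentedGroup.toGroup.of]
      rfl
  rw [key, key, h]

theorem length_eq_of_word_eq {l l' : List B} (h : word M l = word M l') :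
    l.length = l'.length := by
  have := prod_map_eq_of_word_eq (N := Multiplicative ℤ) (fun _ => Multiplicative.ofAdd 1)
    (fun _ => Group.isUnit _) (fun _ _ _ _ => rfl) h
  have := congrArg Multiplicative.toAdd this
  simpa using this

variable (M) in
/-- Replace the infinite entries of a Coxeter matrix by `n`. -/
def cut (n : ℕ) (s t : B) : ℕ := if M s t = 0 then n else M s t

theorem cut_of_ne_zero {n : ℕ} {s t : B} (h : M s t ≠ 0) : cut M n s t = M s t := if_neg h

theorem foldable_cut [Fintype B] {n : ℕ} (hn : 2 ≤ n) :
    Foldable (cut M n) (∏ p : B × B, max 1 (cut M n p.1 p.2 - 1)) := by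
  have h2 : ∀ s t, s ≠ t → 2 ≤ cut M n s t := by
    intro s t hst
    unfold cut
    split_ifs with h
    · exact hn
    · exact coxeterMatrix_two_le M hst h
  refine ⟨fun s t => ?_, h2, fun s t hst => ?_, Finset.prod_pos fun p _ => by simp⟩
  · rw [cut, cut, M.symmetric s t]
  · have := Finset.dvd_prod_of_mem (fun p : B × B => max 1 (cut M n p.1 p.2 - 1))
      (Finset.mem_univ (s, t))
    have h := h2 s t hst
    dsimp only at this
    rwa [max_eq_right (by omega)] at this

theorem word_eq_of_mgen_eq {n : ℕ} {l l' : List B} (hl : l.length < n)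
    (h : (l.map (mgen (cut M n))).prod = (l'.map (mgen (cut M n))).prod) :
    word M l = word M l' := by
  suffices key : ∀ a b : FreeMonoid B, conGen (monoidRel (cut M n)) a b →
      a.toList.length = b.toList.length ∧ (a.toList.length < n →
        word M a.toList = word M b.toList) by
    rw [← mk_ofList, ← mk_ofList] at h
    exact (key _ _ ((Con.eq _).1 h)).2 hl
  intro a b hab
  induction hab with
  | of x y hr =>
    obtain ⟨s, t, hst, h0, rfl, rfl⟩ := hr
    simp only [FreeMonoid.toList_ofList, length_altList, true_and]
    intro hn
    by_cases hM : M s t = 0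
    · simp [cut, hM] at hn
    · rw [cut_of_ne_zero hM, word, word, prod_map_altList, prod_map_altList]
      exact braid_gen hst hM
  | refl => exact ⟨rfl, fun _ => rfl⟩
  | symm _ ih => exact ⟨ih.1.symm, fun hn => (ih.2 (ih.1 ▸ hn)).symm⟩
  | trans _ _ ih1 ih2 =>
    exact ⟨ih1.1.trans ih2.1, fun hn => (ih1.2 hn).trans (ih2.2 (ih1.1 ▸ hn))⟩
  | mul _ _ ih1 ih2 =>
    simp only [FreeMonoid.toList_mul, List.length_append, word_append]
    refine ⟨by rw [ih1.1, ih2.1], fun hn => ?_⟩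
    rw [ih1.2 (by omega), ih2.2 (by omega)]

variable [Fintype B]

theorem mgen_dvd_of_word_eq {n : ℕ} (hn : 2 ≤ n) {s : B} {l l' : List B}
    (h : word M l = word M (s :: l')) :
    ∃ k, (l.map (mgen (cut M n))).prod = mgen (cut M n) s * k := by
  have hm := foldable_cut (M := M) hn
  refine mgen_dvd_of_foldWeight_eq_zero (hm := hm) _ s ⟨0, hm.pos⟩ ?_
  have key : foldWeight hm (foldHom hm (l.map (mgen (cut M n))).prod) =
      foldWeight hm (foldHom hm ((s :: l').map (mgen (cut M n))).prod) := by
    refine weight_eq_of_deformHom_eq _ fun x hx => ?_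
    have hu : ∀ g, IsUnit (deformHom (foldGraph_triangleFree hm) x g) := by
      intro g
      obtain ⟨w, rfl⟩ := exists_word g
      rw [map_list_prod]
      refine List.prod_isUnit fun e he => ?_
      simp only [List.map_map, List.mem_map, Function.comp] at he
      obtain ⟨a, _, rfl⟩ := he
      rw [deformHom_mgen]
      exact isUnit_deform hx a
    have := prod_map_eq_of_word_eq (M := M)
      (fun z => deformHom (foldGraph_triangleFree hm) x (foldHom hm (mgen (cut M n) z)))
      (fun z => hu _) (fun s t hst h0 => by
        have := braid_mgen (m := cut M n) hst (by rwa [cut_of_ne_zero h0])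
        rw [cut_of_ne_zero h0] at this
        simpa only [map_altProd] using congrArg
          (fun g => deformHom (foldGraph_triangleFree hm) x (foldHom hm g)) this) h
    simpa only [map_list_prod, List.map_map, Function.comp_def] using this
  rw [key, List.map_cons, List.prod_cons]
  exact foldWeight_mgen_mul_self _ _ _

theorem mgen_eq_of_word_eq {n : ℕ} (hn : 2 ≤ n) {l l' : List B} (hl : l.length < n)
    (h : word M l = word M l') :
    (l.map (mgen (cut M n))).prod = (l'.map (mgen (cut M n))).prod := by
  induction l generalizing l' with
  | nil =>
    rw [List.eq_nil_of_length_eq_zero (length_eq_of_word_eq h).symm]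
  | cons s l ih =>
    obtain ⟨k, hk⟩ := mgen_dvd_of_word_eq hn h.symm
    obtain ⟨w, rfl⟩ := exists_word k
    have hw : word M l' = word M (s :: w) := by
      refine word_eq_of_mgen_eq (n := n) ?_ (by simpa using hk)
      rwa [← length_eq_of_word_eq h]
    rw [hk, List.map_cons, List.prod_cons, ih (by simp at hl; omega)]
    rw [hw, word_cons, word_cons] at h
    exact mul_left_cancel h

/-- Two positive words with distinct first letters representing the same element. -/
theorem exists_lcm_word {s t : B} (hst : s ≠ t) {l l' : List B}
    (h : word M (s :: l) = word M (t :: l')) :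
    M s t ≠ 0 ∧ ∃ k, word M (s :: l) = word M (altList s t (M s t) ++ k) := by
  have hn : 2 ≤ (t :: l').length + 1 := by simp
  set n := (t :: l').length + 1
  have e := mgen_eq_of_word_eq (n := n) hn (Nat.lt_succ_self _) h.symm
  simp only [List.map_cons, List.prod_cons] at e
  obtain ⟨k, hk⟩ := altProd_dvd (foldable_cut (M := M) hn) hst.symm e
  have hlen := congrArg mlen hk
  obtain ⟨w, rfl⟩ := exists_word k
  rw [← prod_map_altList, ← List.prod_append, ← List.map_append] at hk
  rw [← prod_map_altList, mlen_mul, mlen_prod, mlen_mul, mlen_prod, mlen_prod, length_altList,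
    mlen_mgen] at hlen
  have hll := length_eq_of_word_eq h
  simp only [List.length_cons] at hll
  have h0 : M s t ≠ 0 := by
    intro h0
    rw [cut, M.symmetric, if_pos h0] at hlen
    simp [n] at hlen
    omega
  refine ⟨h0, w, ?_⟩
  rw [cut_of_ne_zero (by rwa [M.symmetric]), M.symmetric] at hk
  refine word_eq_of_mgen_eq (n := n) ?_ hk
  simp [n, hll]

end Embedding

section SquareFree

variable {B : Type*} {M : CoxeterMatrix B} {P : Type*} [Monoid P]

/-- The properties of Artin-Tits monoids used to study their square-free elements. -/
structure IsArtinMonoid (M : CoxeterMatrix B) (σ : B → P) (ℓ : P → ℕ) (rev : P → P) : Prop where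
  length_mul : ∀ a b, ℓ (a * b) = ℓ a + ℓ b
  length_gen : ∀ s, ℓ (σ s) = 1
  eq_one_or : ∀ g, g = 1 ∨ ∃ s h, g = σ s * h
  braid : ∀ s t, s ≠ t → M s t ≠ 0 →
    altProd (σ s) (σ t) (M s t) = altProd (σ t) (σ s) (M s t)
  lcm : ∀ s t a b, s ≠ t → σ s * a = σ t * b →
    M s t ≠ 0 ∧ ∃ c, σ s * a = altProd (σ s) (σ t) (M s t) * c
  rev_mul : ∀ a b, rev (a * b) = rev b * rev a
  rev_gen : ∀ s, rev (σ s) = σ s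

/-- No expression of `g` contains a square of a generator. -/
def SquareFree (σ : B → P) (g : P) : Prop := ∀ a x b, g ≠ a * (σ x * (σ x * b))

theorem altProd_add {N : Type*} [Monoid N] (f : B → N) (x y : B) (k n : ℕ) :
    altProd (f x) (f y) (k + n) = altProd (f x) (f y) k *
      altProd (f (letter x y k)) (f (letter x y (k + 1))) n := by
  induction k generalizing x y with
  | zero => simp [altProd, letter]
  | succ k ih =>
    rw [Nat.succ_add, altProd, ih, altProd, mul_assoc, Nat.cast_succ, letter_succ x y k,
      letter_succ x y (k + 1)]

variable {σ : B → P} {ℓ : P → ℕ} {rev : P → P}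

theorem SquareFree.of_mul_left {a b : P} (h : SquareFree σ (a * b)) : SquareFree σ b := by
  rintro c x d rfl
  exact h (a * c) x d (by simp only [mul_assoc])

theorem SquareFree.of_mul_right {a b : P} (h : SquareFree σ (a * b)) : SquareFree σ a := by
  rintro c x d rfl
  exact h c x (d * b) (by simp only [mul_assoc])

theorem SquareFree.of_dvd {a b : P} (h : SquareFree σ b) (hab : a ∣ b) : SquareFree σ a := by
  obtain ⟨c, rfl⟩ := hab
  exact h.of_mul_right

theorem SquareFree.not_dvd {s : B} {c : P} (h : SquareFree σ (σ s * c)) : ¬ σ s ∣ c := by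
  rintro ⟨d, rfl⟩
  exact h 1 s d (one_mul _).symm

namespace IsArtinMonoid

theorem length_one (hP : IsArtinMonoid M σ ℓ rev) : ℓ 1 = 0 := by
  have := hP.length_mul 1 1
  rw [mul_one] at this
  omega

theorem eq_one_of_length (hP : IsArtinMonoid M σ ℓ rev) {g : P} (h : ℓ g = 0) : g = 1 := by
  obtain rfl | ⟨s, k, rfl⟩ := hP.eq_one_or g
  · rfl
  · rw [hP.length_mul, hP.length_gen] at h
    omega

theorem eq_gen_of_length (hP : IsArtinMonoid M σ ℓ rev) {g : P} (h : ℓ g = 1) :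
    ∃ s, g = σ s := by
  obtain rfl | ⟨s, k, rfl⟩ := hP.eq_one_or g
  · rw [hP.length_one] at h
    omega
  · rw [hP.length_mul, hP.length_gen] at h
    exact ⟨s, by rw [hP.eq_one_of_length (g := k) (by omega), mul_one]⟩

theorem length_le_of_dvd (hP : IsArtinMonoid M σ ℓ rev) {a b : P} (h : a ∣ b) : ℓ a ≤ ℓ b := by
  obtain ⟨c, rfl⟩ := h
  rw [hP.length_mul]
  omega

theorem dvd_antisymm (hP : IsArtinMonoid M σ ℓ rev) {a b : P} (h : a ∣ b) (h' : b ∣ a) :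
    a = b := by
  obtain ⟨c, rfl⟩ := h
  have := hP.length_le_of_dvd h'
  rw [hP.length_mul] at this
  rw [hP.eq_one_of_length (g := c) (by omega), mul_one]

theorem length_altProd (hP : IsArtinMonoid M σ ℓ rev) (x y : B) (n : ℕ) :
    ℓ (altProd (σ x) (σ y) n) = n := by
  induction n generalizing x y with
  | zero => exact hP.length_one
  | succ n ih => rw [altProd, hP.length_mul, ih, hP.length_gen, add_comm]

theorem length_prod (hP : IsArtinMonoid M σ ℓ rev) (l : List B) :
    ℓ (l.map σ).prod = l.length := by
  induction l with
  | nil => exact hP.length_one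
  | cons s l ih =>
    rw [List.map_cons, List.prod_cons, hP.length_mul, hP.length_gen, ih, List.length_cons,
      add_comm]

theorem gen_injective (hP : IsArtinMonoid M σ ℓ rev) : Function.Injective σ := by
  intro s t h
  by_contra hst
  obtain ⟨h0, c, hc⟩ := hP.lcm s t 1 1 hst (by rw [h])
  have := congrArg ℓ hc
  rw [mul_one, hP.length_gen, hP.length_mul, hP.length_altProd] at this
  have := coxeterMatrix_two_le M hst h0
  omega

theorem squareFree_one (hP : IsArtinMonoid M σ ℓ rev) : SquareFree σ 1 := by
  intro a x b h
  have := congrArg ℓ h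
  rw [hP.length_one, hP.length_mul, hP.length_mul, hP.length_gen] at this
  omega

variable [IsCancelMul P]

theorem not_dvd_altProd_mul (hP : IsArtinMonoid M σ ℓ rev) {x y : B} (hxy : x ≠ y) {e : P}
    (hx : ¬ σ x ∣ e) (hy : ¬ σ y ∣ e) {k : ℕ} (hk : M x y = 0 ∨ k < M x y) :
    ¬ σ y ∣ altProd (σ x) (σ y) k * e := by
  rintro ⟨b, hb⟩
  cases k with
  | zero => exact hy ⟨b, by rwa [altProd, one_mul] at hb⟩
  | succ k =>
    obtain ⟨h0, c, hc⟩ := hP.lcm x y _ b hxy (by rwa [altProd, mul_assoc] at hb)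
    obtain ⟨i, hi⟩ : ∃ i, M x y = k + 1 + (i + 1) := ⟨M x y - (k + 1 + 1), by omega⟩
    rw [← mul_assoc, ← altProd, hi, altProd_add, mul_assoc] at hc
    have := mul_left_cancel hc
    rw [altProd, mul_assoc] at this
    rcases letter_mem x y ((k + 1 : ℕ) : ℤ) with h | h <;> rw [h] at this
    · exact hx ⟨_, this⟩
    · exact hy ⟨_, this⟩

theorem squareFree_altProd_mul_of (hP : IsArtinMonoid M σ ℓ rev) {n : ℕ}
    (H : ∀ c, ℓ c < n → SquareFree σ c → ∀ s, ¬ σ s ∣ c → SquareFree σ (σ s * c)) {e : P}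
    (he : SquareFree σ e) (k : ℕ) {x y : B} (hxy : x ≠ y) (hx : ¬ σ x ∣ e) (hy : ¬ σ y ∣ e)
    (hk : M x y = 0 ∨ k ≤ M x y) (hn : k + ℓ e ≤ n) :
    SquareFree σ (altProd (σ x) (σ y) k * e) := by
  induction k generalizing x y with
  | zero => rwa [altProd, one_mul]
  | succ k ih =>
    rw [altProd, mul_assoc]
    have hs := M.symmetric y x
    refine H _ ?_ (ih hxy.symm hy hx (by omega) (by omega)) _
      (hP.not_dvd_altProd_mul hxy.symm hy hx (by omega))
    rw [hP.length_mul, hP.length_altProd]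
    omega

/-- Multiplying a square-free element by a generator that does not divide it. -/
theorem squareFree_gen_mul (hP : IsArtinMonoid M σ ℓ rev) {c : P} (hc : SquareFree σ c) {s : B}
    (hs : ¬ σ s ∣ c) : SquareFree σ (σ s * c) := by
  induction hn : ℓ c using Nat.strong_induction_on generalizing c s with
  | _ n ih =>
    have key : ∀ y d, s ≠ y → σ s * c = σ y * d → SquareFree σ d ∧ ¬ σ y ∣ d := by
      intro y d hsy h
      obtain ⟨h0, e, he⟩ := hP.lcm s y c d hsy h
      have h2 := coxeterMatrix_two_le M hsy h0
      obtain ⟨k, hk⟩ : ∃ k, M s y = k + 2 := ⟨M s y - 2, by omega⟩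
      have hd := he
      rw [h, hP.braid s y hsy h0, hk, altProd, mul_assoc] at hd
      replace hd := mul_left_cancel hd
      have hce := he
      rw [hk, altProd, mul_assoc] at hce
      replace hce := mul_left_cancel hce
      have h1 : ¬ σ (letter y s (k : ℤ)) ∣ e := by
        rintro ⟨e, rfl⟩
        rw [altProd_succ_right, mul_assoc] at hce
        exact hc _ _ _ hce
      have h2 : ¬ σ (letter y s ((k + 1 : ℕ) : ℤ)) ∣ e := by
        rintro ⟨e, rfl⟩
        rw [← mul_assoc, ← altProd_succ_right, ← hk, M.symmetric,
          hP.braid y s hsy.symm (by rwa [M.symmetric]), M.symmetric, hk, altProd,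
          mul_assoc] at hce
        exact hs ⟨_, hce⟩
      have h3 : ¬ σ s ∣ e ∧ ¬ σ y ∣ e := by
        rw [Nat.cast_succ, letter_succ] at h2
        unfold letter at h1 h2
        split_ifs at h1 h2 <;> exact ⟨by assumption, by assumption⟩
      have hlen := congrArg ℓ hce
      rw [hP.length_mul, hP.length_altProd] at hlen
      rw [hd]
      exact ⟨hP.squareFree_altProd_mul_of (n := n)
          (fun c' h' hc' s' hs' => ih (ℓ c') h' hc' hs' rfl) (hce ▸ hc).of_mul_left _ hsy h3.1 h3.2
          (by omega) (by omega),
        hP.not_dvd_altProd_mul hsy h3.1 h3.2 (by omega)⟩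
    intro a x b h
    obtain rfl | ⟨y, a, rfl⟩ := hP.eq_one_or a
    · rw [one_mul] at h
      by_cases hx : s = x
      · subst hx
        exact hs ⟨b, mul_left_cancel h⟩
      · exact (key x _ hx h).2 ⟨b, rfl⟩
    · rw [mul_assoc] at h
      by_cases hy : s = y
      · subst hy
        exact hc a x b (mul_left_cancel h)
      · exact (key y _ hy h).1 a x b rfl

theorem squareFree_altProd_mul (hP : IsArtinMonoid M σ ℓ rev) {e : P} (he : SquareFree σ e)
    {k : ℕ} {x y : B} (hxy : x ≠ y) (hx : ¬ σ x ∣ e) (hy : ¬ σ y ∣ e)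
    (hk : M x y = 0 ∨ k ≤ M x y) : SquareFree σ (altProd (σ x) (σ y) k * e) :=
  hP.squareFree_altProd_mul_of (fun _ _ hc _ hs => hP.squareFree_gen_mul hc hs) he k hxy hx hy hk
    le_rfl

end IsArtinMonoid

end SquareFree

section Action

theorem altProd_mul_inv {G : Type*} [Group G] {a b : G} (ha : a * a = 1) (hb : b * b = 1) (n : ℕ) :
    altProd a b n * (altProd b a n)⁻¹ = (a * b) ^ n := by
  induction n generalizing a b with
  | zero => simp [altProd]
  | succ n ih =>
    have h : a * (b * a) ^ n * b = (a * b) ^ (n + 1) := by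
      rw [← mul_pow_mul, mul_assoc, ← pow_succ]
    rw [altProd, altProd, mul_inv_rev, ← h, ← ih hb ha, inv_eq_of_mul_eq_one_left hb]
    simp only [mul_assoc]

variable {X : Type*} {a b : Equiv.Perm X}

theorem pow_apply_apply_iff (ha : a * a = 1) (hb : b * b = 1) (n : ℕ) (c : X) :
    ((a * b) ^ n) (a c) = a c ↔ ((a * b) ^ n) c = c := by
  have h : (a * b) ^ n * a = a * ((a * b) ^ n)⁻¹ := by
    rw [← inv_pow, mul_inv_rev, inv_eq_of_mul_eq_one_left hb, inv_eq_of_mul_eq_one_left ha]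
    exact mul_pow_mul a b n
  rw [← Equiv.Perm.mul_apply, h, Equiv.Perm.mul_apply, a.apply_eq_iff_eq, Equiv.Perm.inv_eq_iff_eq,
    eq_comm]

theorem pow_apply_apply_iff' (ha : a * a = 1) (hb : b * b = 1) (n : ℕ) (c : X) :
    ((a * b) ^ n) (b c) = b c ↔ ((a * b) ^ n) c = c := by
  have h : (a * b) ^ n = ((b * a) ^ n)⁻¹ := by
    rw [← inv_pow, mul_inv_rev, inv_eq_of_mul_eq_one_left hb, inv_eq_of_mul_eq_one_left ha]
  rw [h, Equiv.Perm.inv_eq_iff_eq, Equiv.Perm.inv_eq_iff_eq, eq_comm, pow_apply_apply_iff hb ha,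
    eq_comm]

theorem pow_apply_altProd_apply_iff (ha : a * a = 1) (hb : b * b = 1) (n k : ℕ) (c : X) :
    ((a * b) ^ n) (altProd a b k c) = altProd a b k c ↔ ((a * b) ^ n) c = c := by
  suffices h : ∀ k, (((a * b) ^ n) (altProd a b k c) = altProd a b k c ↔ ((a * b) ^ n) c = c) ∧
      (((a * b) ^ n) (altProd b a k c) = altProd b a k c ↔ ((a * b) ^ n) c = c) from (h k).1
  intro k
  induction k with
  | zero => simp [altProd]
  | succ k ih =>
    rw [altProd, altProd, Equiv.Perm.mul_apply, Equiv.Perm.mul_apply, pow_apply_apply_iff ha hb,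
      pow_apply_apply_iff' ha hb]
    exact ih.symm

variable {B : Type*} {M : CoxeterMatrix B} {P : Type*} [Monoid P] [IsCancelMul P]
  {σ : B → P} {ℓ : P → ℕ} {rev : P → P}

namespace IsArtinMonoid

open Classical in
/-- The action of a generator of the Coxeter group on the square-free elements. -/
noncomputable def act (hP : IsArtinMonoid M σ ℓ rev) (s : B) (c : {g // SquareFree σ g}) :
    {g // SquareFree σ g} :=
  if h : σ s ∣ c.1 then ⟨h.choose, (h.choose_spec ▸ c.2).of_mul_left⟩
  else ⟨σ s * c.1, hP.squareFree_gen_mul c.2 h⟩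

theorem act_gen_mul (hP : IsArtinMonoid M σ ℓ rev) {s : B} {c : P}
    (hc : SquareFree σ (σ s * c)) : hP.act s ⟨σ s * c, hc⟩ = ⟨c, hc.of_mul_left⟩ := by
  have h : σ s ∣ σ s * c := ⟨c, rfl⟩
  rw [act, dif_pos h]
  exact Subtype.ext (mul_left_cancel h.choose_spec).symm

theorem act_of_not_dvd (hP : IsArtinMonoid M σ ℓ rev) {s : B} {c : {g // SquareFree σ g}}
    (h : ¬ σ s ∣ c.1) : hP.act s c = ⟨σ s * c.1, hP.squareFree_gen_mul c.2 h⟩ := dif_neg h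

theorem act_involutive (hP : IsArtinMonoid M σ ℓ rev) (s : B) :
    Function.Involutive (hP.act s) := by
  rintro ⟨c, hc⟩
  by_cases h : σ s ∣ c
  · obtain ⟨d, rfl⟩ := h
    rw [hP.act_gen_mul, hP.act_of_not_dvd hc.not_dvd]
  · rw [hP.act_of_not_dvd (c := ⟨c, hc⟩) h, hP.act_gen_mul]

/-- The permutation of the square-free elements defined by a generator. -/
noncomputable def perm (hP : IsArtinMonoid M σ ℓ rev) (s : B) :
    Equiv.Perm {g // SquareFree σ g} :=
  (hP.act_involutive s).toPerm

theorem perm_mul_self (hP : IsArtinMonoid M σ ℓ rev) (s : B) : hP.perm s * hP.perm s = 1 :=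
  Equiv.ext (hP.act_involutive s)

theorem altProd_perm (hP : IsArtinMonoid M σ ℓ rev) {x y : B} (hxy : x ≠ y)
    {e : {g // SquareFree σ g}} (hx : ¬ σ x ∣ e.1) (hy : ¬ σ y ∣ e.1) {k : ℕ} (hk : k ≤ M x y) :
    (altProd (hP.perm x) (hP.perm y) k e).1 = altProd (σ x) (σ y) k * e.1 := by
  induction k generalizing x y with
  | zero => simp [altProd]
  | succ k ih =>
    have hs := M.symmetric y x
    have h := ih hxy.symm hy hx (by omega)
    rw [altProd, Equiv.Perm.mul_apply]
    refine (congrArg Subtype.val (hP.act_of_not_dvd (c := altProd (hP.perm y) (hP.perm x) k e)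
      ?_)).trans ?_
    · rw [h]
      exact hP.not_dvd_altProd_mul hxy.symm hy hx (by omega)
    · simp only [h, altProd, mul_assoc]

theorem perm_mul_pow (hP : IsArtinMonoid M σ ℓ rev) (s t : B) :
    (hP.perm s * hP.perm t) ^ M s t = 1 := by
  by_cases hst : s = t
  · rw [hst, perm_mul_self, one_pow]
  by_cases h0 : M s t = 0
  · rw [h0, pow_zero]
  have hs := hP.perm_mul_self s
  have ht := hP.perm_mul_self t
  have key : ∀ n, ∀ c : {g // SquareFree σ g}, ℓ c.1 = n →
      ((hP.perm s * hP.perm t) ^ M s t) c = c := by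
    intro n
    induction n using Nat.strong_induction_on with
    | _ n ih =>
      rintro ⟨c, hc⟩ hn
      by_cases hsc : σ s ∣ c
      · obtain ⟨d, rfl⟩ := hsc
        rw [← pow_apply_apply_iff hs ht]
        refine ih (ℓ d) ?_ _ (congrArg (fun x => ℓ (Subtype.val x)) (hP.act_gen_mul hc))
        rw [hP.length_mul, hP.length_gen] at hn
        omega
      by_cases htc : σ t ∣ c
      · obtain ⟨d, rfl⟩ := htc
        rw [← pow_apply_apply_iff' hs ht]
        refine ih (ℓ d) ?_ _ (congrArg (fun x => ℓ (Subtype.val x)) (hP.act_gen_mul hc))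
        rw [hP.length_mul, hP.length_gen] at hn
        omega
      have h : altProd (hP.perm s) (hP.perm t) (M s t) ⟨c, hc⟩ =
          altProd (hP.perm t) (hP.perm s) (M s t) ⟨c, hc⟩ := by
        apply Subtype.ext
        rw [hP.altProd_perm hst hsc htc le_rfl, hP.altProd_perm (Ne.symm hst) htc hsc
          (M.symmetric s t).le, hP.braid s t hst h0]
      rw [← pow_apply_altProd_apply_iff hs ht _ (M s t), h, ← altProd_mul_inv hs ht,
        ← Equiv.Perm.mul_apply, inv_mul_cancel_right, h]
  exact Equiv.ext fun c => key _ c rfl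

/-- The action of the Coxeter group on the square-free elements. -/
noncomputable def coxeterAct (hP : IsArtinMonoid M σ ℓ rev) :
    M.Group →* Equiv.Perm {g // SquareFree σ g} :=
  M.toCoxeterSystem.lift ⟨hP.perm, hP.perm_mul_pow⟩

theorem coxeterAct_simple (hP : IsArtinMonoid M σ ℓ rev) (s : B) :
    hP.coxeterAct (M.simple s) = hP.perm s := by
  rw [← CoxeterMatrix.toCoxeterSystem_simple]
  exact M.toCoxeterSystem.lift_apply_simple hP.perm_mul_pow s

theorem coxeterAct_of_squareFree (hP : IsArtinMonoid M σ ℓ rev) (l : List B)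
    (hl : SquareFree σ (l.map σ).prod) :
    hP.coxeterAct (l.map M.simple).prod ⟨1, hP.squareFree_one⟩ = ⟨_, hl⟩ := by
  induction l with
  | nil => rw [List.map_nil, List.prod_nil, map_one]; rfl
  | cons s l ih =>
    rw [List.map_cons, List.prod_cons] at hl
    rw [List.map_cons, List.prod_cons, map_mul, Equiv.Perm.mul_apply, ih hl.of_mul_left,
      coxeterAct_simple]
    exact hP.act_of_not_dvd hl.not_dvd

theorem length_coxeterAct_le (hP : IsArtinMonoid M σ ℓ rev) (l : List B) :
    ℓ (hP.coxeterAct (l.map M.simple).prod ⟨1, hP.squareFree_one⟩).1 ≤ l.length := by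
  induction l with
  | nil => rw [List.map_nil, List.prod_nil, map_one]; exact hP.length_one.le
  | cons s l ih =>
    rw [List.map_cons, List.prod_cons, map_mul, Equiv.Perm.mul_apply, coxeterAct_simple,
      List.length_cons]
    generalize hP.coxeterAct (l.map M.simple).prod ⟨1, hP.squareFree_one⟩ = c at *
    obtain ⟨c, hc⟩ := c
    change ℓ (hP.act s ⟨c, hc⟩).1 ≤ _
    by_cases h : σ s ∣ c
    · obtain ⟨d, rfl⟩ := h
      rw [hP.act_gen_mul]
      rw [hP.length_mul, hP.length_gen] at ih
      exact (by omega : ℓ d ≤ l.length + 1)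
    · rw [hP.act_of_not_dvd (c := ⟨c, hc⟩) h, hP.length_mul, hP.length_gen, add_comm]
      exact Nat.succ_le_succ ih

/-- Words representing a square-free element are reduced in the Coxeter group. -/
theorem length_le_of_squareFree (hP : IsArtinMonoid M σ ℓ rev) {l l' : List B}
    (hl : SquareFree σ (l.map σ).prod) (h : (l.map M.simple).prod = (l'.map M.simple).prod) :
    l.length ≤ l'.length := by
  have := hP.length_coxeterAct_le l'
  rwa [← h, hP.coxeterAct_of_squareFree l hl, hP.length_prod] at this

end IsArtinMonoid

end Action

section Head

theorem antihom_altProd {B N N' : Type*} [Monoid N] [Monoid N'] {f : B → N} {f' : B → N'}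
    {rev : N → N'} (h1 : rev 1 = 1) (hmul : ∀ a b, rev (a * b) = rev b * rev a)
    (hgen : ∀ s, rev (f s) = f' s) {x y : B} {n : ℕ}
    (hb : altProd (f' x) (f' y) n = altProd (f' y) (f' x) n) :
    rev (altProd (f x) (f y) n) = altProd (f' x) (f' y) n := by
  have key : ∀ n : ℕ, rev (altProd (f x) (f y) n) =
      altProd (f' (letter x y ((n : ℤ) + 1))) (f' (letter x y n)) n := by
    intro n
    induction n with
    | zero => exact h1
    | succ n ih =>
      rw [altProd_succ_right, hmul, ih, hgen, Nat.cast_succ, letter_succ x y (n + 1),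
        letter_succ y x n, altProd]
  rw [key]
  rcases Int.emod_two_eq_zero_or_one n with h | h
  · rw [hb, letter_succ, letter, letter, if_pos h, if_pos h]
  · rw [letter_succ, letter, letter, if_neg (by omega), if_neg (by omega)]

theorem gen_dvd_altProd {B P : Type*} [Monoid P] (σ : B → P) (s t : B) {n : ℕ} (hn : n ≠ 0) :
    σ s ∣ altProd (σ s) (σ t) n := by
  obtain ⟨k, rfl⟩ := Nat.exists_eq_succ_of_ne_zero hn
  exact ⟨_, rfl⟩

/-- The greatest square-free left divisor. -/
structure IsHead {B P : Type*} [Monoid P] (σ : B → P) (α y : P) : Prop where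
  squareFree : SquareFree σ α
  dvd : α ∣ y
  greatest : ∀ c, SquareFree σ c → c ∣ y → c ∣ α

variable {B : Type*} {M : CoxeterMatrix B} {P : Type*} [Monoid P] [IsCancelMul P]
  {σ : B → P} {ℓ : P → ℕ} {rev : P → P}

theorem dvd_of_mul_dvd_mul_left {a b c : P} (h : a * b ∣ a * c) : b ∣ c := by
  obtain ⟨d, hd⟩ := h
  exact ⟨d, mul_left_cancel (a := a) (by rw [hd, mul_assoc])⟩

namespace IsArtinMonoid

theorem rev_one (hP : IsArtinMonoid M σ ℓ rev) : rev 1 = 1 := by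
  have := hP.rev_mul 1 1
  rw [mul_one] at this
  exact (mul_left_cancel (this.symm.trans (mul_one _).symm))

theorem rev_rev (hP : IsArtinMonoid M σ ℓ rev) (g : P) : rev (rev g) = g := by
  induction hn : ℓ g generalizing g with
  | zero => rw [hP.eq_one_of_length hn, hP.rev_one, hP.rev_one]
  | succ n ih =>
    obtain rfl | ⟨s, h, rfl⟩ := hP.eq_one_or g
    · rw [hP.rev_one, hP.rev_one]
    · rw [hP.length_mul, hP.length_gen] at hn
      rw [hP.rev_mul, hP.rev_mul, hP.rev_gen, hP.rev_gen, ih h (by omega)]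

theorem squareFree_rev (hP : IsArtinMonoid M σ ℓ rev) {g : P} (h : SquareFree σ g) :
    SquareFree σ (rev g) := by
  intro a x b e
  refine h (rev b) x (rev a) ?_
  rw [← hP.rev_rev g, e]
  simp only [hP.rev_mul, hP.rev_gen, mul_assoc]

theorem not_dvd_rev (hP : IsArtinMonoid M σ ℓ rev) {u : P} {s : B}
    (h : SquareFree σ (u * σ s)) : ¬ σ s ∣ rev u := by
  rintro ⟨d, hd⟩
  refine h (rev d) s 1 ?_
  rw [← hP.rev_rev u, hd, hP.rev_mul, hP.rev_gen, mul_one, mul_assoc]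

theorem squareFree_mul_altProd (hP : IsArtinMonoid M σ ℓ rev) {u : P} {s t : B} (hst : s ≠ t)
    (h0 : M s t ≠ 0) (hs : SquareFree σ (u * σ s)) (ht : SquareFree σ (u * σ t)) :
    SquareFree σ (u * altProd (σ s) (σ t) (M s t)) := by
  have := hP.squareFree_rev (hP.squareFree_altProd_mul (hP.squareFree_rev hs.of_mul_right) hst
    (hP.not_dvd_rev hs) (hP.not_dvd_rev ht) (Or.inr le_rfl))
  rwa [hP.rev_mul, hP.rev_rev,
    antihom_altProd hP.rev_one hP.rev_mul hP.rev_gen (hP.braid s t hst h0)] at this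

/-- Square-free divisors of an element form a directed set. -/
theorem exists_squareFree_upper (hP : IsArtinMonoid M σ ℓ rev) {y : P} (n : ℕ) {u v v' : P}
    (hn : ℓ y ≤ ℓ u + n) (hv : SquareFree σ v) (hv' : SquareFree σ v') (huv : u ∣ v)
    (huv' : u ∣ v') (hvy : v ∣ y) (hvy' : v' ∣ y) :
    ∃ w, SquareFree σ w ∧ v ∣ w ∧ v' ∣ w ∧ w ∣ y := by
  induction n generalizing u v v' with
  | zero =>
    have h1 := hP.length_le_of_dvd hvy
    obtain ⟨a, rfl⟩ := huv
    rw [hP.length_mul] at h1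
    obtain rfl := hP.eq_one_of_length (g := a) (by omega)
    rw [mul_one] at *
    exact ⟨v', hv', huv', dvd_rfl, hvy'⟩
  | succ n ih =>
    obtain ⟨a, rfl⟩ := huv
    obtain ⟨b, rfl⟩ := huv'
    obtain rfl | ⟨s, a, rfl⟩ := hP.eq_one_or a
    · exact ⟨u * b, hv', by rw [mul_one]; exact dvd_mul_right _ _, dvd_rfl, hvy'⟩
    obtain rfl | ⟨t, b, rfl⟩ := hP.eq_one_or b
    · exact ⟨_, hv, dvd_rfl, by rw [mul_one]; exact dvd_mul_right _ _, hvy⟩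
    have hlen : ∀ x, ℓ y ≤ ℓ (u * σ x) + n := fun x => by
      rw [hP.length_mul, hP.length_gen]; omega
    have hdvd : ∀ x c, u * σ x ∣ u * (σ x * c) := fun x c => ⟨c, (mul_assoc _ _ _).symm⟩
    by_cases hst : s = t
    · subst hst
      exact ih (hlen s) hv hv' (hdvd s a) (hdvd s b) hvy hvy'
    obtain ⟨c, hc⟩ := hvy
    obtain ⟨d, hd⟩ := hvy'
    have e : σ s * (a * c) = σ t * (b * d) := by
      refine mul_left_cancel (a := u) ?_
      rw [← mul_assoc (σ s), ← mul_assoc u, ← hc, hd]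
      simp only [mul_assoc]
    obtain ⟨h0, k, hk⟩ := hP.lcm s t _ _ hst e
    have hz := hP.squareFree_mul_altProd hst h0 (hv.of_dvd (hdvd s a)) (hv'.of_dvd (hdvd t b))
    have hsz : u * σ s ∣ u * altProd (σ s) (σ t) (M s t) :=
      mul_dvd_mul_left u (gen_dvd_altProd σ s t h0)
    have htz : u * σ t ∣ u * altProd (σ s) (σ t) (M s t) := by
      rw [hP.braid s t hst h0]
      exact mul_dvd_mul_left u (gen_dvd_altProd σ t s h0)
    have hzy : u * altProd (σ s) (σ t) (M s t) ∣ y :=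
      ⟨k, by rw [hc, mul_assoc, mul_assoc, mul_assoc, hk]⟩
    obtain ⟨w, hw, hw1, hw2, hw3⟩ := ih (hlen s) hv hz (hdvd s a) hsz ⟨c, hc⟩ hzy
    obtain ⟨w', hw', hw1', hw2', hw3'⟩ := ih (hlen t) hv' hz (hdvd t b) htz ⟨d, hd⟩ hzy
    obtain ⟨x, hx, hx1, hx2, hx3⟩ :=
      ih (hlen s) hw hw' (hsz.trans hw2) (hsz.trans hw2') hw3 hw3'
    exact ⟨x, hx, hw1.trans hx1, hw1'.trans hx2, hx3⟩

theorem exists_isHead (hP : IsArtinMonoid M σ ℓ rev) (y : P) : ∃ α, IsHead σ α y := by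
  obtain ⟨α, ⟨h1, h2⟩, h3⟩ := (measure fun a => ℓ y - ℓ a).wf.has_min
    {a | SquareFree σ a ∧ a ∣ y} ⟨1, hP.squareFree_one, one_dvd y⟩
  refine ⟨α, h1, h2, fun c hc hcy => ?_⟩
  obtain ⟨w, hw, ⟨k, rfl⟩, hcw, hwy⟩ := hP.exists_squareFree_upper (ℓ y) (u := 1) (by omega) h1 hc
    (one_dvd _) (one_dvd _) h2 hcy
  have hle := hP.length_le_of_dvd hwy
  have := h3 (α * k) ⟨hw, hwy⟩
  change ¬ (ℓ y - ℓ (α * k) < ℓ y - ℓ α) at this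
  rw [hP.length_mul] at this hle
  rwa [hP.eq_one_of_length (g := k) (by omega), mul_one] at hcw

theorem isHead_gen_mul (hP : IsArtinMonoid M σ ℓ rev) {t : B} {α g : P} (hα : IsHead σ α g)
    (ht : ¬ σ t ∣ α) : IsHead σ (σ t * α) (σ t * g) := by
  have h := hP.squareFree_gen_mul hα.squareFree ht
  have hd := mul_dvd_mul_left (σ t) hα.dvd
  refine ⟨h, hd, fun c hc hcg => ?_⟩
  obtain ⟨β, hβ⟩ := hP.exists_isHead (σ t * g)
  obtain ⟨b, hb⟩ := (dvd_mul_right (σ t) α).trans (hβ.greatest _ h hd)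
  refine (hβ.greatest c hc hcg).trans ?_
  rw [hb]
  exact mul_dvd_mul_left _ (hα.greatest b (hb ▸ hβ.squareFree).of_mul_left
    (dvd_of_mul_dvd_mul_left (hb ▸ hβ.dvd)))

/-- The head of an element conjugating two generators conjugates generators. -/
theorem exists_head_conj (hP : IsArtinMonoid M σ ℓ rev) {s t : B} {g α : P} (hα : IsHead σ α g)
    (h : σ t * g = g * σ s) : ∃ s', σ t * α = α * σ s' := by
  induction hn : ℓ g using Nat.strong_induction_on generalizing g α with
  | _ n ih =>
    by_cases ht : σ t ∣ α
    · obtain ⟨g, rfl⟩ := ht.trans hα.dvd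
      have h' : σ t * g = g * σ s := mul_left_cancel (h.trans (mul_assoc _ _ _))
      obtain ⟨η, hη⟩ := hP.exists_isHead g
      obtain ⟨s', hs'⟩ := ih (ℓ g) (by rw [← hn, hP.length_mul, hP.length_gen]; omega) hη h' rfl
      by_cases htη : σ t ∣ η
      · obtain ⟨x, rfl⟩ := hα.greatest η hη.squareFree (h' ▸ hη.dvd.mul_right _)
        obtain ⟨e, he⟩ := ht
        have h1 : η * x ∣ σ t * η := by
          rw [he]
          exact mul_dvd_mul_left _ (hη.greatest e (he ▸ hα.squareFree).of_mul_left
            (dvd_of_mul_dvd_mul_left (he ▸ hα.dvd)))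
        rw [hs'] at h1
        have h2 := hP.length_le_of_dvd (dvd_of_mul_dvd_mul_left h1)
        obtain ⟨y, hy⟩ := dvd_of_mul_dvd_mul_left h1
        obtain rfl | ⟨z, k, rfl⟩ := hP.eq_one_or x
        · exact ⟨s', by rw [mul_one, hs']⟩
        · have h3 := congrArg ℓ hy
          simp only [hP.length_mul, hP.length_gen] at h3
          rw [hP.eq_one_of_length (g := y) (by omega), mul_one] at hy
          refine absurd htη (SquareFree.not_dvd (σ := σ) ?_)
          rw [hs', hy]
          exact hα.squareFree
      · have h1 := hP.isHead_gen_mul hη htη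
        rw [hP.dvd_antisymm (h1.greatest α hα.squareFree hα.dvd)
          (hα.greatest _ h1.squareFree h1.dvd)]
        exact ⟨s', by rw [mul_assoc, hs']⟩
    · obtain ⟨x, hx⟩ := (hP.isHead_gen_mul hα ht).greatest α hα.squareFree
        (h ▸ hα.dvd.mul_right _)
      have := congrArg ℓ hx
      rw [hP.length_mul, hP.length_mul, hP.length_gen] at this
      obtain ⟨s', rfl⟩ := hP.eq_gen_of_length (g := x) (by omega)
      exact ⟨s', hx⟩

end IsArtinMonoid
end Head

section PositiveMonoid

variable {B : Type*} (M : CoxeterMatrix B)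

theorem word_mem_posMon (l : List B) : word M l ∈ posMon M := by
  refine Submonoid.list_prod_mem _ fun x hx => ?_
  obtain ⟨s, _, rfl⟩ := List.mem_map.1 hx
  exact Submonoid.subset_closure ⟨s, rfl⟩

variable {M} in
theorem exists_word_of_mem_posMon {g : Artin M} (hg : g ∈ posMon M) : ∃ l, word M l = g := by
  induction hg using Submonoid.closure_induction with
  | mem x hx =>
    obtain ⟨s, rfl⟩ := hx
    exact ⟨[s], by rw [word_cons, word_nil, mul_one]⟩
  | one => exact ⟨[], rfl⟩
  | mul x y _ _ hx hy =>
    obtain ⟨l, rfl⟩ := hx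
    obtain ⟨l', rfl⟩ := hy
    exact ⟨l ++ l', word_append l l'⟩

/-- The element of the positive monoid represented by a word. -/
def posWord (l : List B) : posMon M := ⟨word M l, word_mem_posMon M l⟩

/-- The generators of the positive monoid. -/
def posGen (s : B) : posMon M := ⟨gen M s, Submonoid.subset_closure ⟨s, rfl⟩⟩

variable {M}

theorem exists_posWord (g : posMon M) : ∃ l, posWord M l = g := by
  obtain ⟨l, hl⟩ := exists_word_of_mem_posMon g.2
  exact ⟨l, Subtype.ext hl⟩

theorem posWord_eq_iff {l l' : List B} : posWord M l = posWord M l' ↔ word M l = word M l' :=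
  Subtype.ext_iff

theorem posWord_append (l l' : List B) : posWord M (l ++ l') = posWord M l * posWord M l' :=
  Subtype.ext (word_append l l')

theorem posWord_cons (s : B) (l : List B) : posWord M (s :: l) = posGen M s * posWord M l := rfl

theorem posWord_eq_prod (l : List B) : posWord M l = (l.map (posGen M)).prod := by
  induction l with
  | nil => rfl
  | cons s l ih => rw [posWord_cons, ih, List.map_cons, List.prod_cons]

theorem unop_prod_map_op (l : List B) :
    (l.map fun s => MulOpposite.op (gen M s)).prod.unop = word M l.reverse := by
  induction l with
  | nil => rfl
  | cons s l ih =>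
    rw [List.map_cons, List.prod_cons, MulOpposite.unop_mul, ih, List.reverse_cons, word_append,
      word_cons, word_nil, mul_one, MulOpposite.unop_op]

theorem word_reverse_eq_of_word_eq {l l' : List B} (h : word M l = word M l') :
    word M l.reverse = word M l'.reverse := by
  rw [← unop_prod_map_op, ← unop_prod_map_op]
  refine congrArg _ (prod_map_eq_of_word_eq _ (fun _ => Group.isUnit _) (fun s t hst h0 => ?_) h)
  have key : ∀ x y n, altProd (gen M x) (gen M y) n = altProd (gen M y) (gen M x) n →
      (altProd (MulOpposite.op (gen M x)) (MulOpposite.op (gen M y)) n).unop =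
        altProd (gen M x) (gen M y) n := fun x y n hb =>
    antihom_altProd (f := fun s => MulOpposite.op (gen M s)) (rev := MulOpposite.unop) rfl
      (fun _ _ => rfl) (fun _ => rfl) hb
  apply MulOpposite.unop_injective
  rw [key _ _ _ (braid_gen hst h0), key _ _ _ (braid_gen hst h0).symm, braid_gen hst h0]

/-- The length morphism of the positive monoid. -/
noncomputable def posLen (g : posMon M) : ℕ := (exists_posWord g).choose.length

/-- The reversal of the positive monoid. -/
noncomputable def posRev (g : posMon M) : posMon M := posWord M (exists_posWord g).choose.reverse

theorem posLen_posWord (l : List B) : posLen (posWord M l) = l.length :=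
  length_eq_of_word_eq (posWord_eq_iff.1 (exists_posWord (posWord M l)).choose_spec)

theorem posRev_posWord (l : List B) : posRev (posWord M l) = posWord M l.reverse :=
  posWord_eq_iff.2 (word_reverse_eq_of_word_eq
    (posWord_eq_iff.1 (exists_posWord (posWord M l)).choose_spec))

theorem posGen_eq_posWord (s : B) : posGen M s = posWord M [s] :=
  (mul_one (posGen M s)).symm

theorem altProd_posGen (s t : B) (n : ℕ) :
    altProd (posGen M s) (posGen M t) n = posWord M (altList s t n) := by
  rw [posWord_eq_prod, prod_map_altList]

theorem isArtinMonoid_posMon [Finite B] :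
    IsArtinMonoid M (posGen M) posLen posRev where
  length_mul a b := by
    obtain ⟨l, rfl⟩ := exists_posWord a
    obtain ⟨l', rfl⟩ := exists_posWord b
    rw [← posWord_append, posLen_posWord, posLen_posWord, posLen_posWord, List.length_append]
  length_gen s := by rw [posGen_eq_posWord, posLen_posWord, List.length_singleton]
  eq_one_or g := by
    obtain ⟨_ | ⟨s, l⟩, rfl⟩ := exists_posWord g
    · exact Or.inl rfl
    · exact Or.inr ⟨s, posWord M l, rfl⟩
  braid s t hst h0 := by
    rw [altProd_posGen, altProd_posGen, posWord_eq_iff, word, word, prod_map_altList,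
      prod_map_altList]
    exact braid_gen hst h0
  lcm s t a b hst h := by
    have := Fintype.ofFinite B
    obtain ⟨l, rfl⟩ := exists_posWord a
    obtain ⟨l', rfl⟩ := exists_posWord b
    rw [← posWord_cons, ← posWord_cons, posWord_eq_iff] at h
    obtain ⟨h0, k, hk⟩ := exists_lcm_word hst h
    refine ⟨h0, posWord M k, ?_⟩
    rwa [altProd_posGen, ← posWord_append, ← posWord_cons, posWord_eq_iff]
  rev_mul a b := by
    obtain ⟨l, rfl⟩ := exists_posWord a
    obtain ⟨l', rfl⟩ := exists_posWord b
    rw [← posWord_append, posRev_posWord, posRev_posWord, posRev_posWord, ← posWord_append,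
      List.reverse_append]
  rev_gen s := by rw [posGen_eq_posWord, posRev_posWord, List.reverse_singleton]

theorem proj_word (l : List B) : proj M (word M l) = (l.map M.simple).prod := by
  rw [word, map_list_prod, List.map_map]
  refine congrArg List.prod (List.map_congr_left fun s _ => ?_)
  exact PresentedGroup.toGroup.of (braid_lift M)

theorem len_word (l : List B) : len M (word M l) = l.length :=
  (Nat.sInf_mem (s := {n | ∃ l' : List B, l'.length = n ∧ (l'.map (gen M)).prod = word M l})
    ⟨_, l, rfl, rfl⟩).elim fun _ h => h.1.symm.trans (length_eq_of_word_eq h.2)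

theorem wlen_le (l : List B) : wlen M (l.map M.simple).prod ≤ l.length :=
  Nat.sInf_le ⟨l, rfl, rfl⟩

theorem red_iff_squareFree [Finite B] (g : posMon M) :
    Red M g ↔ SquareFree (posGen M) g := by
  obtain ⟨l, rfl⟩ := exists_posWord g
  change word M l ∈ posMon M ∧ len M (word M l) = wlen M (proj M (word M l)) ↔ _
  rw [and_iff_right (word_mem_posMon M l), len_word]
  constructor
  · intro h a x b e
    obtain ⟨p, rfl⟩ := exists_posWord a
    obtain ⟨q, rfl⟩ := exists_posWord b
    rw [← posWord_cons, ← posWord_cons, ← posWord_append, posWord_eq_iff] at e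
    have h1 := length_eq_of_word_eq e
    have h2 := wlen_le (M := M) (p ++ q)
    have h3 : ((p ++ x :: x :: q).map M.simple).prod = ((p ++ q).map M.simple).prod := by
      simp only [List.map_append, List.map_cons, List.prod_append, List.prod_cons]
      rw [← mul_assoc (M.simple x), ← CoxeterMatrix.toCoxeterSystem_simple,
        CoxeterSystem.simple_mul_simple_self, one_mul]
    rw [← h3, ← proj_word, ← e, ← h, h1, List.length_append, List.length_append,
      List.length_cons, List.length_cons] at h2
    omega
  · intro h
    obtain ⟨l', h1, h2⟩ := Nat.sInf_mem
      (s := {n | ∃ l' : List B, l'.length = n ∧ (l'.map M.simple).prod = proj M (word M l)})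
      ⟨_, l, rfl, (proj_word l).symm⟩
    rw [posWord_eq_prod] at h
    refine le_antisymm ?_ ?_
    · rw [proj_word] at h2
      exact (isArtinMonoid_posMon.length_le_of_squareFree h h2.symm).trans h1.le
    · rw [proj_word]
      exact wlen_le l

theorem ldvd_iff_dvd (a b : posMon M) : ldvd M a b ↔ a ∣ b := by
  constructor
  · rintro ⟨c, hc, h⟩
    exact ⟨⟨c, hc⟩, Subtype.ext h.symm⟩
  · rintro ⟨c, rfl⟩
    exact ⟨c, c.2, rfl⟩

/-- The greatest reduced divisor of an element conjugating two generators conjugates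
generators. -/
theorem exists_red_conj [Finite B] {s t : B} {a b : Artin M} (ha : Red M a) (hb : b ∈ posMon M)
    (hgreat : ∀ c, Red M c → ldvd M c (a * b) → ldvd M c a)
    (h : a * b * gen M s = gen M t * (a * b)) : ∃ s', a * gen M s' = gen M t * a := by
  lift a to posMon M using ha.1
  lift b to posMon M using hb
  rw [red_iff_squareFree] at ha
  have hα : IsHead (posGen M) a (a * b) := by
    refine ⟨ha, dvd_mul_right a b, fun c hc hd => ?_⟩
    rw [← ldvd_iff_dvd] at hd ⊢
    exact hgreat c ((red_iff_squareFree c).2 hc) hd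
  obtain ⟨s', hs'⟩ := isArtinMonoid_posMon.exists_head_conj hα
    (s := s) (t := t) (Subtype.ext h.symm)
  exact ⟨s', (congrArg Subtype.val hs').symm⟩

theorem exists_conj_sequence [Finite B] {s t : B} (L : List (Artin M))
    (hred : ∀ a ∈ L, Red M a) (hgreat : ∀ i : Fin L.length, ∀ c : Artin M, Red M c →
      ldvd M c ((L.drop (i : ℕ)).prod) → ldvd M c (L.get i))
    (hconj : L.prod * gen M s = gen M t * L.prod) :
    ∃ f : Fin (L.length + 1) → B, f 0 = t ∧ f (Fin.last L.length) = s ∧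
      ∀ i : Fin L.length, L.get i * gen M (f i.succ) = gen M (f i.castSucc) * L.get i := by
  induction L generalizing t with
  | nil =>
    rw [List.prod_nil, one_mul, mul_one] at hconj
    have : s = t := isArtinMonoid_posMon.gen_injective (M := M) (Subtype.ext hconj)
    exact ⟨fun _ => t, rfl, this.symm, fun i => i.elim0⟩
  | cons a L ih =>
    have hmem : L.prod ∈ posMon M :=
      Submonoid.list_prod_mem _ fun x hx => (hred x (List.mem_cons_of_mem a hx)).1
    rw [List.prod_cons] at hconj
    obtain ⟨s', hs'⟩ := exists_red_conj (hred a List.mem_cons_self) hmem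
      (fun c hc h => hgreat 0 c hc (by simpa using h)) hconj
    have htail : L.prod * gen M s = gen M s' * L.prod := by
      rw [← mul_assoc (gen M t), ← hs', mul_assoc, mul_assoc] at hconj
      exact mul_left_cancel hconj
    obtain ⟨f, h0, h1, h2⟩ := ih (fun x hx => hred x (List.mem_cons_of_mem a hx))
      (fun i c hc h => hgreat i.succ c hc h) htail
    refine ⟨Fin.cons t f, rfl, h1, fun i => ?_⟩
    refine Fin.cases ?_ (fun i => ?_) i
    · change a * gen M (f 0) = gen M t * a
      rw [h0, hs']
    · exact h2 i

end PositiveMonoid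

/-- **Proposition (Godelle).** If `g = g₁⋯g_n` is the Adyan normal decomposition of a positive
element `g ≠ 1` and `gs = tg` with `s, t ∈ S`, then there is a sequence `s₀ = t, …, s_n = s`
in `S` with `g_i s_i = s_{i-1} g_i` for all `i`. -/
theorem adyan_decomposition_conj
    [Finite B] (M : CoxeterMatrix B) (s t : B) (g : Artin M)
    (hg : g ∈ posMon M) (hg1 : g ≠ 1)
    (L : List (Artin M)) (hL : L ≠ []) (hprod : L.prod = g)
    (hred : ∀ gi ∈ L, Red M gi ∧ gi ≠ 1)
    (hgreat : ∀ i : Fin L.length, ∀ c : Artin M, Red M c →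
      ldvd M c ((L.drop (i : ℕ)).prod) → ldvd M c (L.get i))
    (hconj : g * gen M s = gen M t * g) :
    ∃ f : Fin (L.length + 1) → B, f 0 = t ∧ f (Fin.last L.length) = s ∧
      ∀ i : Fin L.length,
        L.get i * gen M (f i.succ) = gen M (f i.castSucc) * L.get i := by
  exact exists_conj_sequence L (fun a ha => (hred a ha).1) hgreat (hprod.symm ▸ hconj)

end ArtinTitsPaper
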